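/- Let n be an odd prime and let H be a finitely generated subgroup of SL(n,ℤ) that is irreducible (acting on ℚ^n), not solvable-by-finite, and not an isometry group (there is no invertible Φ ∈ GL(n,ℚ) with h Φ hᵀ = Φ for all h ∈ H). Then the set Π(H) of primes p with φ_p(H) ≠ SL(n,ℤ/pℤ) is finite. -/

import Mathlib

open Matrix

/-- `SL n R` : the special linear group of `n × n` matrices over `R`. -/
abbrev SL (n : ℕ) (R : Type*) [CommRing R] := Matrix.SpecialLinearGroup (Fin n) R

/-- The reduction-mod-`p` homomorphism `φ_p : SL(n,ℤ) → SL(n,ℤ/pℤ)`. -/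
def redMod (n p : ℕ) : SL n ℤ →* SL n (ZMod p) :=
  Matrix.SpecialLinearGroup.map (Int.castRingHom (ZMod p))

/-- The rational matrix underlying an element of `SL(n,ℤ)`. -/
def matQ {n : ℕ} (g : SL n ℤ) : Matrix (Fin n) (Fin n) ℚ :=
  (g : Matrix (Fin n) (Fin n) ℤ).map ((↑) : ℤ → ℚ)

/-- A subgroup of `SL(n,ℤ)` is absolutely irreducible over `ℚ` if its elements generate the
full matrix algebra over `ℚ`. -/
def AbsIrredQ {n : ℕ} (H : Subgroup (SL n ℤ)) : Prop :=
  Algebra.adjoin ℚ (matQ '' (H : Set (SL n ℤ))) = ⊤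

/-- A subgroup of `SL(n, ℤ/pℤ)` is absolutely irreducible if its elements generate the
full matrix algebra over `ℤ/pℤ`. -/
def AbsIrredMod {n p : ℕ} (G : Subgroup (SL n (ZMod p))) : Prop :=
  Algebra.adjoin (ZMod p)
    ((fun g : SL n (ZMod p) => (g : Matrix (Fin n) (Fin n) (ZMod p))) '' (G : Set _)) = ⊤

/-- Irreducibility of the natural action of a subgroup of `SL(n,R)` on `R^n`. -/
def IrreducibleSub (R : Type*) [CommRing R] {n : ℕ} (G : Subgroup (SL n R)) : Prop :=
  ∀ W : Submodule R (Fin n → R),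
    (∀ g ∈ G, W.map (Matrix.toLin' (g : Matrix (Fin n) (Fin n) R)) ≤ W) → W = ⊥ ∨ W = ⊤

/-- Imprimitivity: a nontrivial direct-sum decomposition whose summands are permuted by `G`. -/
def ImprimitiveSub (R : Type*) [CommRing R] {n : ℕ} (G : Subgroup (SL n R)) : Prop :=
  ∃ m : ℕ, 2 ≤ m ∧ ∃ W : Fin m → Submodule R (Fin n → R),
    (∀ i, W i ≠ ⊥) ∧ DirectSum.IsInternal W ∧
    ∀ g ∈ G, ∀ i, ∃ j, (W i).map (Matrix.toLin' (g : Matrix (Fin n) (Fin n) R)) = W j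

/-- Primitivity: irreducible and not imprimitive. -/
def PrimitiveSub (R : Type*) [CommRing R] {n : ℕ} (G : Subgroup (SL n R)) : Prop :=
  IrreducibleSub R G ∧ ¬ ImprimitiveSub R G

/-- Monomiality: a direct sum of `n` one-dimensional subspaces permuted by `G`. -/
def MonomialSub (R : Type*) [CommRing R] {n : ℕ} (G : Subgroup (SL n R)) : Prop :=
  ∃ L : Fin n → Submodule R (Fin n → R),
    (∀ i, Module.finrank R (L i) = 1) ∧ DirectSum.IsInternal L ∧
    ∀ g ∈ G, ∀ i, ∃ j, (L i).map (Matrix.toLin' (g : Matrix (Fin n) (Fin n) R)) = L j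

/-- Irreducibility of a subgroup of `SL(n,ℤ)` acting on `ℚ^n`. -/
def IrreducibleQ {n : ℕ} (H : Subgroup (SL n ℤ)) : Prop :=
  ∀ W : Submodule ℚ (Fin n → ℚ),
    (∀ g ∈ H, W.map (Matrix.toLin' (matQ g)) ≤ W) → W = ⊥ ∨ W = ⊤

/-- Imprimitivity of a subgroup of `SL(n,ℤ)` acting on `ℚ^n`. -/
def ImprimitiveQ {n : ℕ} (H : Subgroup (SL n ℤ)) : Prop :=
  ∃ m : ℕ, 2 ≤ m ∧ ∃ W : Fin m → Submodule ℚ (Fin n → ℚ),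
    (∀ i, W i ≠ ⊥) ∧ DirectSum.IsInternal W ∧
    ∀ g ∈ H, ∀ i, ∃ j, (W i).map (Matrix.toLin' (matQ g)) = W j

/-- Primitivity of a subgroup of `SL(n,ℤ)` acting on `ℚ^n`. -/
def PrimitiveQ {n : ℕ} (H : Subgroup (SL n ℤ)) : Prop :=
  IrreducibleQ H ∧ ¬ ImprimitiveQ H

/-- A group is solvable-by-finite if it has a solvable subgroup of finite index. -/
def SolvableByFinite (G : Type*) [Group G] : Prop :=
  ∃ K : Subgroup G, IsSolvable K ∧ K.FiniteIndex

/-- A subgroup of `SL(n,ℤ)` is an isometry group if it preserves a nondegenerate bilinear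
form on `ℚ^n`. -/
def IsometryGroupQ {n : ℕ} (H : Subgroup (SL n ℤ)) : Prop :=
  ∃ Φ : Matrix (Fin n) (Fin n) ℚ, IsUnit Φ ∧ ∀ h ∈ H, matQ h * Φ * (matQ h)ᵀ = Φ

set_option linter.all false

section PieceLev
open Polynomial in
lemma levels_inj {J : Type*} [Fintype J] (n : ℕ) (hn : n.Prime) (hJ : Fintype.card J = n)
    (lv : J → ℕ) (hlv : ∀ j, lv j < n) {ι : Type*} (s : Finset ι) (h a : ι → ℕ)
    (hh : ∀ i ∈ s, 0 < h i ∧ h i < n)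
    (heq : (∑ j, (X : ℤ[X]) ^ lv j) * ∏ i ∈ s, (1 - X ^ h i) = ∏ i ∈ s, (1 - X ^ a i)) :
    Function.Injective lv := by
  have hgeo : ∀ m : ℕ, (1 - X ^ m : ℤ[X]) = (1 - X) * ∑ i ∈ Finset.range m, X ^ i := fun m => by
    rw [mul_comm]; exact (geom_sum_mul_neg X m).symm
  have h1 : (1 - X : ℤ[X]) ≠ 0 := by
    intro h0
    have := congrArg (fun p => eval 0 p) h0
    simp at this
  have hc : (∑ j, (X : ℤ[X]) ^ lv j) * ∏ i ∈ s, (∑ l ∈ Finset.range (h i), X ^ l)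
      = ∏ i ∈ s, (∑ l ∈ Finset.range (a i), X ^ l) := by
    simp_rw [hgeo, Finset.prod_mul_distrib, Finset.prod_const] at heq
    have : (1 - X : ℤ[X]) ^ s.card ≠ 0 := pow_ne_zero _ h1
    apply mul_left_cancel₀ this
    rw [← heq]; ring
  have he := congrArg (fun p => eval 1 p) hc
  simp [eval_prod, eval_finset_sum, eval_mul, hJ] at he
  have hdvd : (n : ℤ) ∣ ∏ i ∈ s, (a i : ℤ) := ⟨_, he.symm⟩
  obtain ⟨i, hi, hni⟩ := (Prime.dvd_finset_prod_iff (Nat.prime_iff_prime_int.mp hn) _).1 hdvd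
  have hni : n ∣ a i := by exact_mod_cast hni
  have hn0 : n ≠ 0 := hn.ne_zero
  have hz := Complex.isPrimitiveRoot_exp n hn0
  set z := Complex.exp (2 * Real.pi * Complex.I / n)
  have hev := congrArg (fun p => aeval z p) heq
  simp only [map_mul, map_prod, map_sub, map_one, map_pow, aeval_X, map_sum] at hev
  have hr : ∏ i ∈ s, (1 - z ^ a i) = 0 :=
    Finset.prod_eq_zero hi (by rw [(hz.pow_eq_one_iff_dvd _).2 hni, sub_self])
  rw [hr, mul_eq_zero] at hev
  have hl : ∏ i ∈ s, (1 - z ^ h i) ≠ 0 := by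
    refine Finset.prod_ne_zero_iff.2 fun i hi h0 => ?_
    have : n ∣ h i := (hz.pow_eq_one_iff_dvd _).1 (sub_eq_zero.1 h0).symm
    exact absurd (Nat.le_of_dvd (hh i hi).1 this) (not_le.2 (hh i hi).2)
  have hP : aeval z (∑ j, (X : ℤ[X]) ^ lv j) = 0 := by
    simpa using hev.resolve_right hl
  have hcy : cyclotomic n ℤ ∣ ∑ j, (X : ℤ[X]) ^ lv j := by
    rw [cyclotomic_eq_minpoly hz (Nat.pos_of_ne_zero hn0)]
    exact minpoly.isIntegrallyClosed_dvd (hz.isIntegral (Nat.pos_of_ne_zero hn0)) hP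
  obtain ⟨q, hq⟩ := hcy
  have hdegP : (∑ j, (X : ℤ[X]) ^ lv j).natDegree ≤ n - 1 := by
    refine natDegree_sum_le_of_forall_le _ _ fun j _ => ?_
    rw [natDegree_X_pow]; have := hlv j; omega
  have hev1 := congrArg (fun p => eval 1 p) hq
  have : Fact n.Prime := ⟨hn⟩
  simp [eval_finset_sum, hJ] at hev1
  have hq1 : eval 1 q = 1 := by
    have : (n : ℤ) ≠ 0 := by exact_mod_cast hn0
    exact mul_left_cancel₀ this (by rw [← hev1, mul_one])
  have hq0 : q ≠ 0 := by rintro rfl; simp at hq1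
  have hqd : q.natDegree = 0 := by
    rw [hq, natDegree_mul (cyclotomic_ne_zero n ℤ) hq0, natDegree_cyclotomic,
      Nat.totient_prime hn] at hdegP
    omega
  rw [eq_C_of_natDegree_eq_zero hqd] at hq hq1
  rw [eval_C] at hq1
  rw [hq1, map_one, mul_one, cyclotomic_prime] at hq
  intro j₁ j₂ h12
  by_contra hne
  have hcf := congrArg (fun p => coeff p (lv j₁)) hq
  simp only [finset_sum_coeff, coeff_X_pow] at hcf
  rw [Finset.sum_ite_eq, if_pos (Finset.mem_range.2 (hlv j₁))] at hcf
  classical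
  have h2 : (2 : ℤ) ≤ ∑ j, if lv j₁ = lv j then (1 : ℤ) else 0 := by
    calc (2 : ℤ) = ∑ j ∈ ({j₁, j₂} : Finset J), if lv j₁ = lv j then (1 : ℤ) else 0 := by
          rw [Finset.sum_pair hne]; simp [h12]
      _ ≤ _ := Finset.sum_le_sum_of_subset_of_nonneg (Finset.subset_univ _)
          (fun _ _ _ => by split_ifs <;> simp)
  omega
end PieceLev

section PieceWord
section WordLemma
variable {k I : Type*} [Field k] [CharZero k]

/-- mirror principle -/
lemma word_mirror {n : ℕ} {x : ℕ → I → k} {c : ℕ → I} {a : I → I → k}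
    (x0 : x 0 = 0) (xn : x n = 0)
    (hne : ∀ j, 1 ≤ j → j < n → x j (c j) ≠ 0)
    (hoff : ∀ j, 1 ≤ j → j < n → ∀ i, i ≠ c j → x j i = 0)
    (hrec : ∀ j, j + 1 < n → ∀ i, x (j + 2) i + x j i = 2 * x (j + 1) i - a (c (j + 1)) i)
    (p q : ℕ) (hpq : p ≤ q) (hp : 1 ≤ p) (hq : q < n) (h0 : x p = x q)
    (h1 : x (p - 1) = x (q + 1)) :
    ∀ j, j ≤ n → x j = x (n - j) := by
  have hcol : ∀ i j, 1 ≤ i → i < n → 1 ≤ j → j < n → x i = x j → c i = c j := by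
    intro i j hi hi' hj hj' h
    by_contra hc
    exact hne i hi hi' (by rw [h]; exact hoff j hj hj' _ hc)
  have hnz : ∀ j, 1 ≤ j → j < n → x j ≠ 0 := fun j h1 h2 h => hne j h1 h2 (by rw [h]; rfl)
  -- outward propagation
  have out : ∀ t, t ≤ p → q + t ≤ n → x (p - t) = x (q + t) ∧
      (t + 1 ≤ p → q + t + 1 ≤ n → x (p - (t + 1)) = x (q + (t + 1))) := by
    intro t
    induction t with
    | zero => intro _ _; exact ⟨h0, fun _ _ => h1⟩
    | succ t ih =>
      intro ht1 ht2
      obtain ⟨i1, i2⟩ := ih (by omega) (by omega)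
      have i3 := i2 ht1 (by omega)
      refine ⟨i3, fun h3 h4 => ?_⟩
      funext i
      have r1 := hrec (p - (t + 2)) (by omega) i
      have r2 := hrec (q + t) (by omega) i
      have e1 : p - (t + 2) + 2 = p - t := by omega
      have e2 : p - (t + 2) + 1 = p - (t + 1) := by omega
      rw [e1, e2] at r1
      have hc : c (p - (t + 1)) = c (q + (t + 1)) :=
        hcol _ _ (by omega) (by omega) (by omega) (by omega) i3
      have e3 := congrFun i1 i
      have e4 := congrFun i3 i
      rw [hc] at r1
      have g1 : p - (t + 1 + 1) = p - (t + 2) := by omega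
      have g2 : q + (t + 1 + 1) = q + t + 2 := by omega
      have g3 : q + (t + 1) = q + t + 1 := by omega
      rw [g1, g2]
      rw [g3] at e4 r1
      linear_combination r1 - r2 - e3 + 2 * e4
  have hs : p + q = n := by
    rcases lt_trichotomy (p + q) n with h | h | h
    · have := (out p le_rfl (by omega)).1
      rw [Nat.sub_self, x0] at this
      exact absurd this.symm (hnz _ (by omega) (by omega))
    · exact h
    · have := (out (n - q) (by omega) (by omega)).1
      rw [show q + (n - q) = n by omega, xn] at this
      exact absurd this (hnz _ (by omega) (by omega))
  -- inward propagation
  have inw : ∀ j, p - 1 ≤ j → j ≤ q + 1 → x j = x (n - j) := by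
    have key : ∀ t, p - 1 + t ≤ q + 1 → x (p - 1 + t) = x (n - (p - 1 + t)) ∧
        (p + t ≤ q + 1 → x (p + t) = x (n - (p + t))) := by
      intro t
      induction t with
      | zero =>
        intro _
        refine ⟨?_, fun _ => ?_⟩
        · rw [show n - (p - 1 + 0) = q + 1 by omega]; exact h1
        · rw [show n - (p + 0) = q by omega]; exact h0
      | succ t ih =>
        intro ht
        obtain ⟨i1, i2⟩ := ih (by omega)
        have i3 := i2 (by omega)
        refine ⟨by rw [show p - 1 + (t + 1) = p + t by omega]; exact i3, fun h3 => ?_⟩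
        funext i
        have r1 := hrec (p - 1 + t) (by omega) i
        have r2 := hrec (n - (p + t) - 1) (by omega) i
        rw [show p - 1 + t + 2 = p + (t + 1) by omega, show p - 1 + t + 1 = p + t by omega] at r1
        rw [show n - (p + t) - 1 + 2 = n - (p - 1 + t) by omega,
          show n - (p + t) - 1 + 1 = n - (p + t) by omega,
          show n - (p + t) - 1 = n - (p + (t + 1)) by omega] at r2
        have hc : c (p + t) = c (n - (p + t)) :=
          hcol _ _ (by omega) (by omega) (by omega) (by omega) i3
        have e3 := congrFun i1 i
        have e4 := congrFun i3 i
        rw [hc] at r1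
        linear_combination r1 - r2 - e3 + 2 * e4
    intro j hj hj'
    have := (key (j - (p - 1)) (by omega)).1
    rwa [show p - 1 + (j - (p - 1)) = j by omega] at this
  intro j hj
  rcases le_total j (p - 1) with h | h
  · have := (out (p - j) (by omega) (by omega)).1
    rwa [show p - (p - j) = j by omega, show q + (p - j) = n - j by omega] at this
  · rcases le_total j (q + 1) with h' | h'
    · exact inw j h h'
    · have := (out (j - q) (by omega) (by omega)).1
      rw [show p - (j - q) = n - j by omega, show q + (j - q) = j by omega] at this
      exact this.symm

/-- word lemma -/
lemma word_lemma {n : ℕ} (hodd : Odd n) {x : ℕ → I → k} {c : ℕ → I} {a : I → I → k}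
    (x0 : x 0 = 0) (xn : x n = 0)
    (hne : ∀ j, 1 ≤ j → j < n → x j (c j) ≠ 0)
    (hoff : ∀ j, 1 ≤ j → j < n → ∀ i, i ≠ c j → x j i = 0)
    (ha : ∀ i, a i i = 2)
    (hrec : ∀ j, j + 1 < n → ∀ i, x (j + 2) i + x j i = 2 * x (j + 1) i - a (c (j + 1)) i) :
    (∀ i j, 1 ≤ i → i < n → 1 ≤ j → j < n → c i = c j → i = j) ∨
      ∀ j, j ≤ n → x j = x (n - j) := by
  classical
  by_cases hinj : ∀ i j, 1 ≤ i → i < n → 1 ≤ j → j < n → c i = c j → i = j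
  · exact Or.inl hinj
  right
  have mir := word_mirror x0 xn hne hoff hrec
  -- first repetition
  have hex : ∃ r, r < n ∧ ∃ j, 1 ≤ j ∧ j < r ∧ c r = c j := by
    push Not at hinj
    obtain ⟨i, j, h1, h2, h3, h4, h5, h6⟩ := hinj
    rcases lt_or_gt_of_ne h6 with h | h
    · exact ⟨j, h4, i, h1, h, h5.symm⟩
    · exact ⟨i, h2, j, h3, h, h5⟩
  set r := Nat.find hex with hr
  obtain ⟨hrn, j, hj1, hjr, hcj⟩ := Nat.find_spec hex
  rw [← hr] at hrn hjr hcj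
  have hmin : ∀ s t, 1 ≤ t → t < s → s < r → c s ≠ c t := by
    intro s t h1 h2 h3 h4
    exact Nat.find_min hex h3 ⟨by omega, t, h1, h2, h4⟩
  have hmin' : ∀ s t, 1 ≤ s → 1 ≤ t → s < r → t < r → s ≠ t → c s ≠ c t := by
    intro s t h1 h2 h3 h4 h5
    rcases lt_or_gt_of_ne h5 with h | h
    · exact (hmin t s h1 h h4).symm
    · exact hmin s t h2 h h3
  have hz : ∀ s t, t ≤ n → 1 ≤ s → (1 ≤ t → t < n → c t ≠ c s) → x t (c s) = 0 := by
    intro s t h1 h2 h3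
    rcases Nat.eq_zero_or_pos t with h | h
    · rw [h, x0]; rfl
    rcases Nat.lt_or_ge t n with h' | h'
    · exact hoff t h h' _ (h3 h h').symm
    · rw [show t = n by omega, xn]; rfl
  -- isolated positions
  have iso : ∀ s, 1 ≤ s → s < n → x (s - 1) (c s) = 0 → x (s + 1) (c s) = 0 → x s (c s) = 1 := by
    intro s h1 h2 h3 h4
    have := hrec (s - 1) (by omega) (c s)
    rw [show s - 1 + 2 = s + 1 by omega, show s - 1 + 1 = s by omega, h3, h4, ha] at this
    have h2' : (2 : k) * (x s (c s) - 1) = 0 := by linear_combination -this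
    have := (mul_eq_zero.1 h2').resolve_left two_ne_zero
    linear_combination this
  -- neighbour vector
  have nb : ∀ s t, 1 ≤ s → s < n → 1 ≤ t → t < n → c s = c t → ∀ i, i ≠ c s →
      x (s + 1) i + x (s - 1) i = x (t + 1) i + x (t - 1) i := by
    intro s t h1 h2 h3 h4 h5 i h6
    have r1 := hrec (s - 1) (by omega) i
    have r2 := hrec (t - 1) (by omega) i
    rw [show s - 1 + 2 = s + 1 by omega, show s - 1 + 1 = s by omega,
      hoff s h1 h2 i h6] at r1
    rw [show t - 1 + 2 = t + 1 by omega, show t - 1 + 1 = t by omega,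
      hoff t h3 h4 i (h5 ▸ h6), ← h5] at r2
    rw [r1, r2]
  -- colour from nonvanishing
  have colr : ∀ t i, t ≤ n → x t i ≠ 0 → 1 ≤ t ∧ t < n ∧ c t = i := by
    intro t i h1 h2
    rcases Nat.eq_zero_or_pos t with h | h
    · rw [h, x0] at h2; exact absurd rfl h2
    rcases Nat.lt_or_ge t n with h' | h'
    · refine ⟨h, h', ?_⟩
      by_contra h3
      exact h2 (hoff t h h' i (Ne.symm h3))
    · rw [show t = n by omega, xn] at h2; exact absurd rfl h2
  have ext' : ∀ s t, 1 ≤ s → s < n → 1 ≤ t → t < n → c s = c t → x s (c s) = x t (c t) →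
      x s = x t := by
    intro s t h1 h2 h3 h4 h5 h6
    funext i
    by_cases hi : i = c s
    · rw [hi, h6, h5]
    · rw [hoff s h1 h2 i hi, hoff t h3 h4 i (h5 ▸ hi)]
  -- run of length two
  have run2 : ∀ s, 1 ≤ s → s + 1 < n → c s = c (s + 1) → x (s - 1) (c s) = 0 →
      x (s + 2) (c s) = 0 → x s = x (s + 1) := by
    intro s h1 h2 h3 h4 h5
    apply ext' s (s + 1) h1 (by omega) (by omega) h2 h3
    have r1 := hrec (s - 1) (by omega) (c s)
    have r2 := hrec s (by omega) (c s)
    rw [show s - 1 + 2 = s + 1 by omega, show s - 1 + 1 = s by omega, h4, ha] at r1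
    rw [h5, ← h3, ha] at r2
    rw [← h3]
    have : (3 : k) * (x s (c s) - x (s + 1) (c s)) = 0 := by linear_combination r2 - r1
    have := (mul_eq_zero.1 this).resolve_left three_ne_zero
    linear_combination this
  by_cases hjr1 : j = r - 1
  · by_cases hr2 : r = 2
    · -- constant word
      have hj : j = 1 := by omega
      have h12 : c 2 = c 1 := by rw [← hj, ← hcj, hr2]
      have ha0 : ∀ i, i ≠ c 1 → x 2 i + x 0 i = 0 := fun i hi => by
        rw [hoff 2 (by omega) (by omega) i (h12 ▸ hi), x0]; simp
      have hconst' : ∀ t, ∀ s, 1 ≤ s → s ≤ t → s < n → c s = c 1 := by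
        intro t
        induction t with
        | zero => intro s h1 h2; omega
        | succ t ih =>
          intro s h1 h2 h3
          rcases Nat.lt_or_ge s (t + 1) with h | h
          · exact ih s h1 (by omega) h3
          have hs : s = t + 1 := by omega
          subst hs
          by_contra hc
          have t1 : 1 < t := by
            by_contra ht
            rcases Nat.eq_zero_or_pos t with h0 | h0
            · subst h0; exact hc rfl
            · have : t = 1 := by omega
              subst this; exact hc h12
          have i1 := ih t (by omega) le_rfl (by omega)
          have i2 := ih (t - 1) (by omega) (by omega) (by omega)
          have h3' := nb t 1 (by omega) (by omega) le_rfl (by omega) i1 (c (t + 1))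
            (by rw [i1]; exact hc)
          rw [ha0 _ hc, hoff (t - 1) (by omega) (by omega) _ (by rw [i2]; exact hc),
            add_zero] at h3'
          exact hne _ (by omega) h3 h3'
      have hconst : ∀ t, 1 ≤ t → t < n → c t = c 1 := fun t h1 h2 => hconst' t t h1 le_rfl h2
      have hform : ∀ t : ℕ, t < n → x t (c 1) = t * x 1 (c 1) - t * (t - 1) ∧
          x (t + 1) (c 1) = (t + 1 : ℕ) * x 1 (c 1) - (t + 1 : ℕ) * t := by
        intro t
        induction t with
        | zero => intro _; simp [x0]
        | succ t ih =>
          intro h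
          obtain ⟨h1, h2⟩ := ih (by omega)
          refine ⟨by rw [h2]; push_cast; ring, ?_⟩
          have := hrec t h (c 1)
          rw [hconst (t + 1) (by omega) h, ha] at this
          push_cast at h2 ⊢
          linear_combination this - h1 + 2 * h2
      have hn0 : (n : k) ≠ 0 := by
        have : n ≠ 0 := by omega
        exact_mod_cast this
      have hk1 : x 1 (c 1) = n - 1 := by
        have := (hform (n - 1) (by omega)).2
        rw [show n - 1 + 1 = n by omega, xn, Nat.cast_sub (by omega)] at this
        have h0 : (n : k) * (x 1 (c 1) - (n - 1)) = 0 := by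
          simp only [Pi.zero_apply, Nat.cast_one] at this
          linear_combination -this
        linear_combination (mul_eq_zero.1 h0).resolve_left hn0
      have hall : ∀ t, t ≤ n → x t (c 1) = t * (n - t) := by
        intro t ht
        rcases Nat.lt_or_ge t n with h | h
        · rw [(hform t h).1, hk1]; ring
        · rw [show t = n by omega, xn]; simp
      intro t ht
      funext i
      by_cases hi : i = c 1
      · rw [hi, hall t ht, hall (n - t) (by omega), Nat.cast_sub ht]; ring
      · have : ∀ s, s ≤ n → x s i = 0 := by
          intro s hs
          by_contra h0
          obtain ⟨h1, h2, h3⟩ := colr s i hs h0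
          exact hi (by rw [← h3, hconst s h1 h2])
        rw [this t ht, this _ (by omega)]
    · -- case (i)
      have hc1 : c r = c (r - 1) := by rw [hcj, hjr1]
      have hd : c (r - 2) ≠ c (r - 1) := hmin' _ _ (by omega) (by omega) (by omega) (by omega)
        (by omega)
      have k1 : x (r - 2) (c (r - 2)) = 1 := by
        apply iso _ (by omega) (by omega)
        · exact hz _ _ (by omega) (by omega) fun h1 _ => hmin' _ _ (by omega) (by omega) (by omega)
            (by omega) (by omega)
        · rw [show r - 2 + 1 = r - 1 by omega]
          exact hoff _ (by omega) (by omega) _ hd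
      have h2 := nb r (r - 1) (by omega) (by omega) (by omega) (by omega) hc1 (c (r - 2))
        (by rw [hc1]; exact hd)
      rw [show r - 1 + 1 = r by omega, show r - 1 - 1 = r - 2 by omega, k1,
        hoff r (by omega) hrn _ (by rw [hc1]; exact hd),
        hoff (r - 1) (by omega) (by omega) _ hd] at h2
      simp only [add_zero, zero_add] at h2
      obtain ⟨g1, g2, g3⟩ := colr (r + 1) (c (r - 2)) (by omega) (by rw [h2]; exact one_ne_zero)
      have hx : x (r - 1) = x r := by
        have := run2 (r - 1) (by omega) (by omega) (by rw [show r - 1 + 1 = r by omega, hc1])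
          (by rw [show r - 1 - 1 = r - 2 by omega]; exact hoff _ (by omega) (by omega) _ hd.symm)
          (by rw [show r - 1 + 2 = r + 1 by omega]
              exact hoff _ g1 g2 _ (by rw [g3]; exact hd.symm))
        rwa [show r - 1 + 1 = r by omega] at this
      refine mir (r - 1) r (by omega) (by omega) hrn hx ?_
      rw [show r - 1 - 1 = r - 2 by omega]
      exact ext' _ _ (by omega) (by omega) g1 g2 g3.symm (by rw [k1, g3, h2])
  · have hd : c (r - 1) ≠ c j := hmin' _ _ (by omega) (by omega) (by omega) (by omega) (by omega)
    have hd2 : c (r - 1) ≠ c (r - 2) := hmin' _ _ (by omega) (by omega) (by omega) (by omega)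
      (by omega)
    have k1 : x (r - 1) (c (r - 1)) = 1 := by
      apply iso _ (by omega) (by omega)
      · rw [show r - 1 - 1 = r - 2 by omega]
        exact hoff _ (by omega) (by omega) _ hd2
      · rw [show r - 1 + 1 = r by omega]
        exact hoff _ (by omega) (by omega) _ (by rw [hcj]; exact hd)
    by_cases hj2 : j = r - 2
    · have hcr : c r = c (r - 2) := by rw [hcj, hj2]
      by_cases hr3 : r = 3
      · have hj : j = 1 := by omega
        rw [hr3] at hcr k1 hrn hd2
        norm_num at hcr k1 hd2
        replace hd2 : c 2 ≠ c 1 := hd2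
        have k0 : x 1 (c 1) = 1 := by
          apply iso 1 le_rfl (by omega)
          · rw [x0]; rfl
          · exact hoff 2 (by omega) (by omega) _ hd2.symm
        have hx4 : ∀ i, i ≠ c 1 → x 4 i = 0 := by
          intro i hi
          have h2 := nb 3 1 (by omega) hrn (by omega) (by omega) hcr i (by rw [hcr]; exact hi)
          norm_num [x0] at h2
          exact h2
        rcases Nat.lt_or_ge 4 n with h4 | h4
        · have hc4 : c 4 = c 1 := by
            by_contra h
            exact hne 4 (by omega) h4 (hx4 _ h)
          have h5 := nb 4 1 (by omega) h4 (by omega) (by omega) hc4 (c 2) (by rw [hc4]; exact hd2)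
          norm_num [x0] at h5
          rw [k1, hoff 3 (by omega) hrn _ (by rw [hcr]; exact hd2), add_zero] at h5
          obtain ⟨g1, g2, g3⟩ := colr 5 (c 2) (by omega) (by rw [h5]; exact one_ne_zero)
          have hx := run2 3 (by omega) (by omega) (by rw [hcr, hc4])
            (hoff 2 (by omega) (by omega) _ (by rw [hcr]; exact hd2.symm))
            (hoff 5 g1 g2 _ (by rw [hcr, g3]; exact hd2.symm))
          refine mir 3 4 (by omega) (by omega) h4 hx ?_
          exact ext' _ _ (by omega) (by omega) g1 g2 g3.symm (by rw [g3, h5]; exact k1)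
        · have : n = 4 := by omega
          rw [this] at hodd
          exact absurd hodd (by decide)
      · have hb1 : c (r - 3) ≠ c (r - 2) := hmin' _ _ (by omega) (by omega) (by omega) (by omega)
          (by omega)
        have hb2 : c (r - 3) ≠ c (r - 1) := hmin' _ _ (by omega) (by omega) (by omega) (by omega)
          (by omega)
        have k3 : x (r - 3) (c (r - 3)) = 1 := by
          apply iso _ (by omega) (by omega)
          · exact hz _ _ (by omega) (by omega) fun h1 _ => hmin' _ _ (by omega) (by omega)
              (by omega) (by omega) (by omega)
          · rw [show r - 3 + 1 = r - 2 by omega]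
            exact hoff _ (by omega) (by omega) _ hb1
        have k2 : x (r - 2) (c (r - 2)) = 1 := by
          apply iso _ (by omega) (by omega)
          · rw [show r - 2 - 1 = r - 3 by omega]
            exact hoff _ (by omega) (by omega) _ hb1.symm
          · rw [show r - 2 + 1 = r - 1 by omega]
            exact hoff _ (by omega) (by omega) _ hd2.symm
        have h2 := nb r (r - 2) (by omega) (by omega) (by omega) (by omega) hcr (c (r - 3))
          (by rw [hcr]; exact hb1)
        rw [show r - 2 + 1 = r - 1 by omega, show r - 2 - 1 = r - 3 by omega, k3] at h2
        have h2' : x (r + 1) (c (r - 3)) = 1 := by linear_combination h2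
        obtain ⟨g1, g2, g3⟩ := colr (r + 1) (c (r - 3)) (by omega)
          (by rw [h2']; exact one_ne_zero)
        have kr : x r (c r) = 1 := by
          apply iso _ (by omega) (by omega)
          · exact hoff _ (by omega) (by omega) _ (by rw [hcr]; exact hd2.symm)
          · exact hoff _ g1 g2 _ (by rw [hcr, g3]; exact hb1.symm)
        refine mir (r - 2) r (by omega) (by omega) hrn
          (ext' _ _ (by omega) (by omega) (by omega) hrn hcr.symm (by rw [k2, kr])) ?_
        rw [show r - 2 - 1 = r - 3 by omega]
        exact ext' _ _ (by omega) (by omega) g1 g2 g3.symm (by rw [k3, g3, h2'])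
    · exfalso
      have h2 := nb r j (by omega) (by omega) (by omega) (by omega) hcj (c (r - 1))
        (by rw [hcj]; exact hd)
      have z1 : x (j + 1) (c (r - 1)) = 0 := hz _ _ (by omega) (by omega) fun h1 _ =>
        hmin' _ _ (by omega) (by omega) (by omega) (by omega) (by omega)
      have z2 : x (j - 1) (c (r - 1)) = 0 := hz _ _ (by omega) (by omega) fun h1 _ =>
        hmin' _ _ (by omega) (by omega) (by omega) (by omega) (by omega)
      rw [z1, z2, k1] at h2
      have h3 : x (r + 1) (c (r - 1)) = -1 := by linear_combination h2
      obtain ⟨g1, g2, g3⟩ := colr (r + 1) (c (r - 1)) (by omega) (by rw [h3]; simp)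
      have k2 : x (r - 2) (c (r - 2)) = 1 := by
        apply iso _ (by omega) (by omega)
        · exact hz _ _ (by omega) (by omega) fun h1 _ => hmin' _ _ (by omega) (by omega)
              (by omega) (by omega) (by omega)
        · rw [show r - 2 + 1 = r - 1 by omega]
          exact hoff _ (by omega) (by omega) _ hd2.symm
      have h4 := nb (r + 1) (r - 1) (by omega) g2 (by omega) (by omega) g3 (c (r - 2))
        (by rw [g3]; exact hd2.symm)
      have hcj2 : c (r - 2) ≠ c r := by
        rw [hcj]
        exact hmin' _ _ (by omega) (by omega) (by omega) (by omega) (by omega)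
      rw [show r + 1 - 1 = r by omega, show r - 1 + 1 = r by omega,
        show r - 1 - 1 = r - 2 by omega, k2, show r + 1 + 1 = r + 2 by omega] at h4
      have h5 : x (r + 2) (c (r - 2)) = 1 := by linear_combination h4
      obtain ⟨f1, f2, f3⟩ := colr (r + 2) (c (r - 2)) (by omega) (by rw [h5]; exact one_ne_zero)
      have := iso (r + 1) (by omega) g2
        (hoff _ (by omega) (by omega) _ (by rw [g3, show r + 1 - 1 = r by omega, hcj]; exact hd))
        (hoff _ f1 f2 _ (by rw [g3, show r + 1 + 1 = r + 2 by omega, f3]; exact hd2))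
      rw [g3, h3] at this
      have h6 : (2 : k) = 0 := by linear_combination -this
      exact two_ne_zero h6
end WordLemma
end PieceWord

section PieceWeyl
open Matrix

/-- Positive root data: a self-dual elementary packaging of a finite root system with base. -/
structure PRS (k M N ι : Type*) [Field k] [AddCommGroup M] [Module k M] [AddCommGroup N]
    [Module k N] where
  pr : M →ₗ[k] N →ₗ[k] k
  r : ι → M
  c : ι → N
  S : Finset ι
  σ : ι → Equiv.Perm ι
  two : ∀ i ∈ S, pr (r i) (c i) = 2
  σ_self : ∀ i ∈ S, σ i i = i
  σr : ∀ i ∈ S, ∀ t, t ≠ i → r (σ i t) = r t - pr (r t) (c i) • r i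
  σc : ∀ i ∈ S, ∀ t, t ≠ i → c (σ i t) = c t - pr (r i) (c t) • c i
  rpos : ∀ t, ∃ m : ι → ℕ, r t = ∑ i ∈ S, m i • r i
  cpos : ∀ t, ∃ m : ι → ℕ, c t = ∑ i ∈ S, m i • c i
  int : ∀ s t, ∃ z : ℤ, pr (r s) (c t) = z
  spr : ∀ x, (∀ t, pr x (c t) = 0) → x = 0
  spc : ∀ y, (∀ t, pr (r t) y = 0) → y = 0

namespace PRS
variable {k M N ι : Type*} [Field k] [AddCommGroup M] [Module k M] [AddCommGroup N]
    [Module k N]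

/-- the dual datum -/
def flip (P : PRS k M N ι) : PRS k N M ι where
  pr := P.pr.flip
  r := P.c
  c := P.r
  S := P.S
  σ := P.σ
  two := by intro i hi; simpa using P.two i hi
  σ_self := P.σ_self
  σr := by intro i hi t ht; simpa using P.σc i hi t ht
  σc := by intro i hi t ht; simpa using P.σr i hi t ht
  rpos := P.cpos
  cpos := P.rpos
  int := fun s t => by simpa using P.int t s
  spr := fun x h => P.spc x (by simpa using h)
  spc := fun x h => P.spr x (by simpa using h)

variable (P : PRS k M N ι)

/-- the nonnegative cone -/
def Q (x : M) : Prop := ∃ m : ι → ℕ, x = ∑ i ∈ P.S, m i • P.r i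

/-- simple reflection -/
def s (i : ι) : M →ₗ[k] M := LinearMap.id - (P.pr.flip (P.c i)).smulRight (P.r i)

lemma s_apply (i : ι) (x : M) : P.s i x = x - P.pr x (P.c i) • P.r i := by
  simp [s]

lemma s_s {i : ι} (hi : i ∈ P.S) (x : M) : P.s i (P.s i x) = x := by
  simp only [s_apply, map_sub, LinearMap.sub_apply, map_smul, LinearMap.smul_apply, P.two i hi,
    smul_eq_mul]
  module

lemma pr_s {i : ι} (x : M) (y : N) : P.pr (P.s i x) y = P.pr x (P.flip.s i y) := by
  simp only [s_apply, map_sub, LinearMap.sub_apply, map_smul, LinearMap.smul_apply,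
    smul_eq_mul, flip, LinearMap.flip_apply]
  ring

variable [Fintype ι]

/-- half sum of positive roots -/
noncomputable def rho : M := (2⁻¹ : k) • ∑ t, P.r t

lemma s_rho [CharZero k] [DecidableEq ι] {i : ι} (hi : i ∈ P.S) : P.s i P.rho = P.rho - P.r i := by
  have h1 : P.s i (∑ t, P.r t) = (∑ t, P.r t) - (2:k) • P.r i := by
    rw [map_sum, ← Finset.add_sum_erase _ _ (Finset.mem_univ i),
      ← Finset.add_sum_erase _ (fun t => P.r t) (Finset.mem_univ i)]
    have : ∑ x ∈ Finset.univ.erase i, P.s i (P.r x) = ∑ x ∈ Finset.univ.erase i, P.r x := by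
      refine Finset.sum_bij (fun t _ => P.σ i t) ?_ ?_ ?_ ?_
      · intro t ht
        simp only [Finset.mem_erase, Finset.mem_univ, and_true] at ht ⊢
        intro h
        apply ht
        exact (P.σ i).injective (h.trans (P.σ_self i hi).symm)
      · intro a _ b _ h; exact (P.σ i).injective h
      · intro b hb
        simp only [Finset.mem_erase, Finset.mem_univ, and_true] at hb
        refine ⟨(P.σ i).symm b, ?_, by simp⟩
        simp only [Finset.mem_erase, Finset.mem_univ, and_true]
        intro h
        apply hb
        rw [Equiv.symm_apply_eq] at h
        rw [h, P.σ_self i hi]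
      · intro t ht
        simp only [Finset.mem_erase, Finset.mem_univ, and_true] at ht
        rw [P.σr i hi t ht, s_apply]
    rw [this, s_apply, P.two i hi]
    module
  rw [rho, map_smul, h1, smul_sub, smul_smul]
  norm_num

lemma pr_rho [CharZero k] [DecidableEq ι] {i : ι} (hi : i ∈ P.S) : P.pr P.rho (P.c i) = 1 := by
  have h := P.s_rho hi
  rw [s_apply] at h
  have h2 : P.pr P.rho (P.c i) • P.r i = P.r i := by simpa using h
  have h3 := congrArg (fun x => P.pr x (P.c i)) h2
  simp only [map_smul, LinearMap.smul_apply, P.two i hi, smul_eq_mul] at h3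
  have : (2:k) ≠ 0 := two_ne_zero
  exact mul_right_cancel₀ this (by rw [h3]; ring)

/-- height functional -/
noncomputable def ht : M →ₗ[k] k := P.pr.flip P.flip.rho

lemma ht_r [CharZero k] [DecidableEq ι] {i : ι} (hi : i ∈ P.S) : P.ht (P.r i) = 1 := by
  have := P.flip.pr_rho (i := i) hi
  simpa [ht, flip] using this

lemma ht_sum [CharZero k] [DecidableEq ι] (m : ι → ℕ) :
    P.ht (∑ i ∈ P.S, m i • P.r i) = ((∑ i ∈ P.S, m i : ℕ) : k) := by
  rw [map_sum, Nat.cast_sum]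
  refine Finset.sum_congr rfl fun i hi => ?_
  rw [map_nsmul, P.ht_r hi]; simp

lemma Q.add {x y : M} (hx : P.Q x) (hy : P.Q y) : P.Q (x + y) := by
  obtain ⟨m, rfl⟩ := hx
  obtain ⟨m', rfl⟩ := hy
  exact ⟨m + m', by simp [add_smul, Finset.sum_add_distrib]⟩

lemma Q.zero : P.Q 0 := ⟨0, by simp⟩

lemma Q.ht_nat [CharZero k] [DecidableEq ι] {x : M} (hx : P.Q x) :
    ∃ m : ℕ, P.ht x = m ∧ (m = 0 → x = 0) := by
  obtain ⟨m, rfl⟩ := hx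
  refine ⟨_, P.ht_sum m, fun h => ?_⟩
  rw [Finset.sum_eq_zero_iff] at h
  exact Finset.sum_eq_zero fun i hi => by rw [h i hi, zero_smul]

lemma Q.eq_zero [CharZero k] [DecidableEq ι] {x y : M} (hx : P.Q x) (hy : P.Q y) (h : x + y = 0) :
    x = 0 ∧ y = 0 := by
  obtain ⟨m, h1, h2⟩ := hx.ht_nat
  obtain ⟨m', h1', h2'⟩ := hy.ht_nat
  have : P.ht (x + y) = 0 := by rw [h, map_zero]
  rw [map_add, h1, h1'] at this
  have : m + m' = 0 := by exact_mod_cast this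
  exact ⟨h2 (by omega), h2' (by omega)⟩

lemma Q.int {x : M} (hx : P.Q x) (t : ι) : ∃ z : ℤ, P.pr x (P.c t) = z := by
  obtain ⟨m, rfl⟩ := hx
  choose z hz using fun s => P.int s t
  refine ⟨∑ i ∈ P.S, m i * z i, ?_⟩
  rw [map_sum, LinearMap.sum_apply, Int.cast_sum]
  refine Finset.sum_congr rfl fun i hi => ?_
  rw [map_nsmul, LinearMap.smul_apply, hz]; simp

lemma ascend [CharZero k] [DecidableEq ι] {T : Type*} (Θ : M → T)
    (hΘ : ∀ i ∈ P.S, ∀ x, Θ (P.s i x) = Θ x) (f : M → k)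
    (hf : ∀ i ∈ P.S, ∀ x, f (P.s i x) = - f x) (μ : M) (hμ : ∀ i ∈ P.S, ∃ z : ℤ, P.pr μ (P.c i) = z)
    (hsupp : ∀ x, f x ≠ 0 → P.Q (μ - x)) (ν : M) (hν : f ν ≠ 0) :
    ∃ ν', f ν' ≠ 0 ∧ Θ ν' = Θ ν ∧ ∀ i ∈ P.S, ∃ m : ℕ, P.pr ν' (P.c i) = m + 1 := by
  obtain ⟨m, hm, -⟩ := (hsupp ν hν).ht_nat
  induction m using Nat.strong_induction_on generalizing ν with
  | _ m ih =>
    by_cases hall : ∀ i ∈ P.S, ∃ m : ℕ, P.pr ν (P.c i) = m + 1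
    · exact ⟨ν, hν, rfl, hall⟩
    push Not at hall
    obtain ⟨i, hi, hne⟩ := hall
    obtain ⟨z, hz⟩ : ∃ z : ℤ, P.pr ν (P.c i) = z := by
      obtain ⟨z, hz⟩ := hμ i hi
      obtain ⟨z', hz'⟩ := (hsupp ν hν).int P i
      refine ⟨z - z', ?_⟩
      rw [map_sub, LinearMap.sub_apply, hz] at hz'
      push_cast
      rw [← hz']; ring
    have hz0 : z ≤ 0 := by
      by_contra hlt
      push Not at hlt
      apply hne (z - 1).toNat
      rw [hz]
      have : (((z-1).toNat : ℤ) : k) = ((z - 1 : ℤ) : k) := by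
        rw [Int.toNat_of_nonneg (by omega)]
      push_cast at this
      rw [this]; ring
    rcases eq_or_lt_of_le hz0 with h0 | hlt
    · exfalso
      have h1 : P.s i ν = ν := by rw [s_apply, hz, h0]; simp
      have h2 := hf i hi ν
      rw [h1] at h2
      exact hν (self_eq_neg.mp h2)
    · have hν1 : f (P.s i ν) ≠ 0 := by rw [hf i hi]; simpa using hν
      obtain ⟨m', hm', -⟩ := (hsupp _ hν1).ht_nat
      have hlt' : m' < m := by
        have e : P.ht (μ - P.s i ν) = P.ht (μ - ν) + (z:k) := by
          rw [s_apply, hz]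
          simp only [map_sub, map_smul, P.ht_r hi]
          simp only [smul_eq_mul, mul_one]
          ring
        rw [hm, hm'] at e
        have : (m' : ℤ) = m + z := by exact_mod_cast e
        omega
      obtain ⟨ν', h1, h2, h3⟩ := ih m' hlt' _ hν1 hm'
      exact ⟨ν', h1, h2.trans (hΘ i hi ν), h3⟩

/-- canonical form -/
noncomputable def form (x y : M) : k := ∑ t, P.pr x (P.c t) * P.pr y (P.c t)

lemma form_s [DecidableEq ι] {i : ι} (hi : i ∈ P.S) (x y : M) :
    P.form (P.s i x) (P.s i y) = P.form x y := by
  unfold form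
  refine Fintype.sum_bijective (P.σ i) (P.σ i).bijective _ _ fun t => ?_
  rw [pr_s, pr_s]
  by_cases h : t = i
  · subst h
    rw [P.σ_self t hi, P.flip.s_apply]
    have := P.two t hi
    simp only [flip, LinearMap.flip_apply, this, map_sub, map_smul, smul_eq_mul]
    ring
  · rw [P.σc i hi t h, P.flip.s_apply]
    simp [flip]

lemma form_r [CharZero k] [DecidableEq ι] {i : ι} (hi : i ∈ P.S) (x : M) :
    2 * P.form x (P.r i) = P.form (P.r i) (P.r i) * P.pr x (P.c i) := by
  have h := P.form_s hi x (P.r i)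
  have e : P.s i (P.r i) = - P.r i := by rw [s_apply, P.two i hi]; module
  rw [e, s_apply] at h
  have : P.form (x - P.pr x (P.c i) • P.r i) (-P.r i) =
     - P.form x (P.r i) + P.pr x (P.c i) * P.form (P.r i) (P.r i) := by
    unfold form
    rw [Finset.mul_sum, ← Finset.sum_neg_distrib, ← Finset.sum_add_distrib]
    refine Finset.sum_congr rfl fun t _ => ?_
    simp only [map_sub, map_smul, LinearMap.sub_apply, LinearMap.smul_apply, map_neg,
      LinearMap.neg_apply, smul_eq_mul]
    ring
  rw [this] at h
  linear_combination -h

lemma form_rr [CharZero k] {i : ι} (hi : i ∈ P.S) : ∃ m : ℕ, P.form (P.r i) (P.r i) = m + 1 := by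
  choose z hz using fun t => P.int i t
  have e : P.form (P.r i) (P.r i) = ((∑ t, z t * z t : ℤ) : k) := by
    unfold form; push_cast
    exact Finset.sum_congr rfl fun t _ => by rw [hz]
  have h1 : z i = 2 := by
    have := hz i
    rw [P.two i hi] at this
    exact_mod_cast this.symm
  have : z i * z i ≤ ∑ t, z t * z t :=
    Finset.single_le_sum (f := fun t => z t * z t) (fun t _ => mul_self_nonneg _) (Finset.mem_univ i)
  rw [h1] at this
  refine ⟨(∑ t, z t * z t - 1).toNat, ?_⟩
  have h2 : (((∑ t, z t * z t - 1).toNat : ℤ) : k) = ((∑ t, z t * z t - 1 : ℤ) : k) := by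
    rw [Int.toNat_of_nonneg (by omega)]
  rw [e]
  push_cast at h2 ⊢
  rw [h2]; ring

/-- antidominant elements of the cone vanish -/
lemma Q.eq_zero_of_antidom [CharZero k] [DecidableEq ι] {x : M} (hx : P.Q x)
    (h : ∀ i ∈ P.S, ∃ m : ℕ, P.pr x (P.c i) = - (m : k)) : x = 0 := by
  apply P.spr
  obtain ⟨a, ha⟩ := hx
  have h' : ∀ i, ∃ m : ℕ, i ∈ P.S → P.pr x (P.c i) = - (m : k) := fun i => by
    by_cases hi : i ∈ P.S
    · obtain ⟨m, hm⟩ := h i hi; exact ⟨m, fun _ => hm⟩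
    · exact ⟨0, fun h => absurd h hi⟩
  choose m hm using h'
  have h'' : ∀ i, ∃ q : ℕ, i ∈ P.S → P.form (P.r i) (P.r i) = q + 1 := fun i => by
    by_cases hi : i ∈ P.S
    · obtain ⟨m, hm⟩ := P.form_rr hi; exact ⟨m, fun _ => hm⟩
    · exact ⟨0, fun h => absurd h hi⟩
  choose q hq using h''
  choose z hz using fun t => Q.int P (⟨a, ha⟩ : P.Q x) t
  have e1 : P.form x x = ((∑ t, z t * z t : ℤ) : k) := by
    unfold form; push_cast
    exact Finset.sum_congr rfl fun t _ => by rw [hz]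
  have e2 : 2 * P.form x x = - ((∑ i ∈ P.S, a i * ((q i + 1) * m i) : ℕ) : k) := by
    have : P.form x x = ∑ i ∈ P.S, (a i : k) * P.form x (P.r i) := by
      conv_lhs => rw [form]; enter [2, t, 2]; rw [ha]
      simp only [map_sum, LinearMap.sum_apply, map_nsmul, LinearMap.smul_apply]
      simp only [Finset.mul_sum]
      rw [Finset.sum_comm]
      refine Finset.sum_congr rfl fun i _ => ?_
      unfold form
      rw [Finset.mul_sum]
      refine Finset.sum_congr rfl fun t _ => ?_
      rw [nsmul_eq_mul]; ring
    rw [this, Finset.mul_sum, Nat.cast_sum, ← Finset.sum_neg_distrib]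
    refine Finset.sum_congr rfl fun i hi => ?_
    rw [mul_left_comm, P.form_r hi, hm i hi, hq i hi]
    push_cast; ring
  rw [e1] at e2
  have e3 : 2 * (∑ t, z t * z t) = - ((∑ i ∈ P.S, a i * ((q i + 1) * m i) : ℕ) : ℤ) := by
    exact_mod_cast e2
  have e4 : ∑ t, z t * z t = 0 := by
    have : 0 ≤ ∑ t, z t * z t := Finset.sum_nonneg fun t _ => mul_self_nonneg _
    have : (0:ℤ) ≤ ((∑ i ∈ P.S, a i * ((q i + 1) * m i) : ℕ) : ℤ) := Int.natCast_nonneg _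
    omega
  rw [Finset.sum_eq_zero_iff_of_nonneg (fun t _ => mul_self_nonneg _)] at e4
  intro t
  rw [hz t, mul_self_eq_zero.mp (e4 t (Finset.mem_univ t))]; simp

end PRS
end PieceWeyl

section PieceWeyl2
open Matrix

namespace PRS
variable {k M N ι : Type*} [Field k] [AddCommGroup M] [Module k M] [AddCommGroup N]
    [Module k N]
variable (P : PRS k M N ι)

/-- `f` is supported in `μ - Q` -/
def SuppIn (f : AddMonoidAlgebra k M) (μ : M) : Prop := ∀ x, f.coeff x ≠ 0 → P.Q (μ - x)

variable [Fintype ι]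

lemma SuppIn.mul {f g : AddMonoidAlgebra k M} {μ μ' : M} (hf : P.SuppIn f μ) (hg : P.SuppIn g μ') :
    P.SuppIn (f * g) (μ + μ') := by
  classical
  intro x hx
  rw [AddMonoidAlgebra.coeff_mul] at hx
  have : ∃ a ∈ f.coeff.support, ∃ b ∈ g.coeff.support, a + b = x := by
    by_contra hcon
    push Not at hcon
    apply hx
    simp only [Finsupp.sum]
    refine Finset.sum_eq_zero fun a ha => Finset.sum_eq_zero fun b hb => ?_
    rw [if_neg (hcon a ha b hb)]
  obtain ⟨a, ha, b, hb, rfl⟩ := this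
  have := Q.add P (hf a (by simpa using ha)) (hg b (by simpa using hb))
  convert this using 1
  abel

lemma SuppIn.coeff [CharZero k] [DecidableEq ι] {f g : AddMonoidAlgebra k M} {μ μ' : M}
    (hf : P.SuppIn f μ) (hg : P.SuppIn g μ') :
    (f * g).coeff (μ + μ') = f.coeff μ * g.coeff μ' := by
  apply AddMonoidAlgebra.coeff_mul_add_of_uniqueAdd
  intro a b ha hb hab
  have h1 := hf a (by simpa using ha)
  have h2 := hg b (by simpa using hb)
  have := Q.eq_zero P h1 h2 (by rw [← sub_eq_zero] at hab; rw [← neg_eq_zero, ← hab]; abel)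
  exact ⟨(sub_eq_zero.mp this.1).symm, (sub_eq_zero.mp this.2).symm⟩

lemma SuppIn.single (μ : M) (a : k) : P.SuppIn (AddMonoidAlgebra.single μ a) μ := by
  classical
  intro x hx
  rw [AddMonoidAlgebra.coeff_single, Finsupp.single_apply] at hx
  split_ifs at hx with h
  · subst h; simpa using Q.zero P
  · simp at hx

lemma SuppIn.one_sub (t : ι) : P.SuppIn (1 - AddMonoidAlgebra.single (-P.r t) (1:k)) 0 := by
  classical
  intro x hx
  rw [AddMonoidAlgebra.one_def, AddMonoidAlgebra.coeff_sub, AddMonoidAlgebra.coeff_single,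
    AddMonoidAlgebra.coeff_single, Finsupp.sub_apply, Finsupp.single_apply, Finsupp.single_apply]
     at hx
  split_ifs at hx with h1 h2 h3
  · subst h1; simpa using Q.zero P
  · subst h1; simpa using Q.zero P
  · subst h3; simpa [Q] using P.rpos t
  · simp at hx

lemma r_ne_zero [CharZero k] [DecidableEq ι] (h0 : ∀ t, P.r t ≠ 0) (t : ι) :
   (1 - AddMonoidAlgebra.single (-P.r t) (1:k)).coeff 0 = 1 := by
  classical
  rw [AddMonoidAlgebra.one_def, AddMonoidAlgebra.coeff_sub, AddMonoidAlgebra.coeff_single,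
    AddMonoidAlgebra.coeff_single, Finsupp.sub_apply, Finsupp.single_apply, Finsupp.single_apply]
  simp [h0 t]

/-- Weyl denominator -/
noncomputable def den : AddMonoidAlgebra k M :=
  AddMonoidAlgebra.single P.rho (1:k) * ∏ t, (1 - AddMonoidAlgebra.single (-P.r t) (1:k))

lemma prod_supp [CharZero k] [DecidableEq ι] (h0 : ∀ t, P.r t ≠ 0) (s : Finset ι) :
    P.SuppIn (∏ t ∈ s, (1 - AddMonoidAlgebra.single (-P.r t) (1:k))) 0 ∧
    (∏ t ∈ s, (1 - AddMonoidAlgebra.single (-P.r t) (1:k))).coeff 0 = 1 := by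
  induction s using Finset.induction_on with
  | empty => 
    refine ⟨?_, by simp [AddMonoidAlgebra.one_def]⟩
    simpa [AddMonoidAlgebra.one_def] using SuppIn.single P (0:M) 1
  | insert a s ha ih =>
    rw [Finset.prod_insert ha]
    have h1 := SuppIn.one_sub P a
    refine ⟨by simpa using h1.mul P ih.1, ?_⟩
    have := h1.coeff P ih.1
    rw [zero_add, ih.2, P.r_ne_zero h0] at this
    simpa using this

lemma den_supp [CharZero k] [DecidableEq ι] (h0 : ∀ t, P.r t ≠ 0) :
    P.SuppIn P.den P.rho ∧ P.den.coeff P.rho = 1 := by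
  have h1 := SuppIn.single P P.rho (1:k)
  have h2 := P.prod_supp h0 Finset.univ
  refine ⟨by simpa [den] using h1.mul P h2.1, ?_⟩
  have := h1.coeff P h2.1
  rw [add_zero, h2.2] at this
  rw [den, this]
  simp

/-- action of simple reflection on the group algebra -/
noncomputable def sig (i : ι) : AddMonoidAlgebra k M →+* AddMonoidAlgebra k M :=
  AddMonoidAlgebra.mapDomainRingHom k (P.s i).toAddMonoidHom

lemma sig_single (i : ι) (x : M) (a : k) :
    P.sig i (AddMonoidAlgebra.single x a) = AddMonoidAlgebra.single (P.s i x) a := by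
  simp [sig]

lemma sig_coeff {i : ι} (hi : i ∈ P.S) (f : AddMonoidAlgebra k M) (x : M) :
    (P.sig i f).coeff (P.s i x) = f.coeff x := by
  have hinj : Function.Injective (P.s i) := fun a b h => by
    rw [← P.s_s hi a, h, P.s_s hi]
  have : (P.sig i f).coeff = Finsupp.mapDomain (P.s i) f.coeff := by
    simp [sig, AddMonoidAlgebra.coeff_mapDomain]
  rw [this, Finsupp.mapDomain_apply hinj]

lemma antisym {i : ι} (hi : i ∈ P.S) {f : AddMonoidAlgebra k M} (h : P.sig i f = -f) (x : M) :
    f.coeff (P.s i x) = - f.coeff x := by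
  rw [← P.sig_coeff hi f x, h]; simp

lemma sig_den [CharZero k] [DecidableEq ι] {i : ι} (hi : i ∈ P.S) : P.sig i P.den = - P.den := by
  rw [den, map_mul, map_prod, sig_single, P.s_rho hi,
    ← Finset.mul_prod_erase _ _ (Finset.mem_univ i),
    ← Finset.mul_prod_erase _ (fun t => 1 - AddMonoidAlgebra.single (-P.r t) (1:k)) (Finset.mem_univ i)]
  have : ∏ t ∈ Finset.univ.erase i, P.sig i (1 - AddMonoidAlgebra.single (-P.r t) (1:k)) =
      ∏ t ∈ Finset.univ.erase i, (1 - AddMonoidAlgebra.single (-P.r t) (1:k)) := by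
    refine Finset.prod_bij (fun t _ => P.σ i t) ?_ ?_ ?_ ?_
    · intro t ht
      simp only [Finset.mem_erase, Finset.mem_univ, and_true] at ht ⊢
      intro h
      apply ht
      exact (P.σ i).injective (h.trans (P.σ_self i hi).symm)
    · intro a _ b _ h; exact (P.σ i).injective h
    · intro b hb
      simp only [Finset.mem_erase, Finset.mem_univ, and_true] at hb
      refine ⟨(P.σ i).symm b, ?_, by simp⟩
      simp only [Finset.mem_erase, Finset.mem_univ, and_true]
      intro h
      apply hb
      rw [Equiv.symm_apply_eq] at h
      rw [h, P.σ_self i hi]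
    · intro t ht
      simp only [Finset.mem_erase, Finset.mem_univ, and_true] at ht
      rw [P.σr i hi t ht, map_sub, map_one, sig_single, map_neg, s_apply]
  rw [this]
  have e : P.s i (-P.r i) = P.r i := by rw [s_apply, map_neg, LinearMap.neg_apply, P.two i hi]; module
  rw [map_sub, map_one, sig_single, e]
  have e2 : AddMonoidAlgebra.single (P.rho - P.r i) (1:k) = AddMonoidAlgebra.single P.rho (1:k) *
     AddMonoidAlgebra.single (- P.r i) (1:k) := by
    rw [AddMonoidAlgebra.single_mul_single, sub_eq_add_neg, one_mul]
  have e3 : AddMonoidAlgebra.single (-P.r i) (1:k) * AddMonoidAlgebra.single (P.r i) (1:k) = 1 := by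
    rw [AddMonoidAlgebra.single_mul_single]; simp [AddMonoidAlgebra.one_def]
  rw [e2]
  linear_combination (- AddMonoidAlgebra.single P.rho (1:k) *
    ∏ t ∈ Finset.univ.erase i, (1 - AddMonoidAlgebra.single (-P.r t) (1:k))) * e3

/-- support of the denominator is a single orbit -/
lemma den_orbit [CharZero k] [DecidableEq ι] (h0 : ∀ t, P.r t ≠ 0) {T : Type*} (Θ : M → T)
    (hΘ : ∀ i ∈ P.S, ∀ x, Θ (P.s i x) = Θ x) (ν : M) (hν : P.den.coeff ν ≠ 0) :
    Θ ν = Θ P.rho := by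
  obtain ⟨ν', h1, h2, h3⟩ := P.ascend Θ hΘ (fun x => P.den.coeff x)
    (fun i hi x => P.antisym hi (P.sig_den hi) x) P.rho (fun i hi => ⟨1, by simp [P.pr_rho hi]⟩)
    (P.den_supp h0).1 ν hν
  have hQ := (P.den_supp h0).1 ν' h1
  have := Q.eq_zero_of_antidom P hQ (fun i hi => by
    obtain ⟨m, hm⟩ := h3 i hi
    exact ⟨m, by rw [map_sub, LinearMap.sub_apply, P.pr_rho hi, hm]; ring⟩)
  rw [sub_eq_zero] at this
  rw [← h2, this]

/-- evaluation -/
noncomputable def ev (y : N) : AddMonoidAlgebra k M →+* AddMonoidAlgebra k k :=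
  AddMonoidAlgebra.mapDomainRingHom k (P.pr.flip y).toAddMonoidHom

lemma ev_single (y : N) (x : M) (a : k) :
    P.ev y (AddMonoidAlgebra.single x a) = AddMonoidAlgebra.single (P.pr x y) a := by
  simp [ev]

lemma ev_eq (y : N) (f : AddMonoidAlgebra k M) (s : Finset M) (hs : f.coeff.support ⊆ s) :
    P.ev y f = ∑ x ∈ s, AddMonoidAlgebra.single (P.pr x y) (f.coeff x) := by
  conv_lhs => rw [← AddMonoidAlgebra.sum_single f]
  rw [Finsupp.sum, map_sum]
  simp only [ev_single]
  exact Finset.sum_subset hs (fun x _ hx => by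
    rw [Finsupp.notMem_support_iff] at hx; rw [hx]; simp)

/-- The swap identity. -/
lemma swap [CharZero k] [DecidableEq ι] (h0 : ∀ t, P.c t ≠ 0) (A : AddMonoidAlgebra k M) (μ : M)
    (hA : ∀ i ∈ P.S, P.sig i A = - A) (h1 : A.coeff μ = 1)
    (horb : ∀ (Θ : M → AddMonoidAlgebra k k), (∀ i ∈ P.S, ∀ x, Θ (P.s i x) = Θ x) →
      ∀ ν, A.coeff ν ≠ 0 → Θ ν = Θ μ) :
    (P.flip.den.coeff.support.card : k) • P.ev P.flip.rho A =
      (A.coeff.support.card : k) • P.flip.ev μ P.flip.den := by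
  set D := P.flip.den with hD
  have hsymm : ∀ (i) (hi : i ∈ P.S) (y : N), P.ev (P.flip.s i y) A = - P.ev y A := by
    intro i hi y
    have : P.ev (P.flip.s i y) A = P.ev y (P.sig i A) := by
      have : P.ev (P.flip.s i y) = (P.ev y).comp (P.sig i) := by
        refine AddMonoidAlgebra.ringHom_ext ?_ ?_
        · intro a; simp [ev_single, sig_single]
        · intro a; simp [ev_single, sig_single, pr_s]
      rw [this]; rfl
    rw [this, hA i hi, map_neg]
  have hsymm' : ∀ (i) (hi : i ∈ P.S) (x : M), P.flip.ev (P.s i x) D = - P.flip.ev x D := by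
    intro i hi y
    have : P.flip.ev (P.s i y) D = P.flip.ev y (P.flip.sig i D) := by
      have : P.flip.ev (P.s i y) = (P.flip.ev y).comp (P.flip.sig i) := by
        refine AddMonoidAlgebra.ringHom_ext ?_ ?_
        · intro a; simp [ev_single, sig_single]
        · intro a
          have := P.flip.pr_s (i := i) a y
          simp only [ev_single, sig_single, RingHom.comp_apply]
          rw [this]; rfl
      rw [this]; rfl
    rw [this, P.flip.sig_den hi, map_neg]
  have hc : ∀ (a : k) (f : AddMonoidAlgebra k k), (-a) • (-f) = a • f := by intro a f; simp
  have k1 : ∀ y, D.coeff y ≠ 0 → D.coeff y • P.ev y A = P.ev P.flip.rho A := by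
    intro y hy
    have := P.flip.den_orbit h0 (fun y => D.coeff y • P.ev y A) (by
      intro i hi y
      beta_reduce
      rw [hsymm i hi, P.flip.antisym hi (P.flip.sig_den hi), hc]) y hy
    beta_reduce at this
    rw [this, (P.flip.den_supp h0).2, one_smul]
  have k2 : ∀ x, A.coeff x ≠ 0 → A.coeff x • P.flip.ev x D = P.flip.ev μ D := by
    intro x hx
    have := horb (fun x => A.coeff x • P.flip.ev x D) (by
      intro i hi y
      beta_reduce
      rw [hsymm' i hi, P.antisym hi (hA i hi), hc]) x hx
    beta_reduce at this
    rw [this, h1, one_smul]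
  have e1 : ∑ y ∈ D.coeff.support, D.coeff y • P.ev y A =
      (D.coeff.support.card : k) • P.ev P.flip.rho A := by
    rw [Finset.sum_congr rfl (fun y hy => k1 y (by simpa using hy)), Finset.sum_const,
      Nat.cast_smul_eq_nsmul]
  have e2 : ∑ x ∈ A.coeff.support, A.coeff x • P.flip.ev x D =
      (A.coeff.support.card : k) • P.flip.ev μ D := by
    rw [Finset.sum_congr rfl (fun y hy => k2 y (by simpa using hy)), Finset.sum_const,
      Nat.cast_smul_eq_nsmul]
  rw [← e1, ← e2]
  have e3 : ∀ y, P.ev y A = ∑ x ∈ A.coeff.support, AddMonoidAlgebra.single (P.pr x y) (A.coeff x) :=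
    fun y => P.ev_eq y A _ subset_rfl
  have e4 : ∀ x, P.flip.ev x D =
      ∑ y ∈ D.coeff.support, AddMonoidAlgebra.single (P.pr x y) (D.coeff y) :=
    fun x => P.flip.ev_eq x D _ subset_rfl
  simp only [e3, e4, Finset.smul_sum]
  rw [Finset.sum_comm]
  refine Finset.sum_congr rfl fun x _ => Finset.sum_congr rfl fun y _ => ?_
  rw [AddMonoidAlgebra.smul_single, AddMonoidAlgebra.smul_single, smul_eq_mul, smul_eq_mul, mul_comm]

end PRS
end PieceWeyl2

section PieceWeyl3
open Matrix

section mulc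
variable {k M : Type*} [Field k] [AddCommGroup M] [Module k M]

/-- multiply coefficients by a function -/
noncomputable def mulc (φ : M → k) : AddMonoidAlgebra k M →ₗ[k] AddMonoidAlgebra k M :=
  (Finsupp.lsum k fun ν => (AddMonoidAlgebra.lsingle ν).comp (φ ν • LinearMap.id)).comp
    (AddMonoidAlgebra.coeffLinearEquiv k).toLinearMap

lemma mulc_single (φ : M → k) (x : M) (a : k) : mulc φ (AddMonoidAlgebra.single x a) =
    AddMonoidAlgebra.single x (φ x * a) := by
  simp [mulc]

lemma mulc_coeff (φ : M → k) (f : AddMonoidAlgebra k M) (x : M) :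
    (mulc φ f).coeff x = φ x * f.coeff x := by
  classical
  induction f using AddMonoidAlgebra.induction_linear with
  | zero => simp
  | add f g hf hg => simp [hf, hg, mul_add]
  | single y a =>
    rw [mulc_single]
    simp only [AddMonoidAlgebra.coeff_single, Finsupp.single_apply]
    split_ifs with h
    · rw [h]
    · simp

lemma mulc_deriv (φ : M →ₗ[k] k) (f g : AddMonoidAlgebra k M) :
    mulc φ (f * g) = mulc φ f * g + f * mulc φ g := by
  induction f using AddMonoidAlgebra.induction_linear with
  | zero => simp
  | add f f' hf hg => rw [add_mul, map_add, hf, hg, map_add]; ring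
  | single x a =>
    induction g using AddMonoidAlgebra.induction_linear with
    | zero => simp
    | add f f' hf hg => rw [mul_add, map_add, hf, hg, map_add]; ring
    | single y b =>
      simp only [AddMonoidAlgebra.single_mul_single, mulc_single, map_add]
      rw [← AddMonoidAlgebra.single_add]
      congr 1; ring

lemma lap_mul (B : M →ₗ[k] M →ₗ[k] k) (hs : ∀ x y, B x y = B y x) (x : M) (f : AddMonoidAlgebra k M) :
    mulc (fun x => B x x) (AddMonoidAlgebra.single x (1:k) * f) =
    AddMonoidAlgebra.single x (B x x) * f +
    AddMonoidAlgebra.single x (1:k) * mulc (fun x => B x x) f +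
     2 * (AddMonoidAlgebra.single x (1:k) * mulc (B x) f) := by
  induction f using AddMonoidAlgebra.induction_linear with
  | zero => simp
  | add f f' hf hg => simp only [mul_add, map_add] at *; rw [hf, hg]; ring
  | single y b =>
    simp only [AddMonoidAlgebra.single_mul_single, mulc_single, map_add, two_mul, LinearMap.add_apply]
    simp only [← AddMonoidAlgebra.single_add]
    congr 1; rw [hs y x]; ring
end mulc

namespace PRS
variable {k M N ι : Type*} [Field k] [AddCommGroup M] [Module k M] [AddCommGroup N]
    [Module k N]
variable (P : PRS k M N ι) [Fintype ι]

theorem lap_ch_den [CharZero k] [DecidableEq ι] {J : Type*} [Fintype J] (h0 : ∀ t, P.r t ≠ 0)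
    (B : M →ₗ[k] M →ₗ[k] k) (hs : ∀ x y, B x y = B y x)
    (hBinv : ∀ i ∈ P.S, ∀ x, B (P.s i x) (P.s i x) = B x x)
    (wt : J → M) (T T' : ι → AddMonoidAlgebra k M) (c0 : k)
    (hT : ∀ t, (1 - AddMonoidAlgebra.single (-P.r t) (1:k)) * T t =
      ∑ j, AddMonoidAlgebra.single (wt j) (B (wt j) (P.r t)))
    (hT' : ∀ t, (1 - AddMonoidAlgebra.single (P.r t) (1:k)) * T' t =
      -∑ j, AddMonoidAlgebra.single (wt j) (B (wt j) (P.r t)))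
    (hC : ∑ j, AddMonoidAlgebra.single (wt j) (B (wt j) (wt j)) + ∑ t, (T t + T' t) =
      c0 • ∑ j, AddMonoidAlgebra.single (wt j) (1:k)) :
    mulc (fun x => B x x) ((∑ j, AddMonoidAlgebra.single (wt j) (1:k)) * P.den) =
    (c0 + B P.rho P.rho) • ((∑ j, AddMonoidAlgebra.single (wt j) (1:k)) * P.den) := by
  set E : M → AddMonoidAlgebra k M := fun x => AddMonoidAlgebra.single x (1:k) with hE
  have hEadd : ∀ x y, E x * E y = E (x + y) := by
    intro x y; simp [hE, AddMonoidAlgebra.single_mul_single]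
  have hE0 : E 0 = 1 := by simp [hE, AddMonoidAlgebra.one_def]
  set G : ι → AddMonoidAlgebra k M :=
    fun t => ∑ j, AddMonoidAlgebra.single (wt j) (B (wt j) (P.r t)) with hG
  set δ : AddMonoidAlgebra k M → AddMonoidAlgebra k M := fun f => ∑ j, E (wt j) * mulc (B (wt j)) f
    with hδ
  have hδmul : ∀ f g, δ (f * g) = δ f * g + f * δ g := by
    intro f g
    simp only [hδ, mulc_deriv, mul_add, Finset.sum_add_distrib, Finset.sum_mul, Finset.mul_sum]
    congr 1
    · refine Finset.sum_congr rfl fun j _ => by ring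
    · refine Finset.sum_congr rfl fun j _ => by ring
  have hδE : ∀ x, δ (E x) = (∑ j, AddMonoidAlgebra.single (wt j) (B (wt j) x)) * E x := by
    intro x
    simp only [hδ, hE, mulc_single, Finset.sum_mul, AddMonoidAlgebra.single_mul_single, mul_one,
      one_mul]
  have hcomb : ∀ f g a b : AddMonoidAlgebra k M, 2 * δ f = a * f → 2 * δ g = b * g →
      2 * δ (f * g) = (a + b) * (f * g) := by
    intro f g a b h1 h2
    rw [hδmul]
    linear_combination g * h1 + f * h2
  have hδ1 : δ 1 = 0 := by
    have := hδmul 1 1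
    simp only [mul_one, one_mul] at this
    simpa using this
  have hδrho : 2 * δ (E P.rho) = (∑ t, G t) * E P.rho := by
    rw [hδE, ← mul_assoc]
    congr 1
    simp only [hG]
    rw [Finset.sum_comm, two_mul, ← Finset.sum_add_distrib]
    refine Finset.sum_congr rfl fun j _ => ?_
    rw [← AddMonoidAlgebra.single_add]
    have : ∀ (s : Finset ι), ∑ x ∈ s, AddMonoidAlgebra.single (wt j) (B (wt j) (P.r x)) =
       AddMonoidAlgebra.single (wt j) (∑ x ∈ s, B (wt j) (P.r x)) := by
      intro s
      induction s using Finset.induction_on with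
      | empty => simp
      | insert a s ha ih => rw [Finset.sum_insert ha, ih, Finset.sum_insert ha,
          AddMonoidAlgebra.single_add]
    rw [this, ← map_sum, rho, map_smul, smul_eq_mul]
    congr 1
    have : (2:k) ≠ 0 := two_ne_zero
    simp only [map_sum]
    field_simp
    ring
  have hneg : ∀ t, E (-P.r t) * E (P.r t) = 1 := by intro t; rw [hEadd, neg_add_cancel, hE0]
  have hδr : ∀ t, 2 * δ (1 - E (-P.r t)) = (T t + T' t - G t) * (1 - E (-P.r t)) := by
    intro t
    have e1 : δ (1 - E (-P.r t)) = G t * E (-P.r t) := by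
      have : δ (1 - E (-P.r t)) = δ 1 - δ (E (-P.r t)) := by
        simp only [hδ, map_sub, mul_sub, Finset.sum_sub_distrib]
      rw [this, hδ1, hδE]
      simp only [map_neg, hG]
      have : ∀ j, AddMonoidAlgebra.single (wt j) (-(B (wt j) (P.r t))) =
         - AddMonoidAlgebra.single (wt j) (B (wt j) (P.r t)) := by
        intro j; ext; simp
      simp only [this, Finset.sum_neg_distrib]
      ring
    rw [e1]
    have h1 : (1 - E (-P.r t)) * T t = G t := hT t
    have h2 : (1 - E (P.r t)) * T' t = - G t := hT' t
    linear_combination (-1) * h1 + E (-P.r t) * h2 + T' t * hneg t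
  have hδprod : ∀ s : Finset ι, 2 * δ (∏ t ∈ s, (1 - E (-P.r t))) =
      (∑ t ∈ s, (T t + T' t - G t)) * ∏ t ∈ s, (1 - E (-P.r t)) := by
    intro s
    induction s using Finset.induction_on with
    | empty => simp [hδ1]
    | insert a s ha ih =>
      rw [Finset.prod_insert ha, Finset.sum_insert ha]
      exact hcomb _ _ _ _ (hδr a) ih
  have hδden : 2 * δ P.den = (∑ t, (T t + T' t)) * P.den := by
    have := hcomb _ _ _ _ hδrho (hδprod Finset.univ)
    rw [← Finset.sum_add_distrib] at this
    rw [den]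
    convert this using 2
    exact Finset.sum_congr rfl fun t _ => by ring
  have hlapden : mulc (fun x => B x x) P.den = (B P.rho P.rho) • P.den := by
    ext x
    rw [mulc_coeff]
    by_cases hx : P.den.coeff x = 0
    · simp [hx]
    · rw [P.den_orbit h0 (fun x => B x x) hBinv x hx]; simp
  have hlap : mulc (fun x => B x x) ((∑ j, E (wt j)) * P.den) =
      (∑ j, AddMonoidAlgebra.single (wt j) (B (wt j) (wt j))) * P.den +
      (∑ j, E (wt j)) * mulc (fun x => B x x) P.den + 2 * δ P.den := by
    simp only [Finset.sum_mul, map_sum, hδ, hE, lap_mul B hs, Finset.sum_add_distrib, Finset.mul_sum]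
  have hC' : ∑ t, (T t + T' t) = c0 • ∑ j, E (wt j) -
     ∑ j, AddMonoidAlgebra.single (wt j) (B (wt j) (wt j)) := by
    rw [← hC]; ring
  rw [hlap, hδden, hlapden, hC', add_smul, sub_mul, smul_mul_assoc, mul_smul_comm]
  abel

end PRS
end PieceWeyl3

section PieceWeyl4
open Matrix

section psi
variable (k : Type*) [Field k]
/-- polynomials into the group algebra of k -/
noncomputable def psiH : Polynomial k →ₐ[k] AddMonoidAlgebra k k :=
  Polynomial.aeval (AddMonoidAlgebra.single (-1:k) (1:k))

lemma psiH_X_pow (m : ℕ) : psiH k (Polynomial.X ^ m) = AddMonoidAlgebra.single (-(m:k)) (1:k) := by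
  rw [map_pow, psiH, Polynomial.aeval_X, AddMonoidAlgebra.single_pow]; simp

lemma psiH_coeff [CharZero k] (p : Polynomial k) (m : ℕ) : (psiH k p).coeff (-(m:k)) = p.coeff m := by
  classical
  induction p using Polynomial.induction_on' with
  | add p q hp hq => simp [hp, hq]
  | monomial i a =>
    rw [← Polynomial.smul_X_eq_monomial, map_smul, psiH_X_pow, AddMonoidAlgebra.smul_single]
    simp only [AddMonoidAlgebra.coeff_single, Finsupp.single_apply, Polynomial.coeff_smul,
      Polynomial.coeff_X_pow, neg_inj, Nat.cast_inj, smul_eq_mul]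
    by_cases h : i = m
    · simp [h]
    · simp [h, Ne.symm h]

lemma psiH_inj [CharZero k] : Function.Injective (psiH k) := by
  intro p q h
  ext m
  rw [← psiH_coeff, h, psiH_coeff]
end psi

namespace PRS
variable {k M N ι : Type*} [Field k] [AddCommGroup M] [Module k M] [AddCommGroup N]
    [Module k N]
variable (P : PRS k M N ι) [Fintype ι]

theorem weyl_poly [CharZero k] [DecidableEq ι] {J : Type*} [Fintype J] (h0 : ∀ t, P.r t ≠ 0)
    (h0c : ∀ t, P.c t ≠ 0)
    (B : M →ₗ[k] M →ₗ[k] k) (hs : ∀ x y, B x y = B y x)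
    (hB : ∀ t, ∃ q : ℚ, 0 < q ∧ ∀ x, B x (P.r t) = (q:k) * P.pr x (P.c t))
    (wt : J → M) (T T' : ι → AddMonoidAlgebra k M) (c0 : k)
    (hT : ∀ t, (1 - AddMonoidAlgebra.single (-P.r t) (1:k)) * T t =
      ∑ j, AddMonoidAlgebra.single (wt j) (B (wt j) (P.r t)))
    (hT' : ∀ t, (1 - AddMonoidAlgebra.single (P.r t) (1:k)) * T' t =
      -∑ j, AddMonoidAlgebra.single (wt j) (B (wt j) (P.r t)))
    (hC : ∑ j, AddMonoidAlgebra.single (wt j) (B (wt j) (wt j)) + ∑ t, (T t + T' t) =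
      c0 • ∑ j, AddMonoidAlgebra.single (wt j) (1:k))
    (hsym : ∀ i ∈ P.S, ∑ j, AddMonoidAlgebra.single (P.s i (wt j)) (1:k) =
      ∑ j, AddMonoidAlgebra.single (wt j) (1:k))
    (j0 : J) (hdom : ∀ i ∈ P.S, ∃ m : ℕ, P.pr (wt j0) (P.c i) = m)
    (hle : ∀ j, P.Q (wt j0 - wt j)) (hone : ∀ j, wt j = wt j0 → j = j0)
    (lv : J → ℕ) (hlv : ∀ j, P.ht (wt j0 - wt j) = lv j)
    (hh : ι → ℕ) (hhh : ∀ t, P.ht (P.r t) = hh t) :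
    ∃ a : ι → ℕ, (∑ j, (Polynomial.X : Polynomial ℤ) ^ lv j) * ∏ t, (1 - Polynomial.X ^ hh t) =
      ∏ t, (1 - Polynomial.X ^ a t) := by
  classical
  have hBinv : ∀ i ∈ P.S, ∀ x, B (P.s i x) (P.s i x) = B x x := by
    intro i hi x
    obtain ⟨q, -, hq⟩ := hB i
    rw [s_apply]
    simp only [map_sub, map_smul, LinearMap.sub_apply, LinearMap.smul_apply, smul_eq_mul, hs (P.r i),
      hq, P.two i hi]
    ring
  set ch : AddMonoidAlgebra k M := ∑ j, AddMonoidAlgebra.single (wt j) (1:k) with hch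
  set A := ch * P.den with hA
  have hlap := P.lap_ch_den h0 B hs hBinv wt T T' c0 hT hT' hC
  rw [← hch, ← hA] at hlap
  have hanti : ∀ i ∈ P.S, P.sig i A = - A := by
    intro i hi
    rw [hA, map_mul, P.sig_den hi, hch, map_sum]
    simp only [sig_single]
    rw [hsym i hi]; ring
  have chcoeff : ∀ x, ch.coeff x = ∑ j, if wt j = x then (1:k) else 0 := by
    intro x
    rw [hch, AddMonoidAlgebra.coeff_sum, Finsupp.finset_sum_apply]
    simp only [AddMonoidAlgebra.coeff_single, Finsupp.single_apply]
  have hchS : P.SuppIn ch (wt j0) := by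
    intro x hx
    rw [chcoeff] at hx
    obtain ⟨j, -, hj⟩ := Finset.exists_ne_zero_of_sum_ne_zero hx
    have : wt j = x := by by_contra h; simp [h] at hj
    rw [← this]; exact hle j
  have hch1 : ch.coeff (wt j0) = 1 := by
    rw [chcoeff, Finset.sum_eq_single j0]
    · simp
    · intro j _ hj; rw [if_neg]; intro h; exact hj (hone j h)
    · simp
  set μ := wt j0 + P.rho with hμ
  have hAS : P.SuppIn A μ := hchS.mul P (P.den_supp h0).1
  have hA1 : A.coeff μ = 1 := by
    rw [hA, hμ, hchS.coeff P (P.den_supp h0).1, hch1, (P.den_supp h0).2, one_mul]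
  have hBν : ∀ x, A.coeff x ≠ 0 → B x x = c0 + B P.rho P.rho := by
    intro x hx
    have := congrArg (fun f => f.coeff x) hlap
    simp only [mulc_coeff, AddMonoidAlgebra.coeff_smul, Finsupp.smul_apply, smul_eq_mul] at this
    exact mul_right_cancel₀ hx this
  have hμdom : ∀ i ∈ P.S, ∃ m : ℕ, P.pr μ (P.c i) = m + 1 := by
    intro i hi
    obtain ⟨m, hm⟩ := hdom i hi
    exact ⟨m, by rw [hμ, map_add, LinearMap.add_apply, hm, P.pr_rho hi]⟩
  have horb : ∀ (Θ : M → AddMonoidAlgebra k k), (∀ i ∈ P.S, ∀ x, Θ (P.s i x) = Θ x) →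
      ∀ ν, A.coeff ν ≠ 0 → Θ ν = Θ μ := by
    intro Θ hΘ ν hν
    obtain ⟨ν', h1, h2, h3⟩ := P.ascend Θ hΘ (fun x => A.coeff x)
      (fun i hi x => P.antisym hi (hanti i hi) x) μ
      (fun i hi => by obtain ⟨m, hm⟩ := hμdom i hi; exact ⟨m + 1, by rw [hm]; push_cast; rfl⟩) hAS ν hν
    rw [← h2]
    congr 1
    have hB0 : B μ μ = B ν' ν' := by rw [hBν ν' h1, hBν μ (by rw [hA1]; exact one_ne_zero)]
    obtain ⟨n, hn⟩ := hAS ν' h1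
    have e1 : B (μ + ν') (μ - ν') = 0 := by
      simp only [map_add, map_sub, LinearMap.add_apply]
      rw [hB0, hs ν' μ]; ring
    rw [hn, map_sum] at e1
    choose q hq0 hq using hB
    have hall : ∀ i, ∃ m : ℕ, i ∈ P.S → P.pr (μ + ν') (P.c i) = m + 1 := by
      intro i
      by_cases hi : i ∈ P.S
      · obtain ⟨m, hm⟩ := hμdom i hi
        obtain ⟨m', hm'⟩ := h3 i hi
        exact ⟨m + m' + 1, fun _ => by rw [map_add, LinearMap.add_apply, hm, hm']; push_cast; ring⟩
      · exact ⟨0, fun h => absurd h hi⟩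
    choose m hm using hall
    have e2 : ((∑ i ∈ P.S, (n i : ℚ) * (q i * (m i + 1)) : ℚ) : k) = 0 := by
      rw [← e1, Rat.cast_sum]
      refine Finset.sum_congr rfl fun i hi => ?_
      rw [map_nsmul, hq, hm i hi, nsmul_eq_mul]
      push_cast; ring
    have e3 : (∑ i ∈ P.S, (n i : ℚ) * (q i * (m i + 1)) : ℚ) = 0 := by exact_mod_cast e2
    have hpos : ∀ i, 0 < q i * ((m i:ℚ) + 1) := fun i => mul_pos (hq0 i) (by positivity)
    rw [Finset.sum_eq_zero_iff_of_nonneg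
      (fun i _ => mul_nonneg (Nat.cast_nonneg _) (hpos i).le)] at e3
    have : μ - ν' = 0 := by
      rw [hn]
      refine Finset.sum_eq_zero fun i hi => ?_
      have := e3 i hi
      rw [mul_eq_zero] at this
      rcases this with h | h
      · have : n i = 0 := by exact_mod_cast h
        rw [this, zero_smul]
      · exact absurd h (hpos i).ne'
    rw [sub_eq_zero] at this
    exact this.symm
  have hswap := P.swap h0c A μ hanti hA1 horb
  -- the exponents
  have ha : ∀ t, ∃ a : ℕ, P.pr μ (P.c t) = a ∧ a ≠ 0 := by
    intro t
    obtain ⟨m, hm⟩ := P.cpos t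
    have hall : ∀ i, ∃ l : ℕ, i ∈ P.S → P.pr μ (P.c i) = l + 1 := by
      intro i
      by_cases hi : i ∈ P.S
      · obtain ⟨m, hm⟩ := hμdom i hi
        exact ⟨m, fun _ => hm⟩
      · exact ⟨0, fun h => absurd h hi⟩
    choose l hl using hall
    refine ⟨∑ i ∈ P.S, m i * (l i + 1), ?_, ?_⟩
    · rw [hm, map_sum, Nat.cast_sum]
      refine Finset.sum_congr rfl fun i hi => ?_
      rw [map_nsmul, hl i hi, nsmul_eq_mul]; push_cast; ring
    · intro h
      rw [Finset.sum_eq_zero_iff] at h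
      apply h0c t
      rw [hm]
      refine Finset.sum_eq_zero fun i hi => ?_
      have := h i hi
      have : m i = 0 := by simpa using this
      rw [this, zero_smul]
  choose a ha ha0 using ha
  have hh0 : ∀ t, hh t ≠ 0 := by
    intro t h
    obtain ⟨m, h1, h2⟩ := Q.ht_nat P (P.rpos t : P.Q (P.r t))
    rw [hhh, h] at h1
    have : m = 0 := by exact_mod_cast h1.symm
    exact h0 t (h2 this)
  refine ⟨a, ?_⟩
  set E : k → AddMonoidAlgebra k k := fun x => AddMonoidAlgebra.single x (1:k) with hE
  have hEadd : ∀ x y, E (x + y) = E x * E y := by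
    intro x y; simp [hE, AddMonoidAlgebra.single_mul_single]
  have hE0 : E 0 = 1 := by simp [hE, AddMonoidAlgebra.one_def]
  have e1 : P.ev P.flip.rho A = E (P.ht μ) * psiH k ((∑ j, (Polynomial.X : Polynomial k) ^ lv j) *
      ∏ t, (1 - Polynomial.X ^ hh t)) := by
    have e2 : P.ev P.flip.rho ch = E (P.ht (wt j0)) * psiH k (∑ j, (Polynomial.X : Polynomial k) ^ lv j) := by
      rw [hch, map_sum, map_sum, Finset.mul_sum]
      refine Finset.sum_congr rfl fun j _ => ?_
      rw [ev_single, psiH_X_pow, ← hlv]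
      change E (P.ht (wt j)) = E _ * E _
      rw [← hEadd]
      congr 1
      simp
    have e3 : P.ev P.flip.rho P.den = E (P.ht P.rho) * psiH k (∏ t, (1 - (Polynomial.X : Polynomial k) ^ hh t)) := by
      rw [den, map_mul, map_prod, map_prod, ev_single]
      congr 1
      refine Finset.prod_congr rfl fun t _ => ?_
      rw [map_sub, map_sub, map_one, map_one, psiH_X_pow, ev_single, ← hhh, ← map_neg]
      rfl
    rw [hA, map_mul, e2, e3, hμ, map_add, hEadd, map_mul]
    ring
  have e2 : P.flip.ev μ P.flip.den = E (P.ht μ) * psiH k (∏ t, (1 - (Polynomial.X : Polynomial k) ^ a t)) := by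
    rw [den, map_mul, map_prod, map_prod, ev_single]
    congr 1
    refine Finset.prod_congr rfl fun t _ => ?_
    rw [map_sub, map_sub, map_one, map_one, psiH_X_pow, ev_single, ← ha, ← map_neg]
    rfl
  rw [e1, e2] at hswap
  set C1 : k := (P.flip.den.coeff.support.card : k)
  set C2 : k := (A.coeff.support.card : k) with hC2
  have hunit : E (-P.ht μ) * E (P.ht μ) = 1 := by rw [← hEadd, neg_add_cancel, hE0]
  have hs2 : psiH k (C1 • ((∑ j, (Polynomial.X : Polynomial k) ^ lv j) *
      ∏ t, (1 - Polynomial.X ^ hh t))) = psiH k (C2 • ∏ t, (1 - (Polynomial.X : Polynomial k) ^ a t)) := by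
    rw [map_smul, map_smul]
    have := congrArg (fun f => E (-P.ht μ) * f) hswap
    simp only [mul_smul_comm, ← mul_assoc, hunit, one_mul] at this
    exact this
  have hs3 := psiH_inj k hs2
  have hcon := congrArg (fun p => Polynomial.eval 0 p) hs3
  simp only [Polynomial.eval_smul, Polynomial.eval_mul, Polynomial.eval_prod, Polynomial.eval_sub,
    Polynomial.eval_one, Polynomial.eval_pow, Polynomial.eval_X, zero_pow (hh0 _), zero_pow (ha0 _),
    Polynomial.eval_finset_sum, sub_zero, Finset.prod_const_one, mul_one] at hcon
  have hsum : ∑ j, (0:k) ^ lv j = 1 := by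
    rw [Finset.sum_eq_single j0]
    · have : lv j0 = 0 := by
        have := hlv j0
        rw [sub_self, map_zero] at this
        exact_mod_cast this.symm
      rw [this, pow_zero]
    · intro j _ hj
      apply zero_pow
      intro h
      apply hj
      apply hone
      obtain ⟨m, h1, h2⟩ := Q.ht_nat P (hle j)
      rw [hlv, h] at h1
      have : m = 0 := by exact_mod_cast h1.symm
      exact (sub_eq_zero.mp (h2 this)).symm
    · simp
  rw [hsum] at hcon
  simp only [smul_eq_mul, mul_one] at hcon
  have hC20 : C2 ≠ 0 := by
    rw [hC2]
    have : A.coeff.support.card ≠ 0 := by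
      rw [Finset.card_ne_zero]
      exact ⟨μ, by simp [hA1]⟩
    exact_mod_cast this
  rw [hcon] at hs3
  have hs4 := smul_right_injective _ hC20 hs3
  apply Polynomial.map_injective (Int.castRingHom k) Int.cast_injective
  simpa [Polynomial.map_mul, Polynomial.map_prod, Polynomial.map_sum] using hs4

end PRS
end PieceWeyl4

section PieceGab1
open Matrix

/-- matrix realisation of a root datum acting irreducibly -/
structure GD (k M N ι J : Type*) [Field k] [AddCommGroup M] [Module k M] [AddCommGroup N]
    [Module k N] [Fintype ι] [Fintype J] [DecidableEq J] where
  P : PRS k M N ι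
  h0 : ∀ t, P.r t ≠ 0
  h0c : ∀ t, P.c t ≠ 0
  rinj : ∀ i ∈ P.S, ∀ j ∈ P.S, P.r i = P.r j → i = j
  wt : J → M
  e : ι → Matrix J J k
  f : ι → Matrix J J k
  ewt : ∀ t j l, e t j l ≠ 0 → wt j = wt l + P.r t
  fwt : ∀ t j l, f t j l ≠ 0 → wt l = wt j + P.r t
  ef : ∀ t, e t * f t - f t * e t = diagonal (fun j => P.pr (wt j) (P.c t))
  e0 : ∀ t, e t ≠ 0
  comm : ∀ s ∈ P.S, ∀ t ∈ P.S, s ≠ t → e s * f t = f t * e s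
  irr : ∀ W : Submodule k (J → k), (∀ i ∈ P.S, ∀ w ∈ W, e i *ᵥ w ∈ W ∧ f i *ᵥ w ∈ W) →
    W = ⊥ ∨ W = ⊤
  B : M →ₗ[k] M →ₗ[k] k
  Bs : ∀ x y, B x y = B y x
  q : ι → ℚ
  q0 : ∀ t, 0 < q t
  hB : ∀ t x, B x (P.r t) = (q t : k) * P.pr x (P.c t)
  c0 : k
  cas : ∀ j, B (wt j) (wt j) + ∑ t, (q t : k) * ((e t * f t) j j + (f t * e t) j j) = c0

namespace GD
variable {k M N ι J : Type*} [Field k] [AddCommGroup M] [Module k M] [AddCommGroup N]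
    [Module k N] [Fintype ι] [Fintype J] [DecidableEq J] [CharZero k] [DecidableEq ι]
  (D : GD k M N ι J)

lemma Qr {i : ι} (hi : i ∈ D.P.S) : D.P.Q (D.P.r i) :=
  ⟨Pi.single i 1, by
    rw [Finset.sum_eq_single i]
    · simp
    · intro b _ hb; simp [hb]
    · intro h; exact absurd hi h⟩

lemma Qrt (t : ι) : D.P.Q (D.P.r t) := D.P.rpos t

lemma exists_max [Nonempty J] : ∃ j0 : J, ∀ j, D.P.Q (D.wt j - D.wt j0) → D.wt j = D.wt j0 := by
  let R : J → J → Prop := fun l j => D.P.Q (D.wt l - D.wt j) ∧ D.wt l ≠ D.wt j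
  have ht : IsTrans J R := ⟨fun a b c h1 h2 => by
    refine ⟨?_, fun h => ?_⟩
    · have := PRS.Q.add D.P h1.1 h2.1
      simpa using this
    · have h3 := PRS.Q.eq_zero D.P h1.1 h2.1 (by rw [h]; abel)
      exact h1.2 (sub_eq_zero.1 h3.1)⟩
  have hi : Std.Irrefl R := ⟨fun a h => h.2 rfl⟩
  obtain ⟨j0, -, h⟩ := (Finite.wellFounded_of_trans_of_irrefl R).has_min Set.univ Set.univ_nonempty
  refine ⟨j0, fun j hj => ?_⟩
  by_contra hne
  exact h j trivial ⟨hj, hne⟩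

lemma e_diag (t : ι) (y : N) : e D t * diagonal (fun j => D.P.pr (D.wt j) y) =
    diagonal (fun j => D.P.pr (D.wt j) y) * D.e t - D.P.pr (D.P.r t) y • D.e t := by
  ext j l
  simp only [mul_diagonal, Matrix.sub_apply, diagonal_mul, Matrix.smul_apply, smul_eq_mul]
  by_cases h : D.e t j l = 0
  · simp [h]
  · rw [D.ewt t j l h]; simp; ring

lemma f_diag (t : ι) (y : N) : f D t * diagonal (fun j => D.P.pr (D.wt j) y) =
    diagonal (fun j => D.P.pr (D.wt j) y) * D.f t + D.P.pr (D.P.r t) y • D.f t := by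
  ext j l
  simp only [mul_diagonal, Matrix.add_apply, diagonal_mul, Matrix.smul_apply, smul_eq_mul]
  by_cases h : D.f t j l = 0
  · simp [h]
  · rw [D.fwt t j l h]; simp; ring

section top
variable {j0 : J} (hmax : ∀ j, D.P.Q (D.wt j - D.wt j0) → D.wt j = D.wt j0)
  
lemma e_v0 (hmax : ∀ j, D.P.Q (D.wt j - D.wt j0) → D.wt j = D.wt j0) (t : ι) :
    D.e t *ᵥ Pi.single j0 1 = 0 := by
  ext j
  simp only [mulVec_single_one, col_apply, Pi.zero_apply]
  by_contra h
  have h1 := D.ewt t j j0 h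
  have h2 := hmax j (by rw [h1]; simpa using D.Qrt t)
  rw [h1] at h2
  exact D.h0 t (by simpa using h2)

lemma fstable_top (hmax : ∀ j, D.P.Q (D.wt j - D.wt j0) → D.wt j = D.wt j0)
    (W : Submodule k (J → k)) (h0 : Pi.single j0 1 ∈ W)
    (hf : ∀ i ∈ D.P.S, ∀ w ∈ W, D.f i *ᵥ w ∈ W) : W = ⊤ := by
  let C : Set (Submodule k (J → k)) := {W | Pi.single j0 1 ∈ W ∧ ∀ i ∈ D.P.S, ∀ w ∈ W, D.f i *ᵥ w ∈ W}
  let V := sInf C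
  have V0 : Pi.single j0 1 ∈ V := by
    rw [Submodule.mem_sInf]; exact fun p hp => hp.1
  have Vf : ∀ i ∈ D.P.S, ∀ w ∈ V, D.f i *ᵥ w ∈ V := by
    intro i hi w hw
    rw [Submodule.mem_sInf] at hw ⊢
    exact fun p hp => hp.2 i hi w (hw p hp)
  let V2 : Submodule k (J → k) :=
    { carrier := {w | w ∈ V ∧ (∀ i ∈ D.P.S, D.e i *ᵥ w ∈ V) ∧
        ∀ y, diagonal (fun j => D.P.pr (D.wt j) y) *ᵥ w ∈ V}
      add_mem' := by
        rintro a b ⟨h1, h2, h3⟩ ⟨h4, h5, h6⟩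
        refine ⟨V.add_mem h1 h4, fun i hi => ?_, fun y => ?_⟩
        · rw [mulVec_add]; exact V.add_mem (h2 i hi) (h5 i hi)
        · rw [mulVec_add]; exact V.add_mem (h3 y) (h6 y)
      zero_mem' := by
        refine ⟨V.zero_mem, fun i hi => ?_, fun y => ?_⟩ <;> rw [mulVec_zero] <;> exact V.zero_mem
      smul_mem' := by
        rintro c a ⟨h1, h2, h3⟩
        refine ⟨V.smul_mem c h1, fun i hi => ?_, fun y => ?_⟩
        · rw [mulVec_smul]; exact V.smul_mem c (h2 i hi)
        · rw [mulVec_smul]; exact V.smul_mem c (h3 y) }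
  have hV2 : V ≤ V2 := by
    refine sInf_le ⟨⟨V0, fun i hi => ?_, fun y => ?_⟩, ?_⟩
    · rw [D.e_v0 hmax]; exact V.zero_mem
    · have : diagonal (fun j => D.P.pr (D.wt j) y) *ᵥ (Pi.single j0 1) =
        D.P.pr (D.wt j0) y • (Pi.single j0 1 : J → k) := by
        ext j
        rw [mulVec_diagonal]
        by_cases h : j = j0
        · subst h; simp
        · simp [h]
      rw [this]; exact V.smul_mem _ V0
    · rintro i hi w ⟨h1, h2, h3⟩
      refine ⟨Vf i hi w h1, fun s hs => ?_, fun y => ?_⟩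
      · by_cases hsi : s = i
        · subst hsi
          have := D.ef s
          rw [sub_eq_iff_eq_add] at this
          rw [mulVec_mulVec, this, add_mulVec]
          refine V.add_mem (h3 _) ?_
          rw [← mulVec_mulVec]
          exact Vf s hs _ (h2 s hs)
        · rw [mulVec_mulVec, D.comm s hs i hi hsi, ← mulVec_mulVec]
          exact Vf i hi _ (h2 s hs)
      · have := D.f_diag i y
        rw [← sub_eq_iff_eq_add] at this
        rw [mulVec_mulVec, ← this, sub_mulVec, smul_mulVec, ← mulVec_mulVec]
        exact V.sub_mem (Vf i hi _ (h3 y)) (V.smul_mem _ (Vf i hi _ h1))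
  have hVtop : V = ⊤ := by
    refine (D.irr V fun i hi w hw => ⟨(hV2 hw).2.1 i hi, Vf i hi w hw⟩).resolve_left fun h => ?_
    rw [h, Submodule.mem_bot] at V0
    have := congrFun V0 j0
    simp at this
  rw [eq_top_iff, ← hVtop]
  exact sInf_le ⟨h0, hf⟩

/-- coordinate submodule -/
def cs (k : Type*) {J : Type*} [Field k] (p : J → Prop) : Submodule k (J → k) where
  carrier := {v | ∀ j, v j ≠ 0 → p j}
  add_mem' := by
    intro a b ha hb j h
    by_cases h1 : a j = 0
    · exact hb j (by simpa [h1] using h)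
    · exact ha j h1
  zero_mem' := by intro j h; simp at h
  smul_mem' := by
    intro c a ha j h
    exact ha j (fun h1 => h (by simp [h1]))

lemma mem_cs {k J : Type*} [Field k] {p : J → Prop} {v : J → k} :
  v ∈ cs k p ↔ ∀ j, v j ≠ 0 → p j := Iff.rfl

lemma cs_stable {p : J → Prop} (A : Matrix J J k) (h : ∀ j l, A j l ≠ 0 → p l → p j) :
    ∀ w ∈ cs k p, A *ᵥ w ∈ cs k p := by
  intro w hw j hj
  rw [mulVec, dotProduct] at hj
  obtain ⟨l, -, hl⟩ := Finset.exists_ne_zero_of_sum_ne_zero hj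
  exact h j l (left_ne_zero_of_mul hl) (hw l (right_ne_zero_of_mul hl))

lemma single_mem_cs {p : J → Prop} {j : J} : (Pi.single j 1 : J → k) ∈ cs k p ↔ p j := by
  constructor
  · intro h; exact h j (by simp)
  · intro h l hl
    by_cases h1 : l = j
    · rwa [h1]
    · simp [h1] at hl

lemma cs_top {p : J → Prop} (h : cs k p = ⊤) (j : J) : p j := by
  exact (single_mem_cs (k := k)).1 (by rw [h]; trivial)

lemma fstable_all (hmax : ∀ j, D.P.Q (D.wt j - D.wt j0) → D.wt j = D.wt j0)
    (p : J → Prop) (h0 : p j0) (hp : ∀ i ∈ D.P.S, ∀ j l, D.f i j l ≠ 0 → p l → p j) (j : J) : p j :=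
  cs_top (D.fstable_top hmax (cs k p) (single_mem_cs.2 h0)
    (fun i hi => cs_stable _ (hp i hi))) j

lemma hle' (hmax : ∀ j, D.P.Q (D.wt j - D.wt j0) → D.wt j = D.wt j0) (j : J) :
    j = j0 ∨ (D.P.Q (D.wt j0 - D.wt j) ∧ D.wt j ≠ D.wt j0) := by
  refine D.fstable_all hmax (fun j => j = j0 ∨ (D.P.Q (D.wt j0 - D.wt j) ∧ D.wt j ≠ D.wt j0))
    (Or.inl rfl) ?_ j
  intro i hi j l hjl hl
  have hw := D.fwt i j l hjl
  have hQ : D.P.Q (D.wt j0 - D.wt l) := by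
    rcases hl with rfl | h
    · simpa using PRS.Q.zero D.P
    · exact h.1
  have hj : D.wt j0 - D.wt j = (D.wt j0 - D.wt l) + D.P.r i := by rw [hw]; abel
  right
  refine ⟨?_, fun h => ?_⟩
  · rw [hj]; exact PRS.Q.add D.P hQ (D.Qrt i)
  · rw [h, sub_self] at hj
    exact D.h0 i (PRS.Q.eq_zero D.P hQ (D.Qrt i) hj.symm).2

lemma hle (hmax : ∀ j, D.P.Q (D.wt j - D.wt j0) → D.wt j = D.wt j0) (j : J) :
    D.P.Q (D.wt j0 - D.wt j) := by
  rcases D.hle' hmax j with rfl | h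
  · simpa using PRS.Q.zero D.P
  · exact h.1

lemma hone (hmax : ∀ j, D.P.Q (D.wt j - D.wt j0) → D.wt j = D.wt j0) (j : J)
   (h : D.wt j = D.wt j0) : j = j0 := by
  rcases D.hle' hmax j with h1 | h1
  · exact h1
  · exact absurd h h1.2

attribute [local instance] LieRing.ofAssociativeRing
lemma hdom (hmax : ∀ j, D.P.Q (D.wt j - D.wt j0) → D.wt j = D.wt j0) {i : ι} (hi : i ∈ D.P.S) :
    ∃ m : ℕ, D.P.pr (D.wt j0) (D.P.c i) = m := by
  let eE : Module.End k (J → k) := toLin' (D.e i)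
  let fE : Module.End k (J → k) := toLin' (D.f i)
  let hE : Module.End k (J → k) := toLin' (diagonal (fun j => D.P.pr (D.wt j) (D.P.c i)))
  have key : ∀ A B : Matrix J J k, (⁅(toLin' A : Module.End k (J → k)), toLin' B⁆ : Module.End k (J → k))
      = toLin' (A * B - B * A) := by
    intro A B
    rw [Ring.lie_def, map_sub, toLin'_mul, toLin'_mul]; rfl
  have t : IsSl2Triple hE eE fE := by
    refine ⟨?_, ?_, ?_, ?_⟩
    · intro h
      have h2 : diagonal (fun j => D.P.pr (D.wt j) (D.P.c i)) = 0 := by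
        exact toLin'.map_eq_zero_iff.1 h
      have h3 := D.e_diag i (D.P.c i)
      rw [h2, D.P.two i hi] at h3
      have h4 : (2:k) • D.e i = 0 := by simpa using h3
      exact D.e0 i (by simpa using h4)
    · rw [key, D.ef i]
    · rw [key, D.e_diag i, sub_sub_cancel, D.P.two i hi, map_smul, ofNat_smul_eq_nsmul]
    · rw [key, D.f_diag i, sub_add_cancel_left, D.P.two i hi, map_neg, map_smul, ofNat_smul_eq_nsmul]
  have hp : t.HasPrimitiveVectorWith (Pi.single j0 1 : J → k) (D.P.pr (D.wt j0) (D.P.c i)) := by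
    refine ⟨?_, ?_, ?_⟩
    · intro h
      have := congrFun h j0
      simp at this
    · change toLin' (diagonal (fun j => D.P.pr (D.wt j) (D.P.c i))) _ = _
      rw [toLin'_apply]
      ext j
      rw [mulVec_diagonal]
      by_cases h : j = j0
      · subst h; simp
      · simp [h]
    · change toLin' _ _ = _
      simpa using D.e_v0 hmax i
  exact hp.exists_nat

end top
end GD
end PieceGab1

section PieceGab2
open Matrix

lemma exp_conj {A : Type*} [Ring A] [Algebra ℚ A] {a z w u : A} (ha : IsNilpotent a)
    (h1 : a * z = z * a + w) (h2 : a * w = w * a + u) (h3 : a * u = u * a) :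
    IsNilpotent.exp a * z = (z + w + (2⁻¹ : ℚ) • u) * IsNilpotent.exp a := by
  let L : Module.End ℚ A := LinearMap.mulLeft ℚ a
  let R : Module.End ℚ A := LinearMap.mulRight ℚ a
  obtain ⟨N, hN⟩ := ha
  have hL : L ^ N = 0 := by
    rw [LinearMap.pow_mulLeft, hN]; ext; simp
  have hR : R ^ N = 0 := by
    rw [LinearMap.pow_mulRight, hN]; ext; simp
  have hc : Commute L R := by
    change L * R = R * L
    ext x; simp [L, R, mul_assoc]
  have hD : IsNilpotent (L - R) := hc.isNilpotent_sub ⟨N, hL⟩ ⟨N, hR⟩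
  have e1 : IsNilpotent.exp L = IsNilpotent.exp R * IsNilpotent.exp (L - R) := by
    rw [← IsNilpotent.exp_add_of_commute _ ⟨N, hR⟩ hD]
    · congr 1; abel
    · exact (hc.symm.sub_right (Commute.refl R))
  have e2 : IsNilpotent.exp L z = IsNilpotent.exp a * z := by
    rw [IsNilpotent.exp_eq_sum hL, IsNilpotent.exp_eq_sum hN, LinearMap.sum_apply, Finset.sum_mul]
    refine Finset.sum_congr rfl fun i _ => ?_
    rw [LinearMap.smul_apply, LinearMap.pow_mulLeft]; simp
  have e3 : ∀ y, IsNilpotent.exp R y = y * IsNilpotent.exp a := by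
    intro y
    rw [IsNilpotent.exp_eq_sum hR, IsNilpotent.exp_eq_sum hN, LinearMap.sum_apply, Finset.mul_sum]
    refine Finset.sum_congr rfl fun i _ => ?_
    rw [LinearMap.smul_apply, LinearMap.pow_mulRight]; simp
  have d1 : (L - R) z = w := by simp [L, R, h1]
  have d2 : (L - R) w = u := by simp [L, R, h2]
  have d3 : (L - R) u = 0 := by simp [L, R, h3]
  have p3 : ((L - R) ^ 3) • z = 0 := by
    change ((L - R) ^ 3) z = 0
    rw [pow_succ, pow_two]; simp only [Module.End.mul_apply, d1, d2, d3]
  have e4 : IsNilpotent.exp (L - R) z = z + w + (2⁻¹ : ℚ) • u := by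
    have := IsNilpotent.exp_smul_eq_sum (A := Module.End ℚ A) (M := A) (k := 3) p3 hD
    change IsNilpotent.exp (L - R) z = _ at this
    rw [this]
    simp only [Finset.sum_range_succ, Finset.sum_range_zero, Module.End.smul_def, pow_zero, pow_one,
      pow_two, Module.End.mul_apply, d1, d2, Module.End.one_apply]
    norm_num
  rw [← e2, e1, Module.End.mul_apply, e4, e3]

namespace GD
variable {k M N ι J : Type*} [Field k] [AddCommGroup M] [Module k M] [AddCommGroup N]
    [Module k N] [Fintype ι] [Fintype J] [DecidableEq J] [CharZero k] [DecidableEq ι]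
  (D : GD k M N ι J)

lemma nilp_of_lev {J k : Type*} [Fintype J] [DecidableEq J] [Field k] (A : Matrix J J k) (lv : J → ℕ)
    (h : ∀ j l, A j l ≠ 0 → lv l < lv j) : IsNilpotent A := by
  have key : ∀ m j l, (A ^ m) j l ≠ 0 → lv l + m ≤ lv j := by
    intro m
    induction m with
    | zero => 
      intro j l hjl
      by_cases h1 : j = l
      · simp [h1]
      · simp [h1] at hjl
    | succ m ih =>
      intro j l hjl
      rw [pow_succ, mul_apply] at hjl
      obtain ⟨x, -, hx⟩ := Finset.exists_ne_zero_of_sum_ne_zero hjl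
      have := ih j x (left_ne_zero_of_mul hx)
      have := h x l (right_ne_zero_of_mul hx)
      omega
  refine ⟨(∑ j, lv j) + 1, ?_⟩
  ext j l
  by_contra hne
  have h1 := key _ j l hne
  have : lv j ≤ ∑ j, lv j := Finset.single_le_sum (fun _ _ => Nat.zero_le _) (Finset.mem_univ j)
  omega

variable {j0 : J} 

lemma exists_lv (hmax : ∀ j, D.P.Q (D.wt j - D.wt j0) → D.wt j = D.wt j0) :
    ∃ lv : J → ℕ, ∀ j, D.P.ht (D.wt j0 - D.wt j) = lv j := by
  choose m hm using fun j => (D.hle hmax j).ht_nat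
  exact ⟨m, fun j => (hm j).1⟩

lemma exists_hh : ∃ hh : ι → ℕ, ∀ t, D.P.ht (D.P.r t) = hh t ∧ 0 < hh t := by
  choose m hm using fun t => (D.Qrt t).ht_nat
  exact ⟨m, fun t => ⟨(hm t).1, Nat.pos_of_ne_zero fun h => D.h0 t ((hm t).2 h)⟩⟩

lemma lv_of_add {lv : J → ℕ} (hlv : ∀ j, D.P.ht (D.wt j0 - D.wt j) = lv j) {hh : ι → ℕ}
    (hhh : ∀ t, D.P.ht (D.P.r t) = hh t ∧ 0 < hh t) {j l : J} {t : ι}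
    (h : D.wt j = D.wt l + D.P.r t) : lv l = lv j + hh t := by
  have h1 := hlv j
  have h2 := hlv l
  rw [h] at h1
  rw [← sub_sub, map_sub, h2, (hhh t).1, sub_eq_iff_eq_add] at h1
  exact_mod_cast h1

lemma nil_e (hmax : ∀ j, D.P.Q (D.wt j - D.wt j0) → D.wt j = D.wt j0) (t : ι) :
    IsNilpotent (D.e t) := by
  obtain ⟨lv, hlv⟩ := D.exists_lv hmax
  obtain ⟨hh, hhh⟩ := D.exists_hh
  rw [← isNilpotent_transpose_iff]
  refine nilp_of_lev _ lv fun j l h => ?_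
  have := D.lv_of_add hlv hhh (D.ewt t l j h)
  have := (hhh t).2
  omega

lemma nil_f (hmax : ∀ j, D.P.Q (D.wt j - D.wt j0) → D.wt j = D.wt j0) (t : ι) :
    IsNilpotent (D.f t) := by
  obtain ⟨lv, hlv⟩ := D.exists_lv hmax
  obtain ⟨hh, hhh⟩ := D.exists_hh
  refine nilp_of_lev _ lv fun j l h => ?_
  have := D.lv_of_add hlv hhh (D.fwt t j l h)
  have := (hhh t).2
  omega

lemma hsym (hmax : ∀ j, D.P.Q (D.wt j - D.wt j0) → D.wt j = D.wt j0) {i : ι} (hi : i ∈ D.P.S) :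
    ∑ j, AddMonoidAlgebra.single (D.P.s i (D.wt j)) (1 : k) =
      ∑ j, AddMonoidAlgebra.single (D.wt j) (1 : k) := by
  let E := IsNilpotent.exp (D.e i)
  let F := IsNilpotent.exp (- D.f i)
  let h : N → Matrix J J k := fun y => diagonal (fun j => D.P.pr (D.wt j) y)
  have ne := D.nil_e hmax i
  have nf := (D.nil_f hmax i).neg
  have E1 : ∀ y, E * h y = (h y - D.P.pr (D.P.r i) y • D.e i) * E := by
    intro y
    have := exp_conj (u := 0) (w := -(D.P.pr (D.P.r i) y • D.e i)) (z := h y) ne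
      (by rw [D.e_diag]; abel) (by simp) (by simp)
    rw [this]; simp [sub_eq_add_neg, E]
  have F1 : ∀ y, F * h y = (h y - D.P.pr (D.P.r i) y • D.f i) * F := by
    intro y
    have := exp_conj (u := 0) (w := -(D.P.pr (D.P.r i) y • D.f i)) (z := h y) nf
      (by rw [neg_mul, D.f_diag, mul_neg]; abel) (by simp) (by simp)
    rw [this]; simp [sub_eq_add_neg, F]
  have F2 : F * D.e i = (D.e i + h (D.P.c i) - D.f i) * F := by
    have hef := D.ef i
    have := exp_conj (u := -((2:k) • D.f i)) (w := h (D.P.c i)) (z := D.e i) nf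
      (by simp only [h]; rw [← D.ef i]; noncomm_ring)
      (by simp only [h]; rw [neg_mul, D.f_diag, mul_neg, D.P.two i hi]; abel) (by simp)
    rw [this]
    congr 1
    rw [sub_eq_add_neg]
    congr 1
    ext a b
    simp [Rat.smul_def]
  have E2 : E * D.e i = D.e i * E := by
    have := exp_conj (u := 0) (w := 0) (z := D.e i) ne (by simp) (by simp) (by simp)
    rw [this]; simp [E]
  let θ := E * F * E
  have hθ : ∀ y, θ * h y = (h y - D.P.pr (D.P.r i) y • h (D.P.c i)) * θ := by
    intro y
    set a := D.P.pr (D.P.r i) y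
    have e0 := E1 (D.P.c i)
    rw [D.P.two i hi] at e0
    calc θ * h y = E * (F * (E * h y)) := by simp only [θ, Matrix.mul_assoc]
      _ = E * ((F * h y - a • (F * D.e i)) * E) := by
        rw [E1, ← Matrix.mul_assoc F, Matrix.mul_sub, Matrix.mul_smul]
      _ = E * ((h y - a • D.f i - a • (D.e i + h (D.P.c i) - D.f i)) * F * E) := by
        rw [F1, F2]; simp only [Matrix.sub_mul, Matrix.smul_mul, a]
      _ = E * ((h y - a • D.e i - a • h (D.P.c i)) * F * E) := by
        congr 3; module
      _ = (E * h y - a • (E * D.e i) - a • (E * h (D.P.c i))) * F * E := by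
        rw [← Matrix.mul_assoc, ← Matrix.mul_assoc, Matrix.mul_sub, Matrix.mul_sub, Matrix.mul_smul,
          Matrix.mul_smul]
      _ = ((h y - a • D.e i - a • D.e i - a • (h (D.P.c i) - (2:k) • D.e i)) * E) * F * E := by
        rw [e0, E1, E2]
        simp only [Matrix.sub_mul, Matrix.smul_mul, a]
      _ = ((h y - a • h (D.P.c i)) * E) * F * E := by
        congr 3; module
      _ = _ := by simp only [θ, Matrix.mul_assoc]
  have hwt : ∀ j l, θ j l ≠ 0 → D.wt l = D.P.s i (D.wt j) := by
    intro j l hjl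
    rw [← sub_eq_zero]
    refine D.P.spr _ fun t => ?_
    have := congrFun (congrFun (hθ (D.P.c t)) j) l
    simp only [h, mul_diagonal, ← diagonal_smul, diagonal_sub, diagonal_mul] at this
    have h2 := mul_left_cancel₀ hjl (this.trans (mul_comm _ _))
    rw [map_sub, LinearMap.sub_apply, h2, PRS.s_apply]
    simp
    ring
  have hu : IsUnit θ := by
    refine IsUnit.mul (IsUnit.mul ?_ ?_) ?_
    · exact IsNilpotent.isUnit_exp ne
    · exact IsNilpotent.isUnit_exp nf
    · exact IsNilpotent.isUnit_exp ne
  have hdet : θ.det ≠ 0 := by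
    rw [Matrix.isUnit_iff_isUnit_det] at hu
    exact hu.ne_zero
  rw [det_apply'] at hdet
  obtain ⟨π, -, hπ⟩ := Finset.exists_ne_zero_of_sum_ne_zero hdet
  have hπ' : ∀ j, θ (π j) j ≠ 0 := fun j => by
    have := right_ne_zero_of_mul hπ
    rw [Finset.prod_ne_zero_iff] at this
    exact this j (Finset.mem_univ j)
  rw [← Equiv.sum_comp π]
  refine Finset.sum_congr rfl fun j _ => ?_
  rw [← hwt _ _ (hπ' j)]
end GD
end PieceGab2

section PieceGab3
open Matrix

namespace GD
variable {k M N ι J : Type*} [Field k] [AddCommGroup M] [Module k M] [AddCommGroup N]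
    [Module k N] [Fintype ι] [Fintype J] [DecidableEq J] [CharZero k] [DecidableEq ι]
  (D : GD k M N ι J)

open AddMonoidAlgebra in
lemma shift_T (t : ι) : single (-D.P.r t) (1:k) * ∑ j, single (D.wt j) ((D.e t * D.f t) j j) =
    ∑ j, single (D.wt j) ((D.f t * D.e t) j j) := by
  have h1 : ∀ j, single (D.wt j) ((D.e t * D.f t) j j) = ∑ l, single (D.wt j) (D.e t j l * D.f t l j) := by
    intro j
    rw [Matrix.mul_apply]
    exact map_sum (singleAddHom (D.wt j)) _ _
  have h2 : ∀ j, single (D.wt j) ((D.f t * D.e t) j j) = ∑ l, single (D.wt j) (D.f t j l * D.e t l j) := by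
    intro j
    rw [Matrix.mul_apply]
    exact map_sum (singleAddHom (D.wt j)) _ _
  simp only [h1, h2, Finset.mul_sum]
  rw [Finset.sum_comm]
  refine Finset.sum_congr rfl fun l _ => Finset.sum_congr rfl fun j _ => ?_
  rw [single_mul_single, one_mul, mul_comm (D.f t l j)]
  by_cases h : D.e t j l = 0
  · simp [h]
  · rw [D.ewt t j l h]; congr 1; abel

open AddMonoidAlgebra in
lemma shift_T' (t : ι) : single (D.P.r t) (1:k) * ∑ j, single (D.wt j) ((D.f t * D.e t) j j) =
    ∑ j, single (D.wt j) ((D.e t * D.f t) j j) := by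
  rw [← D.shift_T t, ← mul_assoc, single_mul_single]
  simp [← one_def]

open AddMonoidAlgebra in
lemma diff_T (t : ι) : (∑ j, single (D.wt j) ((D.e t * D.f t) j j)) -
    ∑ j, single (D.wt j) ((D.f t * D.e t) j j) = ∑ j, single (D.wt j) (D.P.pr (D.wt j) (D.P.c t)) := by
  rw [← Finset.sum_sub_distrib]
  refine Finset.sum_congr rfl fun j _ => ?_
  rw [← single_sub]
  congr 1
  have := congrFun (congrFun (D.ef t) j) j
  simpa using this

variable {j0 : J}
open AddMonoidAlgebra in
lemma weyl_poly (hmax : ∀ j, D.P.Q (D.wt j - D.wt j0) → D.wt j = D.wt j0) 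
    (lv : J → ℕ) (hlv : ∀ j, D.P.ht (D.wt j0 - D.wt j) = lv j) (hh : ι → ℕ)
    (hhh : ∀ t, D.P.ht (D.P.r t) = hh t) : 
    ∃ a : ι → ℕ, (∑ j, (Polynomial.X : Polynomial ℤ)^lv j) * ∏ t, (1 - Polynomial.X^hh t) = ∏ t, (1 - Polynomial.X^a t) := by
  have hqs : ∀ t (g : J → k), (D.q t : k) • ∑ j, single (D.wt j) (g j) = ∑ j, single (D.wt j) ((D.q t : k) * g j) := by
    intro t g
    rw [Finset.smul_sum]
    simp [AddMonoidAlgebra.smul_single]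
  refine D.P.weyl_poly D.h0 D.h0c D.B D.Bs (fun t => ⟨D.q t, D.q0 t, D.hB t⟩) D.wt
    (fun t => (D.q t : k) • ∑ j, single (D.wt j) ((D.e t * D.f t) j j))
    (fun t => (D.q t : k) • ∑ j, single (D.wt j) ((D.f t * D.e t) j j)) D.c0 ?_ ?_ ?_
    (fun i hi => D.hsym hmax hi) j0 (fun i hi => D.hdom hmax hi) (D.hle hmax) (D.hone hmax) lv hlv hh hhh
  · intro t
    rw [mul_smul_comm, sub_mul, one_mul, D.shift_T, D.diff_T, hqs]
    simp only [D.hB]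
  · intro t
    rw [mul_smul_comm, sub_mul, one_mul, D.shift_T', ← neg_sub (∑ j, single (D.wt j) ((D.e t * D.f t) j j)), D.diff_T, smul_neg, hqs]
    simp only [D.hB]
  · simp only [hqs]
    rw [Finset.smul_sum]
    simp only [← Finset.sum_add_distrib, ← AddMonoidAlgebra.single_add]
    rw [Finset.sum_comm, ← Finset.sum_add_distrib]
    refine Finset.sum_congr rfl fun j _ => ?_
    rw [AddMonoidAlgebra.smul_single, smul_eq_mul, mul_one, ← D.cas j, AddMonoidAlgebra.single_add]
    congr 1
    simp only [← mul_add]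
    exact (map_sum (singleAddHom (D.wt j)) _ _).symm

lemma lv_contig (hmax : ∀ j, D.P.Q (D.wt j - D.wt j0) → D.wt j = D.wt j0) 
    (lv : J → ℕ) (hlv : ∀ j, D.P.ht (D.wt j0 - D.wt j) = lv j) (m : ℕ) (j : J) (hj : lv j = m + 1) :
    ∃ l, lv l = m := by
  obtain ⟨hh, hhh⟩ := D.exists_hh
  by_contra hne
  push Not at hne
  have := D.fstable_all hmax (fun j => lv j ≤ m) ?_ ?_ j
  · omega
  · have := hlv j0
    rw [sub_self, map_zero] at this
    have : lv j0 = 0 := by exact_mod_cast this.symm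
    omega
  · intro i hi a b hab hb
    have h1 := D.lv_of_add hlv hhh (D.fwt i a b hab)
    have h2 : hh i = 1 := by
      have := (hhh i).1
      rw [D.P.ht_r hi] at this
      exact_mod_cast this.symm
    have := hne b
    omega

lemma lv_lt (hmax : ∀ j, D.P.Q (D.wt j - D.wt j0) → D.wt j = D.wt j0) 
    (lv : J → ℕ) (hlv : ∀ j, D.P.ht (D.wt j0 - D.wt j) = lv j) (j : J) : lv j < Fintype.card J := by
  have key : ∀ m, ∀ j, lv j = m → Finset.range (m+1) ⊆ Finset.univ.image lv := by
    intro m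
    induction m with
    | zero =>
      intro j hj x hx
      simp at hx ⊢
      exact ⟨j, by omega⟩
    | succ m ih =>
      intro j hj x hx
      obtain ⟨l, hl⟩ := D.lv_contig hmax lv hlv m j hj
      by_cases h : x = m + 1
      · simp; exact ⟨j, by omega⟩
      · exact ih l hl (by simp at hx ⊢; omega)
  have := Finset.card_le_card (key _ j rfl)
  have h2 := Finset.card_image_le (s := Finset.univ) (f := lv)
  rw [Finset.card_range] at this
  rw [Finset.card_univ] at h2
  omega

theorem lv_inj {n : ℕ} (hn : n.Prime) (hJ : Fintype.card J = n)
    (hmax : ∀ j, D.P.Q (D.wt j - D.wt j0) → D.wt j = D.wt j0) 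
    (lv : J → ℕ) (hlv : ∀ j, D.P.ht (D.wt j0 - D.wt j) = lv j) : Function.Injective lv := by
  obtain ⟨hh, hhh⟩ := D.exists_hh
  obtain ⟨a, ha⟩ := D.weyl_poly hmax lv hlv hh (fun t => (hhh t).1)
  have hl := D.lv_lt hmax lv hlv
  rw [hJ] at hl
  refine levels_inj n hn hJ lv hl Finset.univ hh a (fun t _ => ⟨(hhh t).2, ?_⟩) ha
  have := D.e0 t
  by_contra hlt
  apply this
  ext j l
  by_contra hne
  have := D.lv_of_add hlv hhh (D.ewt t j l hne)
  have := hl l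
  omega

/-- Final chain form: an enumeration `g : Fin n ≃ J` by levels. -/
theorem chain {n : ℕ} (hn : n.Prime) (hJ : Fintype.card J = n) :
    ∃ g : Fin n ≃ J, (∀ i ∈ D.P.S, ∀ a b : Fin n, D.f i (g a) (g b) ≠ 0 → (a:ℕ) = b + 1) ∧ 
      (∀ i ∈ D.P.S, ∀ a b : Fin n, D.e i (g a) (g b) ≠ 0 → (b:ℕ) = a + 1) := by
  have : Nonempty J := Fintype.card_pos_iff.1 (hJ ▸ hn.pos)
  obtain ⟨j0, hmax⟩ := D.exists_max
  obtain ⟨lv, hlv⟩ := D.exists_lv hmax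
  obtain ⟨hh, hhh⟩ := D.exists_hh
  have hi := D.lv_inj hn hJ hmax lv hlv
  have hl := D.lv_lt hmax lv hlv
  rw [hJ] at hl
  let φ : J → Fin n := fun j => ⟨lv j, hl j⟩
  have hφ : Function.Bijective φ := by
    rw [Fintype.bijective_iff_injective_and_card]
    exact ⟨fun a b h => hi (by simpa [φ] using h), by simpa using hJ⟩
  let g := (Equiv.ofBijective φ hφ).symm
  have hg : ∀ a, lv (g a) = a := by
    intro a
    have : φ (g a) = a := (Equiv.ofBijective φ hφ).apply_symm_apply a
    exact congrArg Fin.val this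
  have h1 : ∀ i ∈ D.P.S, hh i = 1 := by
    intro i hi
    have := (hhh i).1
    rw [D.P.ht_r hi] at this
    exact_mod_cast this.symm
  refine ⟨g, fun i hi a b h => ?_, fun i hi a b h => ?_⟩
  · have := D.lv_of_add hlv hhh (D.fwt i _ _ h)
    rwa [hg, hg, h1 i hi] at this
  · have := D.lv_of_add hlv hhh (D.ewt i _ _ h)
    rwa [hg, hg, h1 i hi] at this
end GD
end PieceGab3

section PieceGab4
open Matrix

lemma sl_gen {k J : Type*} [Field k] [Fintype J] [DecidableEq J] {n : ℕ} (hn : 0 < n) (G : ℕ → J)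
    (Gs : ∀ j, ∃ a, a < n ∧ G a = j) (Gi : ∀ a b, a < n → b < n → G a = G b → a = b)
    (L : Submodule k (Matrix J J k)) (hL : ∀ x ∈ L, ∀ y ∈ L, x * y - y * x ∈ L)
    (h1 : ∀ m, m + 1 < n → Matrix.single (G m) (G (m+1)) (1:k) ∈ L ∧ Matrix.single (G (m+1)) (G m) (1:k) ∈ L)
    (X : Matrix J J k) (hX : X.trace = 0) : X ∈ L := by
  have key : ∀ d a, a + d + 1 < n → Matrix.single (G a) (G (a+d+1)) (1:k) ∈ L ∧ 
      Matrix.single (G (a+d+1)) (G a) (1:k) ∈ L := by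
    intro d
    induction d with
    | zero => intro a ha; exact h1 a ha
    | succ d ih =>
      intro a ha
      obtain ⟨i1, i2⟩ := ih a (by omega)
      obtain ⟨i3, i4⟩ := h1 (a+d+1) (by omega)
      have hne : G (a+d+1+1) ≠ G a := fun h => by
        have := Gi _ _ (by omega) (by omega) h
        omega
      constructor
      · have := hL _ i1 _ i3
        rwa [single_mul_single_same, single_mul_single_of_ne _ _ _ _ hne, sub_zero, mul_one] at this
      · have := hL _ i4 _ i2
        rwa [single_mul_single_same, single_mul_single_of_ne _ _ _ _ hne.symm, sub_zero, mul_one] at this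
  have off : ∀ j l, j ≠ l → Matrix.single j l (1:k) ∈ L := by
    intro j l hjl
    obtain ⟨a, ha, rfl⟩ := Gs j
    obtain ⟨b, hb, rfl⟩ := Gs l
    have hab : a ≠ b := fun h => hjl (by rw [h])
    rcases lt_or_gt_of_ne hab with h | h
    · have := (key (b - a - 1) a (by omega)).1
      rwa [show a + (b - a - 1) + 1 = b by omega] at this
    · have := (key (a - b - 1) b (by omega)).2
      rwa [show b + (a - b - 1) + 1 = a by omega] at this
  have dg : ∀ j, Matrix.single j j (1:k) - Matrix.single (G 0) (G 0) (1:k) ∈ L := by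
    intro j
    by_cases h : j = G 0
    · rw [h, sub_self]; exact L.zero_mem
    · have := hL _ (off j (G 0) h) _ (off (G 0) j (Ne.symm h))
      rwa [single_mul_single_same, single_mul_single_same, mul_one] at this
  have : X = ∑ j, ∑ l, X j l • (Matrix.single j l (1:k) - if j = l then Matrix.single (G 0) (G 0) (1:k) else 0) := by
    have e1 : ∀ j, ∑ l, X j l • (Matrix.single j l (1:k) - if j = l then Matrix.single (G 0) (G 0) (1:k) else 0)
      = (∑ l, Matrix.single j l (X j l)) - X j j • Matrix.single (G 0) (G 0) (1:k) := by
      intro j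
      simp [smul_sub, Finset.sum_sub_distrib]
    simp only [e1]
    rw [Finset.sum_sub_distrib, ← Finset.sum_smul]
    have : ∑ j, X j j = 0 := hX
    rw [this, zero_smul, sub_zero]
    exact matrix_eq_sum_single X
  rw [this]
  refine L.sum_mem fun j _ => L.sum_mem fun l _ => L.smul_mem _ ?_
  split_ifs with h
  · subst h; exact dg j
  · rw [sub_zero]; exact off j l h

namespace GD
variable {k M N ι J : Type*} [Field k] [AddCommGroup M] [Module k M] [AddCommGroup N]
    [Module k N] [Fintype ι] [Fintype J] [DecidableEq J] [CharZero k] [DecidableEq ι]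
  (D : GD k M N ι J)

theorem core {n : ℕ} (hn : n.Prime) (hodd : Odd n) (hJ : Fintype.card J = n) :
    (∀ L : Submodule k (Matrix J J k), (∀ x ∈ L, ∀ y ∈ L, x * y - y * x ∈ L) →
      (∀ i ∈ D.P.S, D.e i ∈ L ∧ D.f i ∈ L) → ∀ X : Matrix J J k, X.trace = 0 → X ∈ L) ∨
    ∃ Φ : Matrix J J k, Φ.det ≠ 0 ∧ ∀ i ∈ D.P.S, (D.e i)ᵀ * Φ + Φ * D.e i = 0 ∧
      (D.f i)ᵀ * Φ + Φ * D.f i = 0 := by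
  have hn2 := hn.two_le
  obtain ⟨g, hgf, hge⟩ := D.chain hn hJ
  let G : ℕ → J := fun m => if h : m < n then g ⟨m, h⟩ else g ⟨0, hn.pos⟩
  have hG : ∀ m (h : m < n), G m = g ⟨m, h⟩ := fun m h => by simp [G, h]
  have Gs : ∀ j, ∃ a, a < n ∧ G a = j := fun j => ⟨g.symm j, (g.symm j).2, by rw [hG _ (g.symm j).2]; simp⟩
  have Gi : ∀ a b, a < n → b < n → G a = G b → a = b := by
    intro a b ha hb h
    rw [hG a ha, hG b hb] at h
    simpa using g.injective h
  have Gf : ∀ i ∈ D.P.S, ∀ a b, a < n → b < n → D.f i (G a) (G b) ≠ 0 → a = b + 1 := by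
    intro i hi a b ha hb h
    rw [hG a ha, hG b hb] at h
    exact hgf i hi _ _ h
  have Ge : ∀ i ∈ D.P.S, ∀ a b, a < n → b < n → D.e i (G a) (G b) ≠ 0 → b = a + 1 := by
    intro i hi a b ha hb h
    rw [hG a ha, hG b hb] at h
    exact hge i hi _ _ h
  clear_value G
  clear hgf hge hG g
  let φ : ι → ℕ → k := fun i m => if 1 ≤ m ∧ m < n then D.f i (G m) (G (m-1)) else 0
  let ε : ι → ℕ → k := fun i m => if 1 ≤ m ∧ m < n then D.e i (G (m-1)) (G m) else 0
  have hφ : ∀ i m, m + 1 < n → D.f i (G (m+1)) (G m) = φ i (m+1) := fun i m h => by simp [φ, h]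
  have hε : ∀ i m, m + 1 < n → D.e i (G m) (G (m+1)) = ε i (m+1) := fun i m h => by simp [ε, h]
  have x0 : ∀ i, φ i 0 = 0 := fun i => by simp [φ]
  have xn : ∀ i, φ i n = 0 := fun i => by simp [φ]
  have φne : ∀ m, m + 1 < n → ∃ i ∈ D.P.S, φ i (m+1) ≠ 0 := by
    intro m hm
    by_contra hne
    push Not at hne
    have st : ∀ i ∈ D.P.S, ∀ w ∈ cs k (fun j => ∃ a, a ≤ m ∧ G a = j), 
        D.e i *ᵥ w ∈ cs k (fun j => ∃ a, a ≤ m ∧ G a = j) ∧ D.f i *ᵥ w ∈ cs k (fun j => ∃ a, a ≤ m ∧ G a = j) := by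
      refine fun i hi w hw => ⟨cs_stable _ ?_ w hw, cs_stable _ ?_ w hw⟩
      · rintro j l hjl ⟨b, hb, rfl⟩
        obtain ⟨a, ha, rfl⟩ := Gs j
        have := Ge i hi a b ha (by omega) hjl
        exact ⟨a, by omega, rfl⟩
      · rintro j l hjl ⟨b, hb, rfl⟩
        obtain ⟨a, ha, rfl⟩ := Gs j
        have := Gf i hi a b ha (by omega) hjl
        refine ⟨a, ?_, rfl⟩
        by_contra hlt
        have h2 : b = m := by omega
        subst h2
        subst this
        rw [hφ i b hm] at hjl
        exact hjl (hne i hi)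
    rcases D.irr _ st with h | h
    · have : (Pi.single (G 0) 1 : J → k) ∈ cs k (fun j => ∃ a, a ≤ m ∧ G a = j) := 
        single_mem_cs.2 ⟨0, by omega, rfl⟩
      rw [h, Submodule.mem_bot] at this
      have := congrFun this (G 0)
      simp at this
    · obtain ⟨a, ha, hh⟩ := cs_top h (G (m+1))
      have := Gi _ _ (by omega) hm hh
      omega
  have εne : ∀ m, m + 1 < n → ∃ i ∈ D.P.S, ε i (m+1) ≠ 0 := by
    intro m hm
    by_contra hne
    push Not at hne
    have st : ∀ i ∈ D.P.S, ∀ w ∈ cs k (fun j => ∃ a, m < a ∧ a < n ∧ G a = j), 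
        D.e i *ᵥ w ∈ cs k (fun j => ∃ a, m < a ∧ a < n ∧ G a = j) ∧ 
        D.f i *ᵥ w ∈ cs k (fun j => ∃ a, m < a ∧ a < n ∧ G a = j) := by
      refine fun i hi w hw => ⟨cs_stable _ ?_ w hw, cs_stable _ ?_ w hw⟩
      · rintro j l hjl ⟨b, hb, hbn, rfl⟩
        obtain ⟨a, ha, rfl⟩ := Gs j
        have := Ge i hi a b ha (by omega) hjl
        refine ⟨a, ?_, ha, rfl⟩
        by_contra hlt
        have h2 : a = m := by omega
        subst h2
        subst this
        rw [hε i a hm] at hjl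
        exact hjl (hne i hi)
      · rintro j l hjl ⟨b, hb, hbn, rfl⟩
        obtain ⟨a, ha, rfl⟩ := Gs j
        have := Gf i hi a b ha (by omega) hjl
        exact ⟨a, by omega, ha, rfl⟩
    rcases D.irr _ st with h | h
    · have : (Pi.single (G (m+1)) 1 : J → k) ∈ cs k (fun j => ∃ a, m < a ∧ a < n ∧ G a = j) := 
        single_mem_cs.2 ⟨m+1, by omega, hm, rfl⟩
      rw [h, Submodule.mem_bot] at this
      have := congrFun this (G (m+1))
      simp at this
    · obtain ⟨a, ha, han, hh⟩ := cs_top h (G 0)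
      have := Gi _ _ han (by omega) hh
      omega
  have φw : ∀ i m, m + 1 < n → φ i (m+1) ≠ 0 → D.wt (G m) = D.wt (G (m+1)) + D.P.r i := by
    intro i m hm h
    rw [← hφ i m hm] at h
    exact D.fwt i _ _ h
  have εw : ∀ i m, m + 1 < n → ε i (m+1) ≠ 0 → D.wt (G m) = D.wt (G (m+1)) + D.P.r i := by
    intro i m hm h
    rw [← hε i m hm] at h
    exact D.ewt i _ _ h
  have hcol : ∀ m, m + 1 < n → ∃ c : {i // i ∈ D.P.S}, φ c (m+1) ≠ 0 ∧ ε c (m+1) ≠ 0 ∧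
      ∀ i ∈ D.P.S, i ≠ c → φ i (m+1) = 0 ∧ ε i (m+1) = 0 := by
    intro m hm
    obtain ⟨i, hi, h1⟩ := φne m hm
    obtain ⟨i', hi', h1'⟩ := εne m hm
    have h2 := φw i m hm h1
    have h3 := εw i' m hm h1'
    have : i' = i := D.rinj _ hi' _ hi (by rw [h2] at h3; simpa using h3.symm)
    subst this
    refine ⟨⟨i', hi⟩, h1, h1', fun t ht hti => ⟨?_, ?_⟩⟩
    · by_contra h
      exact hti (D.rinj _ ht _ hi (by have := φw t m hm h; rw [h2] at this; simpa using this.symm))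
    · by_contra h
      exact hti (D.rinj _ ht _ hi (by have := εw t m hm h; rw [h2] at this; simpa using this.symm))
  obtain ⟨cd, -⟩ := hcol 0 (by omega)
  have hcol' : ∀ m, ∃ c : {i // i ∈ D.P.S}, 1 ≤ m → m < n → φ c m ≠ 0 ∧ ε c m ≠ 0 ∧
      ∀ i ∈ D.P.S, i ≠ c → φ i m = 0 ∧ ε i m = 0 := by
    intro m
    by_cases h : 1 ≤ m ∧ m < n
    · obtain ⟨c, hc⟩ := hcol (m-1) (by omega)
      rw [show m - 1 + 1 = m by omega] at hc
      exact ⟨c, fun _ _ => hc⟩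
    · exact ⟨cd, fun h1 h2 => absurd ⟨h1, h2⟩ h⟩
  choose c hc using hcol'
  have rec1 : ∀ i ∈ D.P.S, ∀ m, m < n → ε i (m+1) * φ i (m+1) - ε i m * φ i m = D.P.pr (D.wt (G m)) (D.P.c i) := by
    intro i hi m hm
    have := congrFun (congrFun (D.ef i) (G m)) (G m)
    rw [Matrix.sub_apply, diagonal_apply_eq] at this
    rw [← this]
    congr 1
    · rw [mul_apply]
      by_cases h : m + 1 < n
      · rw [Finset.sum_eq_single (G (m+1)), hε i m h, hφ i m h]
        · intro b _ hb
          obtain ⟨a, ha, rfl⟩ := Gs b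
          by_contra hne
          have := Ge i hi m a hm ha (left_ne_zero_of_mul hne)
          exact hb (by rw [this])
        · simp
      · rw [Finset.sum_eq_zero]
        · simp [φ, h]
        · intro b _
          obtain ⟨a, ha, rfl⟩ := Gs b
          by_contra hne
          have := Ge i hi m a hm ha (left_ne_zero_of_mul hne)
          omega
    · rw [mul_apply]
      rcases Nat.eq_zero_or_pos m with rfl | h
      · rw [Finset.sum_eq_zero]
        · simp [φ]
        · intro b _
          obtain ⟨a, ha, rfl⟩ := Gs b
          by_contra hne
          have := Gf i hi 0 a hm ha (left_ne_zero_of_mul hne)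
          omega
      · obtain ⟨m, rfl⟩ : ∃ m', m = m' + 1 := ⟨m - 1, by omega⟩
        rw [Finset.sum_eq_single (G m), hε i m hm, hφ i m hm, mul_comm]
        · intro b _ hb
          obtain ⟨a, ha, rfl⟩ := Gs b
          by_contra hne
          have := Gf i hi (m+1) a hm ha (left_ne_zero_of_mul hne)
          exact hb (by congr 1; omega)
        · simp
  let x : ℕ → {i // i ∈ D.P.S} → k := fun m i => ε i m * φ i m
  have hw := word_lemma (k := k) (I := {i // i ∈ D.P.S}) (n := n) hodd (x := x) (c := c) 
    (a := fun i j => D.P.pr (D.P.r i) (D.P.c j))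
    (by ext i; simp [x, x0]) (by ext i; simp [x, xn])
    (fun j h1 h2 => mul_ne_zero (hc j h1 h2).2.1 (hc j h1 h2).1)
    (fun j h1 h2 i hi => by
      simp only [x]
      rw [((hc j h1 h2).2.2 i i.2 (fun h => hi (Subtype.ext h))).1, mul_zero])
    (fun i => D.P.two i i.2)
    (fun j hj i => by
      have e1 := rec1 i i.2 (j+1) hj
      have e2 := rec1 i i.2 j (by omega)
      have e3 := φw (c (j+1)) j hj (hc (j+1) (by omega) hj).1
      rw [e3, map_add, LinearMap.add_apply] at e2
      simp only [x]
      linear_combination e1 - e2)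
  rcases hw with hdist | hpal
  · left
    intro L hL hef X hX
    refine sl_gen hn.pos G Gs Gi L hL ?_ X hX
    intro m hm
    have hcm := hc (m+1) (by omega) hm
    obtain ⟨he, hf⟩ := hef (c (m+1)) (c (m+1)).2
    constructor
    · have : Matrix.single (G m) (G (m+1)) (1:k) = (ε (c (m+1)) (m+1))⁻¹ • D.e (c (m+1)) := by
        ext j l
        obtain ⟨a, ha, rfl⟩ := Gs j
        obtain ⟨b, hb, rfl⟩ := Gs l
        rw [Matrix.smul_apply, smul_eq_mul]
        by_cases h : D.e (c (m+1)) (G a) (G b) = 0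
        · rw [h, mul_zero, single_apply_of_ne]
          rintro ⟨h1, h2⟩
          rw [← h1, ← h2, hε _ m hm] at h
          exact hcm.2.1 h
        · have h1 := Ge _ (c (m+1)).2 a b ha hb h
          subst h1
          rw [hε _ a hb] at h ⊢
          have h2 := hc (a+1) (by omega) hb
          have h3 : c (m+1) = c (a+1) := by
            by_contra hne
            exact h (h2.2.2 _ (c (m+1)).2 (fun h => hne (Subtype.ext h))).2
          have h4 := hdist _ _ (by omega) hm (by omega) hb h3
          have h5 : m = a := by omega
          subst h5
          rw [inv_mul_cancel₀ h]; simp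
      rw [this]; exact L.smul_mem _ he
    · have : Matrix.single (G (m+1)) (G m) (1:k) = (φ (c (m+1)) (m+1))⁻¹ • D.f (c (m+1)) := by
        ext j l
        obtain ⟨a, ha, rfl⟩ := Gs j
        obtain ⟨b, hb, rfl⟩ := Gs l
        rw [Matrix.smul_apply, smul_eq_mul]
        by_cases h : D.f (c (m+1)) (G a) (G b) = 0
        · rw [h, mul_zero, single_apply_of_ne]
          rintro ⟨h1, h2⟩
          rw [← h1, ← h2, hφ _ m hm] at h
          exact hcm.1 h
        · have h1 := Gf _ (c (m+1)).2 a b ha hb h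
          subst h1
          rw [hφ _ b ha] at h ⊢
          have h2 := hc (b+1) (by omega) ha
          have h3 : c (m+1) = c (b+1) := by
            by_contra hne
            exact h (h2.2.2 _ (c (m+1)).2 (fun h => hne (Subtype.ext h))).1
          have h4 := hdist _ _ (by omega) hm (by omega) ha h3
          have h5 : m = b := by omega
          subst h5
          rw [inv_mul_cancel₀ h]; simp
      rw [this]; exact L.smul_mem _ hf
  · right
    have hcp : ∀ m, 1 ≤ m → m < n → c (n - m) = c m := by
      intro m h1 h2
      by_contra hne
      have h3 := (hc (n-m) (by omega) (by omega)).2.2 (c m) (c m).2 (fun h => hne (Subtype.ext h.symm))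
      have h4 := congrFun (hpal m h2.le) (c m)
      simp only [x, h3.1, mul_zero] at h4
      exact mul_ne_zero (hc m h1 h2).2.1 (hc m h1 h2).1 h4
    let β : ℕ → k := fun m => ∏ j ∈ Finset.range m, (- φ (c (j+1)) (n - (j+1)) / φ (c (j+1)) (j+1))
    have β1 : ∀ m, β (m+1) = β m * (- φ (c (m+1)) (n - (m+1)) / φ (c (m+1)) (m+1)) := fun m => 
      Finset.prod_range_succ _ _
    have φ2 : ∀ m, 1 ≤ m → m < n → φ (c m) (n-m) ≠ 0 := by
      intro m h1 h2
      rw [← hcp m h1 h2]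
      exact (hc (n-m) (by omega) (by omega)).1
    have β0 : ∀ m, m < n → β m ≠ 0 := by
      intro m hm
      refine Finset.prod_ne_zero_iff.2 fun j hj => ?_
      rw [Finset.mem_range] at hj
      exact div_ne_zero (neg_ne_zero.2 (φ2 (j+1) (by omega) (by omega))) (hc (j+1) (by omega) (by omega)).1
    choose idx idn idG using Gs
    have Gid : ∀ a, a < n → idx (G a) = a := fun a ha => Gi _ _ (idn _) ha (idG _)
    let Φ : Matrix J J k := of fun j l => if idx j + idx l + 1 = n then β (idx j) else 0
    have hΦ : ∀ j l, Φ j l = if idx j + idx l + 1 = n then β (idx j) else 0 := fun j l => rfl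
    have hl : ∀ (A : Matrix J J k) j l, (Aᵀ * Φ) j l = A (G (n-1-idx l)) j * β (n-1-idx l) := by
      intro A j l
      have := idn l
      rw [mul_apply, Finset.sum_eq_single (G (n-1-idx l))]
      · rw [transpose_apply, hΦ, Gid _ (by omega), if_pos (by omega)]
      · intro s _ hs
        rw [hΦ, if_neg, mul_zero]
        intro h
        apply hs
        rw [← idG s]
        congr 1
        omega
      · simp
    have hr : ∀ (v : J → k) j, (Φ *ᵥ v) j = β (idx j) * v (G (n-1-idx j)) := by
      intro v j
      have := idn j
      rw [mulVec, dotProduct, Finset.sum_eq_single (G (n-1-idx j))]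
      · rw [hΦ, Gid _ (by omega), if_pos (by omega)]
      · intro s _ hs
        rw [hΦ, if_neg, zero_mul]
        intro h
        apply hs
        rw [← idG s]
        congr 1
        omega
      · simp
    have hr2 : ∀ (A : Matrix J J k) j l, (Φ * A) j l = β (idx j) * A (G (n-1-idx j)) l := by
      intro A j l
      exact hr (fun s => A s l) j
    refine ⟨Φ, ?_, ?_⟩
    · intro hdet
      obtain ⟨v, hv, h⟩ := exists_mulVec_eq_zero_iff.2 hdet
      apply hv
      ext j
      have h1 := congrFun h (G (n-1-idx j))
      have := idn j
      rw [hr, Gid _ (by omega), show n - 1 - (n-1-idx j) = idx j by omega, idG] at h1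
      exact (mul_eq_zero.1 h1).resolve_left (β0 _ (by omega))
    · intro i hi
      constructor
      · ext j l
        rw [Matrix.add_apply, hl, hr2]
        obtain ⟨a, ha, hja⟩ : ∃ a, a < n ∧ G a = j := ⟨idx j, idn j, idG j⟩
        obtain ⟨b, hb, hlb⟩ : ∃ a, a < n ∧ G a = l := ⟨idx l, idn l, idG l⟩
        rw [← hja, ← hlb, Gid a ha, Gid b hb, Matrix.zero_apply]
        by_cases h : a + b = n
        · obtain ⟨m, rfl⟩ : ∃ m, a = m + 1 := ⟨a - 1, by omega⟩
          obtain ⟨m', rfl⟩ : ∃ m, b = m + 1 := ⟨b - 1, by omega⟩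
          rw [show n - 1 - (m'+1) = m by omega, show n - 1 - (m+1) = m' by omega, hε i m ha, hε i m' hb]
          by_cases hic : i = c (m+1)
          · subst hic
            have h4 := congrFun (hpal (m+1) ha.le) (c (m+1))
            have h5 := (hc (m+1) (by omega) ha).1
            rw [show n - (m+1) = m'+1 by omega] at h4
            simp only [x] at h4
            rw [β1, show n - (m+1) = m'+1 by omega]
            field_simp
            linear_combination β m * h4
          · have h3 := (hc (m+1) (by omega) ha).2.2 i hi hic
            rw [← hcp (m+1) (by omega) ha, show n - (m+1) = m'+1 by omega] at hic
            have h4 := (hc (m'+1) (by omega) hb).2.2 i hi hic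
            rw [h3.2, h4.2]; ring
        · have h1 : D.e i (G (n-1-b)) (G a) = 0 := by
            by_contra hne
            have := Ge i hi _ _ (by omega) ha hne
            omega
          have h2 : D.e i (G (n-1-a)) (G b) = 0 := by
            by_contra hne
            have := Ge i hi _ _ (by omega) hb hne
            omega
          rw [h1, h2]; ring
      · ext j l
        rw [Matrix.add_apply, hl, hr2]
        obtain ⟨a, ha, hja⟩ : ∃ a, a < n ∧ G a = j := ⟨idx j, idn j, idG j⟩
        obtain ⟨b, hb, hlb⟩ : ∃ a, a < n ∧ G a = l := ⟨idx l, idn l, idG l⟩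
        rw [← hja, ← hlb, Gid a ha, Gid b hb, Matrix.zero_apply]
        by_cases h : a + b + 2 = n
        · rw [show n - 1 - b = a + 1 by omega, show n - 1 - a = b + 1 by omega, hφ i a (by omega), hφ i b (by omega)]
          by_cases hic : i = c (a+1)
          · subst hic
            have h5 := (hc (a+1) (by omega) (by omega)).1
            rw [β1, show n - (a+1) = b+1 by omega]
            field_simp
            ring
          · have h3 := (hc (a+1) (by omega) (by omega)).2.2 i hi hic
            rw [← hcp (a+1) (by omega) (by omega), show n - (a+1) = b+1 by omega] at hic
            have h4 := (hc (b+1) (by omega) (by omega)).2.2 i hi hic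
            rw [h3.1, h4.1]; ring
        · have h1 : D.f i (G (n-1-b)) (G a) = 0 := by
            by_contra hne
            have := Gf i hi _ _ (by omega) ha hne
            omega
          have h2 : D.f i (G (n-1-a)) (G b) = 0 := by
            by_contra hne
            have := Gf i hi _ _ (by omega) hb hne
            omega
          rw [h1, h2]; ring
end GD
end PieceGab4

section PieceLA1
open Matrix

section LA1
open RootPairing

variable {k M N ι : Type*} [Field k] [CharZero k] [AddCommGroup M] [Module k M] [AddCommGroup N]
    [Module k N] [Finite ι] (P : RootPairing ι k M N) [P.IsCrystallographic] [P.IsReduced]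

theorem isPos_refl_iff (b : P.Base) {i j : ι} (hj : j ∈ b.support) (hij : i ≠ j)
    (hij' : i ≠ P.reflectionPerm j j) : b.IsPos (P.reflectionPerm j i) ↔ b.IsPos i := by
  constructor
  · intro h
    have := h.reflectionPerm hj (by
      rintro h2
      apply hij'
      have h3 := congrArg (P.reflectionPerm j) h2
      simpa using h3)
    simpa using this
  · intro h
    exact h.reflectionPerm hj hij

theorem isPos_flip_iff (b : P.Base) {i : ι} (hi : b.IsPos i) : b.flip.IsPos i := by
  have key : b.IsPos i ↔ b.flip.IsPos i := by
    refine hi.induction_on_reflect (p := fun i => b.IsPos i ↔ b.flip.IsPos i) ?_ ?_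
    · intro i hi
      exact iff_of_true (Base.isPos_of_mem_support hi) (Base.isPos_of_mem_support (b := b.flip) hi)
    · intro i j h hj
      have hneg := Base.IsPos.neg_iff_not b j
      have hneg' := Base.IsPos.neg_iff_not b.flip j
      have p1 := Base.isPos_of_mem_support hj
      have p2 := Base.isPos_of_mem_support (b := b.flip) (i := j) hj
      by_cases h1 : i = j
      · subst h1
        exact iff_of_false (fun h => (hneg.1 h) p1) (fun h => (hneg'.1 h) p2)
      by_cases h2 : i = P.reflectionPerm j j
      · subst h2
        simp only [reflectionPerm_self]
        exact iff_of_true p1 p2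
      rw [isPos_refl_iff P b hj h1 h2, h]
      exact (isPos_refl_iff P.flip b.flip hj h1 h2).symm
  exact key.1 hi

theorem isPos_sum (b : P.Base) {i : ι} (hi : b.IsPos i) :
    ∃ f : ι → ℕ, P.root i = ∑ j ∈ b.support, f j • P.root j := by
  obtain ⟨f, hf, h | h⟩ := b.exists_root_eq_sum_nat_or_neg i
  · exact ⟨f, h⟩
  · exfalso
    have h2 : P.root i = ∑ j ∈ b.support, (-(f j : ℤ)) • P.root j := by
      rw [h, ← Finset.sum_neg_distrib]; simp
    have := Base.height_eq_sum h2
    rw [Base.isPos_iff, this] at hi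
    have : ∑ j ∈ b.support, (-(f j : ℤ)) ≤ 0 := Finset.sum_nonpos (fun j _ => by simp)
    omega

open Classical in
noncomputable def posSigma (b : P.Base) (i : {i // b.IsPos i}) : Equiv.Perm {i // b.IsPos i} :=
  if hi : i.1 ∈ b.support then
    Function.Involutive.toPerm (fun t => if h : t = i then i else
      ⟨P.reflectionPerm i.1 t.1, t.2.reflectionPerm hi (fun h' => h (Subtype.ext h'))⟩) (by
      intro t
      by_cases h : t = i
      · simp [h]
      · simp only [h, dite_false]
        have : (⟨P.reflectionPerm i.1 t.1, t.2.reflectionPerm hi (fun h' => h (Subtype.ext h'))⟩ : {i // b.IsPos i}) ≠ i := by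
          intro h2
          have h3 := congrArg (fun x : {i // b.IsPos i} => P.reflectionPerm i.1 x.1) h2
          simp only [reflectionPerm_self] at h3
          have := (Base.IsPos.neg_iff_not b i.1).1 (by
            have := t.2; rw [h3] at this; exact this)
          exact this i.2
        simp only [this, dite_false, reflectionPerm_self])
  else 1

open Classical in
noncomputable def prsOf [P.IsRootSystem] (b : P.Base) : PRS k M N {i // b.IsPos i} where
  pr := P.toLinearMap
  r t := P.root t.1
  c t := P.coroot t.1
  S := (Set.toFinite {t : {i // b.IsPos i} | t.1 ∈ b.support}).toFinset
  σ := posSigma P b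
  two := by intro i hi; simp
  σ_self := by
    intro i hi
    simp at hi
    simp [posSigma, hi, Function.Involutive.toPerm]
  σr := by
    intro i hi t ht
    simp at hi
    simp [posSigma, hi, Function.Involutive.toPerm, ht, root_reflectionPerm, P.reflection_apply]
  σc := by
    intro i hi t ht
    simp at hi
    simp [posSigma, hi, Function.Involutive.toPerm, ht, coroot_reflectionPerm, P.coreflection_apply]
  rpos := by
    intro t
    obtain ⟨f, hf⟩ := isPos_sum P b t.2
    refine ⟨fun i => f i.1, ?_⟩
    rw [hf]
    symm
    refine Finset.sum_bij (fun i _ => i.1) ?_ ?_ ?_ ?_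
    · intro a ha; simpa using ha
    · intro a _ b _ h; exact Subtype.ext h
    · intro a ha; exact ⟨⟨a, Base.isPos_of_mem_support ha⟩, by simpa using ha, rfl⟩
    · intro a ha; rfl
  cpos := by
    intro t
    obtain ⟨f, hf⟩ := isPos_sum P.flip b.flip (isPos_flip_iff P b t.2)
    refine ⟨fun i => f i.1, ?_⟩
    have hf' : P.coroot t.1 = ∑ j ∈ b.support, f j • P.coroot j := hf
    rw [hf']
    symm
    refine Finset.sum_bij (fun i _ => i.1) ?_ ?_ ?_ ?_
    · intro a ha; simpa using ha
    · intro a _ b _ h; exact Subtype.ext h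
    · intro a ha; exact ⟨⟨a, Base.isPos_of_mem_support ha⟩, by simpa using ha, rfl⟩
    · intro a ha; rfl
  int := by
    intro s t
    exact ⟨P.pairingIn ℤ s.1 t.1, by
      rw [root_coroot_eq_pairing, ← P.algebraMap_pairingIn ℤ]; simp⟩
  spr := by
    intro x hx
    have h : (⊤ : Submodule k N) ≤ LinearMap.ker (P.toLinearMap x) := by
      have h1 : Submodule.span k (P.coroot '' b.support) = ⊤ :=
        b.span_coroot_support.trans IsRootSystem.span_coroot_eq_top
      rw [← h1, Submodule.span_le]
      rintro _ ⟨j, hj, rfl⟩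
      exact hx ⟨j, Base.isPos_of_mem_support hj⟩
    apply (LinearMap.IsPerfPair.bijective_left P.toLinearMap).1
    ext y
    simpa using h (Submodule.mem_top (x := y))
  spc := by
    intro y hy
    have h : (⊤ : Submodule k M) ≤ LinearMap.ker (P.toLinearMap.flip y) := by
      have h1 : Submodule.span k (P.root '' b.support) = ⊤ :=
        b.span_root_support.trans IsRootSystem.span_root_eq_top
      rw [← h1, Submodule.span_le]
      rintro _ ⟨j, hj, rfl⟩
      exact hy ⟨j, Base.isPos_of_mem_support hj⟩
    apply (LinearMap.IsPerfPair.bijective_right P.toLinearMap).1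
    ext x
    simpa using h (Submodule.mem_top (x := x))

end LA1
end PieceLA1

section PieceLA2
open Matrix

section LA2
attribute [local instance] LieRing.ofAssociativeRing
open RootPairing LieAlgebra LieAlgebra.IsKilling LieModule

variable {k L : Type*} [Field k] [CharZero k] [IsAlgClosed k] [LieRing L] [LieAlgebra k L]
  [FiniteDimensional k L] [IsKilling k L] {Hc : LieSubalgebra k L} [Hc.IsCartanSubalgebra]
  (b : (rootSystem Hc).Base)

theorem exists_root_vectors : ∃ e f : {i // b.IsPos i} → L, ∀ t,
    IsSl2Triple ((coroot t.1.1 : Hc) : L) (e t) (f t) ∧ e t ∈ rootSpace Hc t.1.1 ∧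
      f t ∈ rootSpace Hc (-t.1.1) := by
  have : ∀ t : {i // b.IsPos i}, ∃ e f : L, IsSl2Triple ((coroot t.1.1 : Hc) : L) e f ∧
      e ∈ rootSpace Hc t.1.1 ∧ f ∈ rootSpace Hc (-t.1.1) := by
    intro t
    obtain ⟨h, e, f, ht, he, hf⟩ :=
      exists_isSl2Triple_of_weight_isNonZero (LieSubalgebra.isNonZero_coe_root t.1)
    have := ht.h_eq_coroot (LieSubalgebra.isNonZero_coe_root t.1) he hf
    subst this
    exact ⟨e, f, ht, he, hf⟩
  choose e f h using this
  exact ⟨e, f, h⟩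

theorem rootSpace_le_of_ne {α : Weight k Hc L} (hα : α.IsNonZero) {x : L} (hx : x ∈ rootSpace Hc α)
    (h0 : x ≠ 0) {W : Submodule k L} (hW : x ∈ W) : ∀ y ∈ rootSpace Hc α, y ∈ W := by
  intro y hy
  have h1 := finrank_rootSpace_eq_one α hα
  obtain ⟨c, hc⟩ := (finrank_eq_one_iff_of_nonzero' (⟨x, hx⟩ : rootSpace Hc α) (by
    intro h; exact h0 (congrArg Subtype.val h))).1 h1 ⟨y, hy⟩
  have : y = c • x := (congrArg Subtype.val hc).symm
  rw [this]; exact W.smul_mem _ hW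

/-- bracket of root vectors nonzero -/
theorem exists_lie_ne_zero {α β γ : Weight k Hc L} (hα : α.IsNonZero) (hβ : β.IsNonZero)
    (hγ : γ.IsNonZero) (h : (γ : Hc → k) = α + β) {e : L} (he : e ∈ rootSpace Hc β) (he0 : e ≠ 0) :
    ∃ x ∈ rootSpace Hc α, ⁅e, x⁆ ≠ 0 := by
  by_contra hcon
  push Not at hcon
  obtain ⟨h', e', f', ht, he', hf'⟩ := exists_isSl2Triple_of_weight_isNonZero hβ
  have hh := ht.h_eq_coroot hβ he' hf'
  subst hh
  have he'2 : ∀ x ∈ rootSpace Hc α, ⁅e', x⁆ = 0 := by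
    intro x hx
    have := rootSpace_le_of_ne hβ he he0 (W := LinearMap.ker (LieModule.toEnd k L L x))
      (by rw [LinearMap.mem_ker, LieModule.toEnd_apply_apply, ← lie_skew, hcon x hx, neg_zero]) e' he'
    rw [LinearMap.mem_ker, LieModule.toEnd_apply_apply, ← lie_skew, neg_eq_zero] at this
    exact this
  -- α
  obtain ⟨x, hx, hx0⟩ := α.exists_ne_zero
  have P1 : ht.HasPrimitiveVectorWith x (α (coroot β)) := ⟨hx0, by
    exact lie_eq_smul_of_mem_rootSpace hx (coroot β), he'2 x hx⟩
  obtain ⟨m, hm⟩ := P1.exists_nat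
  obtain ⟨z, hz, hz0⟩ := (-γ).exists_ne_zero
  have hz' : ⁅e', z⁆ ∈ rootSpace Hc (-α) := by
    have := lie_mem_genWeightSpace_of_mem_genWeightSpace he' hz
    convert! this using 2
    simp [h]
  have : ⁅e', z⁆ = 0 := by
    by_contra hne
    have h2 := mem_ker_killingForm_of_mem_rootSpace_of_forall_rootSpace_neg k L Hc hz' (by
      intro y hy
      rw [neg_neg] at hy
      have : ⁅e', z⁆ = -⁅z, e'⁆ := (lie_skew _ _).symm
      rw [this, map_neg, LinearMap.neg_apply, LieModule.traceForm_apply_lie_apply, he'2 y hy]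
      simp)
    rw [IsKilling.ker_killingForm_eq_bot] at h2
    exact hne h2
  have P2 : ht.HasPrimitiveVectorWith z ((-γ) (coroot β)) := ⟨hz0, by
    exact lie_eq_smul_of_mem_rootSpace hz (coroot β), this⟩
  obtain ⟨m', hm'⟩ := P2.exists_nat
  have e1 : (-γ) (coroot β) = -(α (coroot β)) - 2 := by
    have : (-γ) (coroot β) = -(γ (coroot β)) := rfl
    rw [this, h, Pi.add_apply, root_apply_coroot hβ]; ring
  rw [hm, hm'] at e1
  have : ((m' + m + 2 : ℕ) : k) = 0 := by push_cast; rw [e1]; ring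
  exact absurd (Nat.cast_eq_zero.1 this) (by omega)

theorem root_pos_or (α : Weight k Hc L) (hα : α.IsNonZero) :
    (∃ t : {i // b.IsPos i}, α = t.1.1) ∨ (∃ t : {i // b.IsPos i}, α = -t.1.1) := by
  have hmem : α ∈ Hc.root := by simpa using hα
  rcases Base.IsPos.or_neg b ⟨α, hmem⟩ with h | h
  · exact Or.inl ⟨⟨_, h⟩, rfl⟩
  · refine Or.inr ⟨⟨_, h⟩, ?_⟩
    have h3 : (rootSystem Hc).root ((rootSystem Hc).reflectionPerm ⟨α, hmem⟩ ⟨α, hmem⟩) = -(rootSystem Hc).root ⟨α, hmem⟩ := by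
      rw [root_reflectionPerm, reflection_apply_self]
    rw [rootSystem_root_apply, rootSystem_root_apply] at h3
    ext x
    have := congrArg (fun g => g x) h3
    simp only [Weight.toLinear_apply, LinearMap.neg_apply] at this
    have h4 : (-(((rootSystem Hc).reflectionPerm ⟨α, hmem⟩ ⟨α, hmem⟩ : Hc.root) : Weight k Hc L)) x = -((((rootSystem Hc).reflectionPerm ⟨α, hmem⟩ ⟨α, hmem⟩ : Hc.root) : Weight k Hc L) x) := rfl
    exact (h4.trans (by rw [this, neg_neg])).symm

theorem eq_top_of_contains {e f : {i // b.IsPos i} → L} (hef : ∀ t,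
    IsSl2Triple ((coroot t.1.1 : Hc) : L) (e t) (f t) ∧ e t ∈ rootSpace Hc t.1.1 ∧
      f t ∈ rootSpace Hc (-t.1.1))
    (W : Submodule k L) (hH : ∀ x ∈ Hc, x ∈ W) (he : ∀ t, e t ∈ W)
    (hf : ∀ t, f t ∈ W) : W = ⊤ := by
  have h := iSup_genWeightSpace_eq_top' k Hc L
  rw [eq_top_iff]
  have h2 : (⊤ : Submodule k L) = ⨆ χ : Weight k Hc L, (rootSpace Hc χ).toSubmodule := by
    rw [← LieSubmodule.iSup_toSubmodule, h]; rfl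
  rw [h2, iSup_le_iff]
  intro α
  by_cases hα : α.IsZero
  · intro x hx
    apply hH
    have : x ∈ rootSpace Hc (0 : Hc → k) := by
      rw [hα.eq] at hx; exact hx
    simpa using this
  · rcases root_pos_or b α hα with ⟨t, rfl⟩ | ⟨t, rfl⟩
    · exact rootSpace_le_of_ne hα (hef t).2.1 (hef t).1.e_ne_zero (he t)
    · exact rootSpace_le_of_ne hα (hef t).2.2 (hef t).1.f_ne_zero (hf t)

end LA2
end PieceLA2

section PieceLA3
open Matrix

section LA3
attribute [local instance] LieRing.ofAssociativeRing
open RootPairing LieAlgebra LieAlgebra.IsKilling LieModule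

variable {k L : Type*} [Field k] [CharZero k] [IsAlgClosed k] [LieRing L] [LieAlgebra k L]
  [FiniteDimensional k L] [IsKilling k L] {Hc : LieSubalgebra k L} [Hc.IsCartanSubalgebra]
  (b : (rootSystem Hc).Base)

theorem rootSpace_le_of_add {α β γ : Weight k Hc L} (hα : α.IsNonZero) (hβ : β.IsNonZero)
    (hγ : γ.IsNonZero) (h : (γ : Hc → k) = α + β) (L' : LieSubalgebra k L)
    (h1 : ∀ x ∈ rootSpace Hc α, x ∈ L') (h2 : ∀ x ∈ rootSpace Hc β, x ∈ L') :
    ∀ x ∈ rootSpace Hc γ, x ∈ L' := by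
  obtain ⟨y, hy, hy0⟩ := β.exists_ne_zero
  obtain ⟨x, hx, hx0⟩ := exists_lie_ne_zero hα hβ hγ h hy hy0
  have h3 : ⁅y, x⁆ ∈ rootSpace Hc γ := by
    have := lie_mem_genWeightSpace_of_mem_genWeightSpace hy hx
    rw [add_comm, ← h] at this
    exact this
  exact rootSpace_le_of_ne hγ h3 hx0 (W := L'.toSubmodule) (L'.lie_mem (h2 _ hy) (h1 _ hx))

theorem lie_gen {e f : {i // b.IsPos i} → L} (hef : ∀ t,
    IsSl2Triple ((coroot t.1.1 : Hc) : L) (e t) (f t) ∧ e t ∈ rootSpace Hc t.1.1 ∧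
      f t ∈ rootSpace Hc (-t.1.1)) (L' : LieSubalgebra k L)
    (h : ∀ t : {i // b.IsPos i}, t.1 ∈ b.support → e t ∈ L' ∧ f t ∈ L') : L'.toSubmodule = ⊤ := by
  have key : ∀ i : Hc.root, b.IsPos i → (∀ x ∈ rootSpace Hc i.1, x ∈ L') ∧
      (∀ x ∈ rootSpace Hc (-i.1 : Weight k Hc L), x ∈ L') := by
    intro i hi
    have simp_case : ∀ i ∈ b.support, (∀ x ∈ rootSpace Hc i.1, x ∈ L') ∧
      (∀ x ∈ rootSpace Hc (-i.1 : Weight k Hc L), x ∈ L') := by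
      intro i hi
      have ht := hef ⟨i, Base.isPos_of_mem_support hi⟩
      have hh := h ⟨i, Base.isPos_of_mem_support hi⟩ hi
      exact ⟨rootSpace_le_of_ne (LieSubalgebra.isNonZero_coe_root i) ht.2.1 ht.1.e_ne_zero
          (W := L'.toSubmodule) hh.1,
        rootSpace_le_of_ne (LieSubalgebra.isNonZero_coe_root i).neg ht.2.2 ht.1.f_ne_zero
          (W := L'.toSubmodule) hh.2⟩
    refine hi.induction_on_add (p := fun i => (∀ x ∈ rootSpace Hc i.1, x ∈ L') ∧
      (∀ x ∈ rootSpace Hc (-i.1 : Weight k Hc L), x ∈ L')) simp_case ?_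
    intro i j l hl hpi hj
    have hpj := simp_case j hj
    have hlw : (l.1 : Hc → k) = i.1 + j.1 := by
      rw [rootSystem_root_apply, rootSystem_root_apply, rootSystem_root_apply] at hl
      ext x
      exact congrArg (fun g => g x) hl
    have ni := LieSubalgebra.isNonZero_coe_root i
    have nj := LieSubalgebra.isNonZero_coe_root j
    have nl := LieSubalgebra.isNonZero_coe_root l
    refine ⟨rootSpace_le_of_add ni nj nl hlw L' hpi.1 hpj.1,
      rootSpace_le_of_add ni.neg nj.neg nl.neg ?_ L' hpi.2 hpj.2⟩
    rw [Weight.coe_neg, Weight.coe_neg, Weight.coe_neg, hlw, neg_add]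
  refine eq_top_of_contains b hef _ ?_ ?_ ?_
  · intro x hx
    have h1 : Submodule.span k ((rootSystem Hc).coroot '' b.support) = ⊤ :=
      b.span_coroot_support.trans IsRootSystem.span_coroot_eq_top
    have h2 : (⊤ : Submodule k Hc) ≤ L'.toSubmodule.comap Hc.toSubmodule.subtype := by
      rw [← h1, Submodule.span_le]
      rintro _ ⟨j, hj, rfl⟩
      have ht := hef ⟨j, Base.isPos_of_mem_support hj⟩
      have hh := h ⟨j, Base.isPos_of_mem_support hj⟩ hj
      have := L'.lie_mem hh.1 hh.2
      rw [ht.1.lie_e_f] at this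
      exact this
    exact h2 (Submodule.mem_top (x := ⟨x, hx⟩))
  · intro t; exact (key t.1 t.2).1 _ (hef t).2.1
  · intro t; exact (key t.1 t.2).2 _ (hef t).2.2

/-- rational normalisation -/
theorem exists_q (α : Weight k Hc L) (hα : α.IsNonZero) :
    ∃ q : ℚ, 0 < q ∧ α ((cartanEquivDual Hc).symm α) = 2 * (q : k) := by
  set a := α ((cartanEquivDual Hc).symm α) with ha
  have ha0 : a ≠ 0 := root_apply_cartanEquivDual_symm_ne_zero hα
  have h1 := traceForm_coroot α (coroot α)
  rw [root_apply_coroot hα, ← restrict_killingForm, restrict_killingForm_eq_sum] at h1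
  have hz : ∀ β : Weight k Hc L, ∃ z : ℤ, β (coroot α) = z := fun β =>
    ⟨_, apply_coroot_eq_cast α β⟩
  choose z hz using hz
  have hmem : α ∈ Hc.root := by simpa using hα
  have h2 : ((∑ β ∈ Hc.root, (z β)^2 : ℤ) : k) = 4 * a⁻¹ := by
    have : (2 • a⁻¹ • (2:k)) = 4 * a⁻¹ := by simp [smul_eq_mul]; ring
    rw [← this, ← h1]
    rw [LinearMap.sum_apply, LinearMap.sum_apply]
    push_cast
    refine Finset.sum_congr rfl fun β _ => ?_
    simp [hz, pow_two]
  have hzα : z α = 2 := by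
    have := hz α
    rw [root_apply_coroot hα] at this
    exact_mod_cast this.symm
  have hpos : 0 < ∑ β ∈ Hc.root, (z β)^2 := by
    refine Finset.sum_pos' (fun β _ => sq_nonneg _) ⟨α, hmem, by rw [hzα]; norm_num⟩
  set s := ∑ β ∈ Hc.root, (z β)^2
  refine ⟨2 / (s : ℚ), by positivity, ?_⟩
  have hs0 : (s : k) ≠ 0 := by exact_mod_cast hpos.ne'
  push_cast
  field_simp at h2 ⊢
  linear_combination h2

theorem killing_ef {α : Weight k Hc L} (hα : α.IsNonZero) {e f : L}
    (ht : IsSl2Triple ((coroot α : Hc) : L) e f) (he : e ∈ rootSpace Hc α) (hf : f ∈ rootSpace Hc (-α))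
    {q : ℚ} (hq : 0 < q) (h : α ((cartanEquivDual Hc).symm α) = 2 * (q : k)) :
    (q : k) * killingForm k L e f = 1 := by
  have h1 := lie_eq_killingForm_smul_of_mem_rootSpace_of_mem_rootSpace_neg he hf
  rw [ht.lie_e_f] at h1
  have h2 : coroot α = killingForm k L e f • (cartanEquivDual Hc).symm α := Subtype.ext h1
  have h3 : α (coroot α) = α (killingForm k L e f • (cartanEquivDual Hc).symm α) := by rw [← h2]
  rw [root_apply_coroot hα, ← Weight.toLinear_apply (R := k), map_smul, Weight.toLinear_apply, h, smul_eq_mul] at h3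
  have : (2:k) ≠ 0 := two_ne_zero
  have h4 : (2:k) * ((q : k) * killingForm k L e f) = 2 * 1 := by rw [mul_one, ← mul_assoc, mul_comm, ← h3]
  exact mul_left_cancel₀ this h4

end LA3
end PieceLA3

section PieceLA4
open Matrix

section LA4
attribute [local instance] LieRing.ofAssociativeRing
open RootPairing LieAlgebra LieAlgebra.IsKilling LieModule

variable {k L V : Type*} [Field k] [CharZero k] [IsAlgClosed k] [LieRing L] [LieAlgebra k L]
  [FiniteDimensional k L] [IsKilling k L] {Hc : LieSubalgebra k L} [Hc.IsCartanSubalgebra]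
  (b : (rootSystem Hc).Base)
  [AddCommGroup V] [Module k V] [LieRingModule L V] [LieModule k L V]

theorem casimir_comm {I : Type*} [Fintype I] (u w : I → L)
    (h : ∀ x, x = ∑ i, killingForm k L x (w i) • u i) (x : L) (v : V) :
    ⁅x, ∑ i, ⁅u i, ⁅w i, v⁆⁆⁆ = ∑ i, ⁅u i, ⁅w i, ⁅x, v⁆⁆⁆ := by
  have h' : ∀ y, y = ∑ i, killingForm k L y (u i) • w i := by
    intro y
    have h1 : y - ∑ i, killingForm k L y (u i) • w i ∈ LinearMap.ker (killingForm k L) := by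
      rw [LinearMap.mem_ker]
      ext z
      rw [map_sub, LinearMap.sub_apply, LinearMap.zero_apply, sub_eq_zero]
      rw [map_sum, LinearMap.sum_apply]
      conv_lhs => rw [h z]
      rw [map_sum]
      refine Finset.sum_congr rfl fun i _ => ?_
      rw [map_smul, map_smul, LinearMap.smul_apply, smul_eq_mul, smul_eq_mul, mul_comm,
        LieModule.traceForm_comm k L L z]
    rw [IsKilling.ker_killingForm_eq_bot] at h1
    exact sub_eq_zero.1 h1
  have e1 : ∀ i, ⁅x, ⁅u i, ⁅w i, v⁆⁆⁆ - ⁅u i, ⁅w i, ⁅x, v⁆⁆⁆ = ⁅⁅x, u i⁆, ⁅w i, v⁆⁆ + ⁅u i, ⁅⁅x, w i⁆, v⁆⁆ := by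
    intro i
    rw [leibniz_lie x (u i), leibniz_lie x (w i) v, lie_add]; abel
  rw [lie_sum, ← sub_eq_zero, ← Finset.sum_sub_distrib, Finset.sum_congr rfl (fun i _ => e1 i),
    Finset.sum_add_distrib]
  have e2 : ∀ i, ⁅⁅x, u i⁆, ⁅w i, v⁆⁆ = ∑ j, killingForm k L ⁅x, u i⁆ (w j) • ⁅u j, ⁅w i, v⁆⁆ := by
    intro i
    conv_lhs => rw [h ⁅x, u i⁆]
    rw [sum_lie]; simp
  have e3 : ∀ i, ⁅u i, ⁅⁅x, w i⁆, v⁆⁆ = ∑ j, killingForm k L ⁅x, w i⁆ (u j) • ⁅u i, ⁅w j, v⁆⁆ := by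
    intro i
    conv_lhs => rw [h' ⁅x, w i⁆]
    rw [sum_lie, lie_sum]; simp
  rw [Finset.sum_congr rfl (fun i _ => e2 i), Finset.sum_congr rfl (fun i _ => e3 i), Finset.sum_comm,
    ← Finset.sum_add_distrib]
  refine Finset.sum_eq_zero fun j _ => ?_
  rw [← Finset.sum_add_distrib]
  refine Finset.sum_eq_zero fun i _ => ?_
  rw [← add_smul]
  have : killingForm k L ⁅x, u i⁆ (w j) + killingForm k L ⁅x, w j⁆ (u i) = 0 := by
    rw [← lie_skew, map_neg, LinearMap.neg_apply, LieModule.traceForm_apply_lie_apply, LieModule.traceForm_comm k L L (u i)]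
    ring
  rw [this, zero_smul]

theorem resolution {e f : {i // b.IsPos i} → L} (hef : ∀ t,
    IsSl2Triple ((coroot t.1.1 : Hc) : L) (e t) (f t) ∧ e t ∈ rootSpace Hc t.1.1 ∧
      f t ∈ rootSpace Hc (-t.1.1)) (q : {i // b.IsPos i} → ℚ) (q0 : ∀ t, 0 < q t)
    (hq : ∀ t : {i // b.IsPos i}, t.1.1 ((cartanEquivDual Hc).symm t.1.1) = 2 * (q t : k))
    {r : Type*} [Fintype r] (hb : Module.Basis r k Hc) [Fintype {i // b.IsPos i}] (x : L) :
    x = (∑ i, killingForm k L x ((cartanEquivDual Hc).symm (hb.coord i) : Hc) • (hb i : L)) +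
      ∑ t, (q t : k) • (killingForm k L x (f t) • e t + killingForm k L x (e t) • f t) := by
  classical
  set T : L →ₗ[k] L := 
    (∑ i, ((killingForm k L).flip ((cartanEquivDual Hc).symm (hb.coord i) : Hc)).smulRight (hb i : L)) +
      ∑ t, (q t : k) • (((killingForm k L).flip (f t)).smulRight (e t) + ((killingForm k L).flip (e t)).smulRight (f t)) with hT
  have hTx : ∀ x, T x = (∑ i, killingForm k L x ((cartanEquivDual Hc).symm (hb.coord i) : Hc) • (hb i : L)) +
      ∑ t, (q t : k) • (killingForm k L x (f t) • e t + killingForm k L x (e t) • f t) := by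
    intro x; simp [hT]
  rw [← hTx]
  have orth := fun {α β : Hc → k} {x y : L} hx hy hab => 
    killingForm_apply_eq_zero_of_mem_rootSpace_of_add_ne_zero k L Hc (α := α) (β := β) (x := x) (y := y) hx hy hab
  have hHroot : ∀ x : Hc, (x : L) ∈ rootSpace Hc (0 : Hc → k) := by
    intro x; simp
  have nz : ∀ t : {i // b.IsPos i}, (t.1.1 : Hc → k) ≠ 0 := fun t => LieSubalgebra.isNonZero_coe_root t.1
  have inj1 : ∀ s t : {i // b.IsPos i}, (s.1.1 : Hc → k) = t.1.1 → s = t := by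
    intro s t h; apply Subtype.ext; apply Subtype.ext; exact DFunLike.coe_injective h
  have inj2 : ∀ s t : {i // b.IsPos i}, (s.1.1 : Hc → k) + t.1.1 ≠ 0 := by
    intro s t h
    have h1 : s.1.1 = -t.1.1 := by
      apply DFunLike.coe_injective; rw [Weight.coe_neg]; exact eq_neg_of_add_eq_zero_left h
    have h2 : (rootSystem Hc).root s.1 = - (rootSystem Hc).root t.1 := by
      rw [rootSystem_root_apply, rootSystem_root_apply, h1]; rfl
    have h3 : s.1 = (rootSystem Hc).reflectionPerm t.1 t.1 := by
      apply (rootSystem Hc).root.injective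
      rw [h2, root_reflectionPerm, reflection_apply_self]
    have := (Base.IsPos.neg_iff_not b t.1).1 (by have := s.2; rw [h3] at this; exact this)
    exact this t.2
  have main : LinearMap.eqLocus (LinearMap.id : L →ₗ[k] L) T = ⊤ := by
    refine eq_top_of_contains b hef _ ?_ ?_ ?_
    · intro x hx
      rw [LinearMap.mem_eqLocus, LinearMap.id_apply, hTx]
      rw [Finset.sum_eq_zero (f := fun t => (q t : k) • (killingForm k L x (f t) • e t + killingForm k L x (e t) • f t)) (fun t _ => by
        rw [orth (hHroot ⟨x, hx⟩) (hef t).2.1 (by simpa using nz t), orth (hHroot ⟨x, hx⟩) (hef t).2.2 (by simpa using nz t)]; simp), add_zero]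
      have h1 := hb.sum_repr ⟨x, hx⟩
      have h2 := congrArg Subtype.val h1
      conv_lhs => rw [show x = ((⟨x, hx⟩ : Hc) : L) from rfl, ← h1]
      rw [show (((∑ i, hb.repr ⟨x, hx⟩ i • hb i : Hc)) : L) = ∑ i, hb.repr ⟨x, hx⟩ i • (hb i : L) by
        rw [AddSubmonoidClass.coe_finset_sum]; rfl]
      refine Finset.sum_congr rfl fun i _ => ?_
      congr 1
      have h3 : cartanEquivDual Hc ((cartanEquivDual Hc).symm (hb.coord i)) ⟨x, hx⟩ = hb.coord i ⟨x, hx⟩ := by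
        rw [LinearEquiv.apply_symm_apply]
      rw [LieModule.traceForm_comm]
      exact h3.symm
    · intro s
      rw [LinearMap.mem_eqLocus, LinearMap.id_apply, hTx]
      rw [Finset.sum_eq_zero (fun i _ => by
        rw [orth (hef s).2.1 (hHroot _) (by simpa using nz s), zero_smul]), zero_add]
      rw [Finset.sum_eq_single s]
      · rw [orth (hef s).2.1 (hef s).2.1 (inj2 s s), zero_smul, add_zero, smul_smul,
          killing_ef (LieSubalgebra.isNonZero_coe_root s.1) (hef s).1 (hef s).2.1 (hef s).2.2 (q0 s) (hq s), one_smul]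
      · intro t _ hts
        rw [orth (hef s).2.1 (hef t).2.1 (inj2 s t), orth (hef s).2.1 (hef t).2.2 (fun h => hts (inj1 _ _ (by rw [add_neg_eq_zero] at h; exact h.symm)))]
        simp
      · simp
    · intro s
      rw [LinearMap.mem_eqLocus, LinearMap.id_apply, hTx]
      rw [Finset.sum_eq_zero (fun i _ => by
        rw [orth (hef s).2.2 (hHroot _) (by simpa using nz s), zero_smul]), zero_add]
      rw [Finset.sum_eq_single s]
      · rw [orth (hef s).2.2 (hef s).2.2 (fun h => inj2 s s (by rw [← neg_add, neg_eq_zero] at h; exact h)), zero_smul, zero_add, smul_smul,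
          LieModule.traceForm_comm, killing_ef (LieSubalgebra.isNonZero_coe_root s.1) (hef s).1 (hef s).2.1 (hef s).2.2 (q0 s) (hq s), one_smul]
      · intro t _ hts
        rw [orth (hef s).2.2 (hef t).2.2 (fun h => inj2 s t (by rw [← neg_add, neg_eq_zero] at h; exact h)), orth (hef s).2.2 (hef t).2.1 (fun h => hts (inj1 _ _ (by rw [neg_add_eq_zero] at h; exact h.symm)))]
        simp
      · simp
  have : x ∈ LinearMap.eqLocus (LinearMap.id : L →ₗ[k] L) T := by rw [main]; trivial
  exact this

end LA4
end PieceLA4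

section PieceLA5
open Matrix

section LA5
attribute [local instance] LieRing.ofAssociativeRing
open RootPairing LieAlgebra LieAlgebra.IsKilling LieModule

variable {k L V : Type*} [Field k] [CharZero k] [IsAlgClosed k] [LieRing L] [LieAlgebra k L]
  [FiniteDimensional k L] [IsKilling k L] {Hc : LieSubalgebra k L} [Hc.IsCartanSubalgebra]
  (b : (rootSystem Hc).Base)
  [AddCommGroup V] [Module k V] [LieRingModule L V] [LieModule k L V] [FiniteDimensional k V]

theorem root_act {α : Hc → k} {x : L} (hx : x ∈ rootSpace Hc α) (h : Hc) (v : V) (lam : k)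
    (hv : ⁅(h : L), v⁆ = lam • v) : ⁅(h : L), ⁅x, v⁆⁆ = (lam + α h) • ⁅x, v⁆ := by
  have h1 : ⁅(h : L), x⁆ = α h • x := lie_eq_smul_of_mem_rootSpace hx h
  rw [leibniz_lie, h1, hv, smul_lie, lie_smul, add_smul, add_comm]

theorem exists_weight_basis [Nontrivial V]
    (hirr : ∀ W : Submodule k V, (∀ x : L, ∀ w ∈ W, ⁅x, w⁆ ∈ W) → W = ⊥ ∨ W = ⊤) :
    ∃ (J : Type) (_ : Fintype J) (bs : Module.Basis J k V) (wt : J → Module.Dual k Hc),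
      ∀ (h : Hc) j, ⁅(h : L), bs j⁆ = wt j h • bs j := by
  classical
  set s : Set V := {v | ∃ lam : Module.Dual k Hc, ∀ h : Hc, ⁅(h : L), v⁆ = lam h • v} with hs
  obtain ⟨b⟩ : Nonempty (rootSystem Hc).Base := RootPairing.nonempty_base _
  obtain ⟨e, f, hef⟩ := exists_root_vectors b
  have hspan : Submodule.span k s = ⊤ := by
    refine (hirr (Submodule.span k s) ?_).resolve_left ?_
    · have key : ∀ (α : Module.Dual k Hc) (x : L), x ∈ rootSpace Hc (α : Hc → k) → ∀ w ∈ Submodule.span k s, ⁅x, w⁆ ∈ Submodule.span k s := by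
        intro α x hx w hw
        refine Submodule.span_induction (p := fun w _ => ⁅x, w⁆ ∈ Submodule.span k s) ?_ ?_ ?_ ?_ hw
        · rintro v ⟨lam, hlam⟩
          refine Submodule.subset_span ⟨lam + α, fun h => ?_⟩
          rw [root_act hx h v _ (hlam h)]; rfl
        · simp
        · intro u v _ _ hu hv; rw [lie_add]; exact add_mem hu hv
        · intro c v _ hv; rw [lie_smul]; exact Submodule.smul_mem _ _ hv
      set S : Submodule k L := 
        { carrier := {x | ∀ w ∈ Submodule.span k s, ⁅x, w⁆ ∈ Submodule.span k s}
          add_mem' := by intro x y hx hy w hw; rw [add_lie]; exact add_mem (hx w hw) (hy w hw)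
          zero_mem' := by intro w hw; simp
          smul_mem' := by intro c x hx w hw; rw [smul_lie]; exact Submodule.smul_mem _ _ (hx w hw) } with hS
      have : S = ⊤ := by
        refine eq_top_of_contains b hef S ?_ ?_ ?_
        · intro x hx
          refine key 0 x ?_
          have : x ∈ rootSpace Hc (0 : Hc → k) := by simpa using hx
          exact this
        · intro t
          exact key t.1.1.toLinear _ (hef t).2.1
        · intro t
          exact key (-t.1.1.toLinear) _ (hef t).2.2
      intro x w hw
      have hx : x ∈ S := by rw [this]; trivial
      exact hx w hw
    · obtain ⟨χ, hχ⟩ := LieModule.exists_nontrivial_weightSpace_of_isSolvable k Hc V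
      obtain ⟨⟨v, hv⟩, hv0⟩ := exists_ne (0 : weightSpace V χ)
      intro hbot
      have hv1 : v ∈ Submodule.span k s := Submodule.subset_span ⟨χ, fun h => by
        exact (mem_weightSpace _ v).1 hv h⟩
      rw [hbot, Submodule.mem_bot] at hv1
      exact hv0 (Subtype.ext hv1)
  let B := Module.Basis.ofSpan (K := k) hspan.ge
  have hmem : ∀ j, B j ∈ s := Module.Basis.ofSpan_subset hspan.ge |> fun h j => h ⟨j, rfl⟩
  have fin := Module.Finite.finite_basis B
  have := Fintype.ofFinite (↑(LinearIndepOn.extend (linearIndepOn_empty k id) (Set.empty_subset s)))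
  let eq := Fintype.equivFin (↑(LinearIndepOn.extend (linearIndepOn_empty k id) (Set.empty_subset s)))
  choose lam hlam using hmem
  refine ⟨_, inferInstance, B.reindex eq, fun j => lam (eq.symm j), fun h j => ?_⟩
  simpa using hlam (eq.symm j) h

end LA5
end PieceLA5

section PieceLA6
open Matrix

section LA6
attribute [local instance] LieRing.ofAssociativeRing
open RootPairing LieAlgebra LieAlgebra.IsKilling LieModule

variable {k L V : Type*} [Field k] [CharZero k] [IsAlgClosed k] [LieRing L] [LieAlgebra k L]
  [FiniteDimensional k L] [IsKilling k L] {Hc : LieSubalgebra k L} [Hc.IsCartanSubalgebra]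
  (b : (rootSystem Hc).Base)
  [AddCommGroup V] [Module k V] [LieRingModule L V] [LieModule k L V] [FiniteDimensional k V]

noncomputable def repMat {J : Type*} [Fintype J] [DecidableEq J] (bs : Module.Basis J k V) : L →ₗ[k] Matrix J J k :=
  (LinearMap.toMatrix bs bs).toLinearMap ∘ₗ (LieModule.toEnd k L V : L →ₗ[k] Module.End k V)

theorem repMat_lie {J : Type*} [Fintype J] [DecidableEq J] (bs : Module.Basis J k V) (x y : L) :
    repMat bs ⁅x, y⁆ = repMat bs x * repMat bs y - repMat bs y * repMat bs x := by
  simp only [repMat, LinearMap.comp_apply]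
  have : (LieModule.toEnd k L V : L →ₗ[k] Module.End k V) ⁅x, y⁆ =
    (LieModule.toEnd k L V x) ∘ₗ (LieModule.toEnd k L V y) - (LieModule.toEnd k L V y) ∘ₗ (LieModule.toEnd k L V x) := by
    ext v; simp
  rw [this, map_sub]
  simp only [LinearEquiv.coe_coe]
  rw [LinearMap.toMatrix_comp bs bs bs, LinearMap.toMatrix_comp bs bs bs]; rfl

theorem repMat_apply {J : Type*} [Fintype J] [DecidableEq J] (bs : Module.Basis J k V) (x : L) (i j : J) :
    repMat bs x i j = bs.repr ⁅x, bs j⁆ i := by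
  simp [repMat, LinearMap.toMatrix_apply]

theorem repMat_mulVec {J : Type*} [Fintype J] [DecidableEq J] (bs : Module.Basis J k V) (x : L) (v : V) :
    repMat bs x *ᵥ (bs.equivFun v) = bs.equivFun ⁅x, v⁆ := by
  have := LinearMap.toMatrix_mulVec_repr bs bs (LieModule.toEnd k L V x) v
  simpa [repMat] using! this

theorem repMat_entry {J : Type*} [Fintype J] [DecidableEq J] (bs : Module.Basis J k V) 
    (wt : J → Module.Dual k Hc) (hwt : ∀ (h : Hc) j, ⁅(h : L), bs j⁆ = wt j h • bs j)
    (α : Module.Dual k Hc) {x : L} (hx : x ∈ rootSpace Hc (α : Hc → k)) (i j : J)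
    (h : repMat bs x i j ≠ 0) : wt i = wt j + α := by
  ext t
  have h1 := root_act hx t (bs j) _ (hwt t j)
  have h2 : ∀ v : V, bs.repr ⁅(t : L), v⁆ i = wt i t * bs.repr v i := by
    intro v
    conv_lhs => rw [← bs.sum_repr v]
    rw [lie_sum, map_sum, Finsupp.finset_sum_apply]
    rw [Finset.sum_eq_single i]
    · rw [lie_smul, hwt, map_smul, map_smul]; simp; ring
    · intro l _ hl
      rw [lie_smul, hwt, map_smul, map_smul]; simp [Finsupp.single_eq_of_ne hl.symm]
    · simp
  have h3 := congrArg (fun v => bs.repr v i) h1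
  simp only [h2, map_smul] at h3
  rw [repMat_apply] at h
  simp only [Finsupp.smul_apply, smul_eq_mul] at h3
  exact mul_right_cancel₀ h h3

theorem repMat_cartan {J : Type*} [Fintype J] [DecidableEq J] (bs : Module.Basis J k V) 
    (wt : J → Module.Dual k Hc) (hwt : ∀ (h : Hc) j, ⁅(h : L), bs j⁆ = wt j h • bs j) (h : Hc) :
    repMat bs (h : L) = diagonal (fun j => wt j h) := by
  ext i j
  rw [repMat_apply, hwt, map_smul]
  by_cases hij : i = j
  · subst hij; simp
  · simp [hij, Finsupp.single_eq_of_ne hij]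

theorem casimir_scalar {J : Type*} [Fintype J] [DecidableEq J] (bs : Module.Basis J k V) [Nontrivial V]
    (hirr : ∀ W : Submodule k V, (∀ x : L, ∀ w ∈ W, ⁅x, w⁆ ∈ W) → W = ⊥ ∨ W = ⊤)
    {I : Type*} [Fintype I] (u w : I → L)
    (h : ∀ x, x = ∑ i, killingForm k L x (w i) • u i) :
    ∃ c : k, ∀ j, ∑ i, (repMat bs (u i) * repMat bs (w i)) j j = c := by
  set C : Module.End k V := ∑ i, (LieModule.toEnd k L V (u i)) ∘ₗ (LieModule.toEnd k L V (w i)) with hC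
  have hCv : ∀ v, C v = ∑ i, ⁅u i, ⁅w i, v⁆⁆ := by intro v; simp [hC]
  obtain ⟨c, hc⟩ := Module.End.exists_eigenvalue C
  have htop : C.eigenspace c = ⊤ := by
    refine (hirr (C.eigenspace c) ?_).resolve_left hc
    intro x v hv
    rw [Module.End.mem_eigenspace_iff] at hv ⊢
    rw [hCv, ← casimir_comm u w h, ← hCv, hv, lie_smul]
  refine ⟨c, fun j => ?_⟩
  have h1 : C (bs j) = c • bs j := by
    rw [← Module.End.mem_eigenspace_iff, htop]; trivial
  have h2 := congrArg (fun v => bs.repr v j) h1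
  simp only [map_smul, Finsupp.smul_apply, Module.Basis.repr_self, Finsupp.single_eq_same, smul_eq_mul, mul_one] at h2
  rw [← h2, hCv, map_sum, Finsupp.finset_sum_apply]
  refine Finset.sum_congr rfl fun i _ => ?_
  have h3 : bs.repr ⁅u i, ⁅w i, bs j⁆⁆ j = bs.equivFun ⁅u i, ⁅w i, bs j⁆⁆ j := rfl
  rw [h3, ← repMat_mulVec, ← repMat_mulVec, Matrix.mulVec_mulVec]
  have h4 : bs.equivFun (bs j) = Pi.single j 1 := by
    ext l; simp [Pi.single_apply, Finsupp.single_apply, eq_comm]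
  rw [h4, Matrix.mulVec_single_one]; rfl

end LA6
end PieceLA6

section PieceLA7
open Matrix

section LA7
attribute [local instance] LieRing.ofAssociativeRing
open RootPairing LieAlgebra LieAlgebra.IsKilling LieModule

variable {k L V : Type*} [Field k] [CharZero k] [IsAlgClosed k] [LieRing L] [LieAlgebra k L]
  [FiniteDimensional k L] [IsKilling k L] {Hc : LieSubalgebra k L} [Hc.IsCartanSubalgebra]
  (b : (rootSystem Hc).Base)
  [AddCommGroup V] [Module k V] [LieRingModule L V] [LieModule k L V] [FiniteDimensional k V]

theorem cartan_symm (x y : Module.Dual k Hc) :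
    x ((cartanEquivDual Hc).symm y) = y ((cartanEquivDual Hc).symm x) := by
  have a1 : ∀ x y : Module.Dual k Hc, x ((cartanEquivDual Hc).symm y) =
      traceForm k Hc L ((cartanEquivDual Hc).symm x) ((cartanEquivDual Hc).symm y) := by
    intro x y
    conv_lhs => rw [← (cartanEquivDual Hc).apply_symm_apply x]
    rfl
  exact (a1 x y).trans ((traceForm_comm k Hc L _ _).trans (a1 y x).symm)

theorem cas_lemma {J : Type*} [Fintype J] [DecidableEq J] (bs : Module.Basis J k V) [Nontrivial V]
    (hirr : ∀ W : Submodule k V, (∀ x : L, ∀ w ∈ W, ⁅x, w⁆ ∈ W) → W = ⊥ ∨ W = ⊤)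
    (wt : J → Module.Dual k Hc) (hwt : ∀ (h : Hc) j, ⁅(h : L), bs j⁆ = wt j h • bs j)
    {e f : {i // b.IsPos i} → L} (hef : ∀ t,
    IsSl2Triple ((coroot t.1.1 : Hc) : L) (e t) (f t) ∧ e t ∈ rootSpace Hc t.1.1 ∧
      f t ∈ rootSpace Hc (-t.1.1)) (q : {i // b.IsPos i} → ℚ) (q0 : ∀ t, 0 < q t)
    (hq : ∀ t : {i // b.IsPos i}, t.1.1 ((cartanEquivDual Hc).symm t.1.1) = 2 * (q t : k))
    [Fintype {i // b.IsPos i}] :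
    ∃ c : k, ∀ j, wt j ((cartanEquivDual Hc).symm (wt j)) + ∑ t, (q t : k) * ((repMat bs (e t) * repMat bs (f t)) j j 
      + (repMat bs (f t) * repMat bs (e t)) j j) = c := by
  let hb := Module.finBasis k Hc
  let I := (Fin (Module.finrank k Hc)) ⊕ ({i // b.IsPos i} ⊕ {i // b.IsPos i})
  let u : I → L := Sum.elim (fun i => (hb i : L)) (Sum.elim (fun t => (q t : k) • e t) (fun t => (q t : k) • f t))
  let w : I → L := Sum.elim (fun i => ((cartanEquivDual Hc).symm (hb.coord i) : Hc)) (Sum.elim f e)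
  have h : ∀ x, x = ∑ i, killingForm k L x (w i) • u i := by
    intro x
    conv_lhs => rw [resolution b hef q q0 hq hb x]
    rw [Fintype.sum_sum_type, Fintype.sum_sum_type]
    simp only [u, w, Sum.elim_inl, Sum.elim_inr]
    congr 1
    rw [← Finset.sum_add_distrib]
    refine Finset.sum_congr rfl fun t _ => ?_
    rw [smul_add, smul_comm, smul_comm (q t : k)]
  obtain ⟨c, hc⟩ := casimir_scalar bs hirr u w h
  refine ⟨c, fun j => ?_⟩
  rw [← hc j, Fintype.sum_sum_type, Fintype.sum_sum_type]
  simp only [u, w, Sum.elim_inl, Sum.elim_inr]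
  congr 1
  · have h1 : ∀ i, (repMat bs (hb i : L) * repMat bs (((cartanEquivDual Hc).symm (hb.coord i) : Hc) : L)) j j =
        hb.coord i ((cartanEquivDual Hc).symm (wt j)) * wt j (hb i) := by
      intro i
      rw [repMat_cartan bs wt hwt, repMat_cartan bs wt hwt, Matrix.diagonal_mul_diagonal, Matrix.diagonal_apply_eq, mul_comm]
      congr 1
      exact cartan_symm _ _
    simp only [h1]
    conv_lhs => rw [← hb.sum_repr ((cartanEquivDual Hc).symm (wt j)), map_sum]
    simp
  · rw [← Finset.sum_add_distrib]
    refine Finset.sum_congr rfl fun t _ => ?_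
    simp [mul_add]


end LA7
end PieceLA7

section PieceLA8
open Matrix

section LA8
attribute [local instance] LieRing.ofAssociativeRing
open RootPairing LieAlgebra LieAlgebra.IsKilling LieModule

variable {k L V : Type*} [Field k] [CharZero k] [IsAlgClosed k] [LieRing L] [LieAlgebra k L]
  [FiniteDimensional k L] [IsKilling k L] {Hc : LieSubalgebra k L} [Hc.IsCartanSubalgebra]
  (b : (rootSystem Hc).Base)
  [AddCommGroup V] [Module k V] [LieRingModule L V] [LieModule k L V] [FiniteDimensional k V]

theorem simple_comm {e f : {i // b.IsPos i} → L} (hef : ∀ t,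
    IsSl2Triple ((coroot t.1.1 : Hc) : L) (e t) (f t) ∧ e t ∈ rootSpace Hc t.1.1 ∧
      f t ∈ rootSpace Hc (-t.1.1)) (s t : {i // b.IsPos i}) (hs : s.1 ∈ b.support) (ht : t.1 ∈ b.support)
    (hst : s ≠ t) : ⁅e s, f t⁆ = 0 := by
  have h1 := lie_mem_genWeightSpace_of_mem_genWeightSpace (hef s).2.1 (hef t).2.2
  by_contra h0
  have hne : genWeightSpace L ((s.1.1 : Hc → k) + (-t.1.1 : Hc → k)) ≠ ⊥ := by
    intro h
    rw [h] at h1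
    exact h0 (by simpa using h1)
  let w : Weight k Hc L := ⟨_, hne⟩
  have hw : (w : Hc → k) = (s.1.1 : Hc → k) + (-t.1.1 : Hc → k) := rfl
  have hwnz : w.IsNonZero := by
    intro hz
    apply hst
    have : (s.1.1 : Hc → k) = (t.1.1 : Hc → k) := by
      have h2 : (w : Hc → k) = 0 := hz
      rw [hw, ← sub_eq_add_neg, sub_eq_zero] at h2
      exact h2
    exact Subtype.ext (Subtype.ext (DFunLike.coe_injective this))
  have hwr : w ∈ Hc.root := by simpa using hwnz
  refine b.sub_notMem_range_root hs ht ⟨⟨w, hwr⟩, ?_⟩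
  ext x
  have := congrFun hw x
  simpa [sub_eq_add_neg] using this

theorem symm_root_eq {α : Weight k Hc L} (hα : α.IsNonZero) {q : ℚ} (hq0 : 0 < q)
    (hq : α ((cartanEquivDual Hc).symm α) = 2 * (q : k)) (x : Module.Dual k Hc) :
    x ((cartanEquivDual Hc).symm α) = (q : k) * x (coroot α) := by
  have hqk : (q : k) ≠ 0 := by exact_mod_cast hq0.ne'
  have : (cartanEquivDual Hc).symm α = (q : k) • coroot α := by
    rw [IsKilling.coroot, hq]
    rw [← Nat.cast_smul_eq_nsmul k, smul_smul, smul_smul]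
    have h1 : (q : k) * (((2 : ℕ) : k) * (2 * (q : k))⁻¹) = 1 := by
      push_cast; field_simp
    rw [mul_assoc]
    rw [h1, one_smul]
  rw [this, map_smul, smul_eq_mul]

theorem rep_irr {J : Type*} [Fintype J] [DecidableEq J] (bs : Module.Basis J k V)
    (hirr : ∀ W : Submodule k V, (∀ x : L, ∀ w ∈ W, ⁅x, w⁆ ∈ W) → W = ⊥ ∨ W = ⊤)
    {e f : {i // b.IsPos i} → L} (hef : ∀ t,
    IsSl2Triple ((coroot t.1.1 : Hc) : L) (e t) (f t) ∧ e t ∈ rootSpace Hc t.1.1 ∧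
      f t ∈ rootSpace Hc (-t.1.1)) (W : Submodule k (J → k))
    (hW : ∀ i : {i // b.IsPos i}, i.1 ∈ b.support → ∀ w ∈ W, repMat bs (e i) *ᵥ w ∈ W ∧ repMat bs (f i) *ᵥ w ∈ W) :
    W = ⊥ ∨ W = ⊤ := by
  let L' : LieSubalgebra k L :=
    { carrier := {x | ∀ w ∈ W, repMat bs x *ᵥ w ∈ W}
      add_mem' := by
        intro x y hx hy w hw
        rw [map_add, Matrix.add_mulVec]; exact W.add_mem (hx w hw) (hy w hw)
      zero_mem' := by intro w hw; simp
      smul_mem' := by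
        intro c x hx w hw
        rw [map_smul, Matrix.smul_mulVec]; exact W.smul_mem c (hx w hw)
      lie_mem' := by
        intro x y hx hy w hw
        rw [repMat_lie, Matrix.sub_mulVec, ← Matrix.mulVec_mulVec, ← Matrix.mulVec_mulVec]
        exact W.sub_mem (hx _ (hy w hw)) (hy _ (hx w hw)) }
  have htop := lie_gen b hef L' (fun t ht => ⟨fun w hw => (hW t ht w hw).1, fun w hw => (hW t ht w hw).2⟩)
  have hall : ∀ x : L, ∀ w ∈ W, repMat bs x *ᵥ w ∈ W := by
    intro x
    have : x ∈ L'.toSubmodule := by rw [htop]; trivial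
    exact this
  have h2 := hirr (W.comap bs.equivFun.toLinearMap) (by
    intro x w hw
    have := hall x _ hw
    simp only [LinearEquiv.coe_coe] at this
    rw [repMat_mulVec] at this
    exact this)
  have h4 : ∀ w, w ∈ W ↔ bs.equivFun.symm w ∈ W.comap bs.equivFun.toLinearMap := by
    intro w
    rw [Submodule.mem_comap, LinearEquiv.coe_coe, LinearEquiv.apply_symm_apply]
  rcases h2 with h2 | h2
  · left
    rw [eq_bot_iff]
    intro w hw
    rw [h4, h2, Submodule.mem_bot, LinearEquiv.map_eq_zero_iff] at hw
    exact hw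
  · right
    rw [eq_top_iff]
    intro w _
    rw [h4, h2]; trivial

theorem gd_exists {J : Type*} [Fintype J] [DecidableEq J] (bs : Module.Basis J k V) [Nontrivial V]
    (hirr : ∀ W : Submodule k V, (∀ x : L, ∀ w ∈ W, ⁅x, w⁆ ∈ W) → W = ⊥ ∨ W = ⊤)
    (hfaith : ∀ x : L, repMat bs x = 0 → x = 0)
    (wt : J → Module.Dual k Hc) (hwt : ∀ (h : Hc) j, ⁅(h : L), bs j⁆ = wt j h • bs j)
    {e f : {i // b.IsPos i} → L} (hef : ∀ t,
    IsSl2Triple ((coroot t.1.1 : Hc) : L) (e t) (f t) ∧ e t ∈ rootSpace Hc t.1.1 ∧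
      f t ∈ rootSpace Hc (-t.1.1)) [Fintype {i // b.IsPos i}] :
    ∃ D : GD k (Module.Dual k Hc) Hc {i // b.IsPos i} J, (∀ t, D.e t = repMat bs (e t)) ∧ (∀ t, D.f t = repMat bs (f t)) ∧
      ∀ t, t ∈ D.P.S ↔ t.1 ∈ b.support := by
  classical
  have hnz : ∀ t : {i // b.IsPos i}, t.1.1.IsNonZero := fun t => LieSubalgebra.isNonZero_coe_root t.1
  have hq' := fun t : {i // b.IsPos i} => exists_q t.1.1 (hnz t)
  choose q q0 hq using hq'
  obtain ⟨c0, hc0⟩ := cas_lemma b bs hirr wt hwt hef q q0 hq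
  let B : Module.Dual k Hc →ₗ[k] Module.Dual k Hc →ₗ[k] k := 
    (LinearMap.applyₗ ∘ₗ (cartanEquivDual Hc).symm.toLinearMap).flip
  have hBd : ∀ x y, B x y = x ((cartanEquivDual Hc).symm y) := fun x y => rfl
  let P := prsOf (rootSystem Hc) b
  have hPr : ∀ t, P.r t = (t.1.1 : Module.Dual k Hc) := fun t => rfl
  have hPc : ∀ t, P.c t = coroot t.1.1 := fun t => rfl
  have hpr : ∀ x y, P.pr x y = x y := fun x y => rfl
  have hS : ∀ t : {i // b.IsPos i}, t ∈ P.S ↔ t.1 ∈ b.support := by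
    intro t; simp [P, prsOf]
  have h0 : ∀ t, P.r t ≠ 0 := fun t => (rootSystem Hc).ne_zero t.1
  have h0c : ∀ t, P.c t ≠ 0 := fun t => (rootSystem Hc).flip.ne_zero t.1
  have rinj : ∀ i ∈ P.S, ∀ j ∈ P.S, P.r i = P.r j → i = j := by
    intro i _ j _ h
    exact Subtype.ext ((rootSystem Hc).root.injective h)
  clear_value P
  have ewt : ∀ t j l, repMat bs (e t) j l ≠ 0 → wt j = wt l + P.r t := by
    intro t j l h
    rw [hPr]
    exact repMat_entry bs wt hwt _ (by simpa using (hef t).2.1) j l h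
  have fwt : ∀ t j l, repMat bs (f t) j l ≠ 0 → wt l = wt j + P.r t := by
    intro t j l h
    have := repMat_entry bs wt hwt (-(t.1.1 : Module.Dual k Hc)) (x := f t) (by simpa using (hef t).2.2) j l h
    rw [this, hPr]; simp
  have ef : ∀ t, repMat bs (e t) * repMat bs (f t) - repMat bs (f t) * repMat bs (e t) = 
      diagonal (fun j => P.pr (wt j) (P.c t)) := by
    intro t
    rw [← repMat_lie, (hef t).1.lie_e_f, repMat_cartan bs wt hwt]
    simp only [hpr, hPc]
  have hB : ∀ t x, B x (P.r t) = (q t : k) * P.pr x (P.c t) := by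
    intro t x
    rw [hBd, hPr, hpr, hPc]
    exact symm_root_eq (hnz t) (q0 t) (hq t) x
  have Bs : ∀ x y, B x y = B y x := fun x y => cartan_symm x y
  have comm : ∀ s ∈ P.S, ∀ t ∈ P.S, s ≠ t → repMat bs (e s) * repMat bs (f t) = repMat bs (f t) * repMat bs (e s) := by
    intro s hs t ht hst
    rw [← sub_eq_zero, ← repMat_lie, simple_comm b hef s t ((hS s).1 hs) ((hS t).1 ht) hst, map_zero]
  have irr : ∀ W : Submodule k (J → k), (∀ i ∈ P.S, ∀ w ∈ W, repMat bs (e i) *ᵥ w ∈ W ∧ repMat bs (f i) *ᵥ w ∈ W) → W = ⊥ ∨ W = ⊤ :=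
    fun W hW => rep_irr b bs hirr hef W fun i hi => hW i ((hS i).2 hi)
  have cas : ∀ j, B (wt j) (wt j) + ∑ t, (q t : k) * ((repMat bs (e t) * repMat bs (f t)) j j
      + (repMat bs (f t) * repMat bs (e t)) j j) = c0 := hc0
  clear_value B
  exact ⟨{ P := P, h0 := h0, h0c := h0c, rinj := rinj, wt := wt, e := fun t => repMat bs (e t)
           f := fun t => repMat bs (f t), ewt := ewt, fwt := fwt, ef := ef
           e0 := fun t h => (hef t).1.e_ne_zero (hfaith _ h), comm := comm, irr := irr
           B := B, Bs := Bs, q := q, q0 := q0, hB := hB, c0 := c0, cas := cas }, fun _ => rfl, fun _ => rfl, hS⟩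

theorem gabber_abs {J : Type*} [Fintype J] [DecidableEq J] (bs : Module.Basis J k V) [Nontrivial V]
    (hirr : ∀ W : Submodule k V, (∀ x : L, ∀ w ∈ W, ⁅x, w⁆ ∈ W) → W = ⊥ ∨ W = ⊤)
    (hfaith : ∀ x : L, repMat bs x = 0 → x = 0)
    (wt : J → Module.Dual k Hc) (hwt : ∀ (h : Hc) j, ⁅(h : L), bs j⁆ = wt j h • bs j)
    {n : ℕ} (hn : n.Prime) (hodd : Odd n) (hJ : Fintype.card J = n) :
    (∀ X : Matrix J J k, X.trace = 0 → ∃ x : L, repMat bs x = X) ∨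
    ∃ Φ : Matrix J J k, Φ.det ≠ 0 ∧ ∀ x : L, (repMat bs x)ᵀ * Φ + Φ * repMat bs x = 0 := by
  classical
  obtain ⟨b⟩ : Nonempty (rootSystem Hc).Base := RootPairing.nonempty_base _
  obtain ⟨e, f, hef⟩ := exists_root_vectors b
  haveI : Fintype {i // b.IsPos i} := Fintype.ofFinite _
  obtain ⟨D, hDe, hDf, hS⟩ := gd_exists b bs hirr hfaith wt hwt hef
  rcases D.core hn hodd hJ with h | ⟨Φ, hΦ, h⟩
  · left
    intro X hX
    have := h (LinearMap.range (repMat bs : L →ₗ[k] Matrix J J k)) ?_ ?_ X hX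
    · exact this
    · rintro _ ⟨x, rfl⟩ _ ⟨y, rfl⟩
      exact ⟨⁅x, y⁆, repMat_lie bs x y⟩
    · intro i _
      exact ⟨⟨e i, (hDe i).symm⟩, ⟨f i, (hDf i).symm⟩⟩
  · right
    refine ⟨Φ, hΦ, ?_⟩
    let L' : LieSubalgebra k L :=
      { carrier := {x | (repMat bs x)ᵀ * Φ + Φ * repMat bs x = 0}
        add_mem' := by
          intro x y hx hy
          simp only [Set.mem_setOf_eq] at hx hy ⊢
          rw [map_add, Matrix.transpose_add, add_mul, mul_add]
          rw [add_add_add_comm, hx, hy, add_zero]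
        zero_mem' := by simp
        smul_mem' := by
          intro c x hx
          simp only [Set.mem_setOf_eq] at hx ⊢
          rw [map_smul, Matrix.transpose_smul, Matrix.smul_mul, Matrix.mul_smul, ← smul_add, hx, smul_zero]
        lie_mem' := by
          intro x y hx hy
          simp only [Set.mem_setOf_eq] at hx hy ⊢
          change (repMat bs x)ᵀ * Φ + Φ * repMat bs x = 0 at hx
          change (repMat bs y)ᵀ * Φ + Φ * repMat bs y = 0 at hy
          rw [repMat_lie, Matrix.transpose_sub, Matrix.transpose_mul, Matrix.transpose_mul]
          have hx' := eq_neg_of_add_eq_zero_left hx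
          have hy' := eq_neg_of_add_eq_zero_left hy
          simp only [sub_mul, mul_sub, mul_assoc, hx', hy', mul_neg]
          simp only [← mul_assoc, hx', hy', neg_mul]
          abel }
    have htop := lie_gen b hef L' (fun t ht => by
      have := h t ((hS t).2 ht)
      rw [hDe, hDf] at this
      exact this)
    intro x
    have : x ∈ L'.toSubmodule := by rw [htop]; trivial
    exact this
end LA8
end PieceLA8

section PieceLA9
open Matrix

section LA9
attribute [local instance] LieRing.ofAssociativeRing
open LieAlgebra LieModule

theorem gabber {k : Type*} [Field k] [CharZero k] [IsAlgClosed k] {n : ℕ} (hn : n.Prime) (hodd : Odd n)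
    (S : Submodule k (Matrix (Fin n) (Fin n) k))
    (hlie : ∀ x ∈ S, ∀ y ∈ S, x * y - y * x ∈ S) (htr : ∀ x ∈ S, x.trace = 0)
    (hirr : ∀ W : Submodule k (Fin n → k), (∀ x ∈ S, ∀ w ∈ W, x *ᵥ w ∈ W) → W = ⊥ ∨ W = ⊤) :
    (∀ X : Matrix (Fin n) (Fin n) k, X.trace = 0 → X ∈ S) ∨
    ∃ Φ : Matrix (Fin n) (Fin n) k, Φ.det ≠ 0 ∧ ∀ x ∈ S, xᵀ * Φ + Φ * x = 0 := by
  classical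
  let A : LieSubalgebra k (Module.End k (Fin n → k)) :=
    { S.map (Matrix.toLinAlgEquiv' (R := k) (n := Fin n)).toLinearMap with
      lie_mem' := by
        rintro _ _ ⟨x, hx, rfl⟩ ⟨y, hy, rfl⟩
        refine ⟨x * y - y * x, hlie x hx y hy, ?_⟩
        simp only [AlgEquiv.toLinearMap_apply, map_sub, map_mul]; rfl }
  have hA : ∀ x : Module.End k (Fin n → k), x ∈ A ↔ LinearMap.toMatrix' x ∈ S := by
    intro x
    constructor
    · rintro ⟨y, hy, rfl⟩
      have : LinearMap.toMatrix' ((Matrix.toLinAlgEquiv' (R := k) (n := Fin n)).toLinearMap y) = y := LinearMap.toMatrix'_toLin' y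
      rw [this]; exact hy
    · intro h
      exact ⟨_, h, Matrix.toLin'_toMatrix' x⟩
  have hact : ∀ (x : A) (v : Fin n → k), ⁅x, v⁆ = x.1 v := fun x v => rfl
  haveI : NeZero n := ⟨hn.ne_zero⟩
  haveI : Nontrivial (Fin n → k) := inferInstance
  haveI : FiniteDimensional k A := FiniteDimensional.finiteDimensional_submodule A.toSubmodule
  have hirr' : ∀ W : Submodule k (Fin n → k), (∀ x : A, ∀ w ∈ W, ⁅x, w⁆ ∈ W) → W = ⊥ ∨ W = ⊤ := by
    intro W hW
    apply hirr W
    intro x hx w hw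
    exact hW ⟨Matrix.toLin' x, (hA _).2 (by simpa using hx)⟩ w hw
  haveI : LieModule.IsIrreducible k A (Fin n → k) := by
    apply LieModule.IsIrreducible.mk
    intro N hN
    rcases hirr' N.toSubmodule (fun x w hw => N.lie_mem hw) with h | h
    · exact absurd (by simpa using h) hN
    · simpa using h
  haveI : LieModule.IsFaithful k A (Fin n → k) := by
    constructor
    intro x y h
    apply Subtype.ext
    exact LinearMap.ext fun v => LinearMap.congr_fun h v
  haveI : HasTrivialRadical k A := 
    LieAlgebra.hasTrivialRadical_of_isIrreducible_of_isFaithful k A (Fin n → k) (by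
      intro x
      have h1 := htr _ ((hA x.1).1 x.2)
      have : LieModule.toEnd k A (Fin n → k) x = x.1 := LinearMap.ext fun v => rfl
      rw [this]
      rw [LinearMap.trace_eq_matrix_trace k (Pi.basisFun k (Fin n))]
      exact h1)
  haveI : IsKilling k A := inferInstance
  obtain ⟨x, hx⟩ := LieAlgebra.exists_isCartanSubalgebra_engel k A
  haveI := hx
  obtain ⟨J, _, bs, wt, hwt⟩ := exists_weight_basis (Hc := LieSubalgebra.engel k x) (V := Fin n → k) hirr'
  have hJ : Fintype.card J = n := by
    rw [← Module.finrank_eq_card_basis bs]; simp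
  let eJ : J ≃ Fin n := Fintype.equivFinOfCardEq hJ
  let bs' := bs.reindex eJ
  have hwt' : ∀ (h : LieSubalgebra.engel k x) (j : Fin n), ⁅(h : A), bs' j⁆ = wt (eJ.symm j) h • bs' j := by
    intro h j
    simp only [bs', Module.Basis.reindex_apply]
    exact hwt h _
  have hrep : ∀ y : A, repMat bs' y = LinearMap.toMatrix bs' bs' y.1 := fun y => rfl
  set Q := bs'.toMatrix (Pi.basisFun k (Fin n)) with hQ
  set R := (Pi.basisFun k (Fin n)).toMatrix bs' with hR
  have hQR : Q * R = 1 := Module.Basis.toMatrix_mul_toMatrix_flip _ _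
  have hRQ : R * Q = 1 := Module.Basis.toMatrix_mul_toMatrix_flip _ _
  have hconj : ∀ y : Module.End k (Fin n → k), LinearMap.toMatrix bs' bs' y = Q * LinearMap.toMatrix' y * R := by
    intro y
    exact (basis_toMatrix_mul_linearMap_toMatrix_mul_basis_toMatrix bs' (Pi.basisFun k (Fin n)) bs' (Pi.basisFun k (Fin n)) y).symm
  rcases gabber_abs (L := A) (Hc := LieSubalgebra.engel k x) bs' hirr' (by
      intro y hy
      rw [hrep] at hy
      apply Subtype.ext
      simpa using hy) (fun j => wt (eJ.symm j)) hwt' hn hodd (Fintype.card_fin n) with h | ⟨Φ, hΦ, h⟩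
  · left
    intro X hX
    obtain ⟨y, hy⟩ := h (Q * X * R) (by rw [Matrix.trace_mul_comm, ← mul_assoc, hRQ, one_mul, hX])
    rw [hrep, hconj] at hy
    have h2 : LinearMap.toMatrix' y.1 = X := by
      have h3 := congrArg (fun Z => R * Z * Q) hy
      calc LinearMap.toMatrix' y.1 = (R * Q) * LinearMap.toMatrix' y.1 * (R * Q) := by rw [hRQ]; simp
        _ = R * (Q * LinearMap.toMatrix' y.1 * R) * Q := by noncomm_ring
        _ = R * (Q * X * R) * Q := h3
        _ = (R * Q) * X * (R * Q) := by noncomm_ring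
        _ = X := by rw [hRQ]; simp
    rw [← h2]; exact (hA _).1 y.2
  · right
    have hQd : Q.det * R.det = 1 := by rw [← det_mul, hQR, det_one]
    refine ⟨Qᵀ * Φ * Q, ?_, ?_⟩
    · rw [det_mul, det_mul, det_transpose]
      have : Q.det ≠ 0 := left_ne_zero_of_mul_eq_one hQd
      exact mul_ne_zero (mul_ne_zero this hΦ) this
    · intro X hX
      have h1 := h ⟨Matrix.toLin' X, (hA _).2 (by simpa using hX)⟩
      rw [hrep, hconj] at h1
      simp only [LinearMap.toMatrix'_toLin'] at h1
      have h2 : (Q * X * R)ᵀ = Rᵀ * Xᵀ * Qᵀ := by simp [Matrix.transpose_mul, mul_assoc]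
      rw [h2] at h1
      have h3 : Qᵀ * Rᵀ = 1 := by rw [← Matrix.transpose_mul, hRQ, Matrix.transpose_one]
      calc Xᵀ * (Qᵀ * Φ * Q) + Qᵀ * Φ * Q * X 
          = (Qᵀ * Rᵀ) * Xᵀ * Qᵀ * Φ * Q + Qᵀ * Φ * Q * X * (R * Q) := by rw [h3, hRQ]; noncomm_ring
        _ = Qᵀ * (Rᵀ * Xᵀ * Qᵀ * Φ + Φ * (Q * X * R)) * Q := by noncomm_ring
        _ = 0 := by rw [h1]; simp
end LA9
end PieceLA9

section PieceCl1
open Matrix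

/-- Jacobson density / Burnside for matrix algebras with scalar commutant -/
theorem burnside_aux {F ι : Type*} [Field F] [Fintype ι] [DecidableEq ι]
    (A : Submodule F (Matrix ι ι F)) (hmul : ∀ a ∈ A, ∀ b ∈ A, a * b ∈ A) (h1 : 1 ∈ A)
    (hirr : ∀ W : Submodule F (ι → F), (∀ a ∈ A, ∀ w ∈ W, a *ᵥ w ∈ W) → W = ⊥ ∨ W = ⊤)
    (hcom : ∀ x : Module.End F (ι → F), (∀ a ∈ A, ∀ v, x (a *ᵥ v) = a *ᵥ x v) → ∃ c : F, ∀ v, x v = c • v)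
    (s : Set (ι → F)) (hs : s.Finite) : ∀ v, v ∉ Submodule.span F s → ∃ a ∈ A, (∀ u ∈ s, a *ᵥ u = 0) ∧ a *ᵥ v ≠ 0 := by
  classical
  induction s, hs using Set.Finite.induction_on with
  | empty =>
    intro v hv
    refine ⟨1, h1, by simp, ?_⟩
    simpa using hv
  | @insert u s hus hsf ih =>
    intro v hv
    by_cases hu : u ∈ Submodule.span F s
    · rw [Submodule.span_insert_eq_span hu] at hv
      obtain ⟨a, ha, h2, h3⟩ := ih v hv
      refine ⟨a, ha, ?_, h3⟩
      intro w hw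
      rcases Set.mem_insert_iff.1 hw with rfl | hw
      · have : Submodule.span F s ≤ LinearMap.ker (Matrix.toLin' a) := by
          rw [Submodule.span_le]; intro w hw; simpa using h2 w hw
        simpa using this hu
      · exact h2 w hw
    by_contra hcon
    push Not at hcon
    let I : Submodule F (Matrix ι ι F) := A ⊓ (⨅ w ∈ s, LinearMap.ker (((Matrix.mulVecBilin F F).flip w : Matrix ι ι F →ₗ[F] ι → F)))
    have hI : ∀ a, a ∈ I ↔ a ∈ A ∧ ∀ w ∈ s, a *ᵥ w = 0 := by
      intro a; simp [I, Submodule.mem_iInf]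
    let ev : I →ₗ[F] (ι → F) := ((Matrix.mulVecBilin F F).flip u).comp I.subtype
    let ev' : I →ₗ[F] (ι → F) := ((Matrix.mulVecBilin F F).flip v).comp I.subtype
    have hev : ∀ a : I, ev a = a.1 *ᵥ u := fun a => rfl
    have hev' : ∀ a : I, ev' a = a.1 *ᵥ v := fun a => rfl
    clear_value ev ev'
    have hsurj : LinearMap.range ev = ⊤ := by
      refine (hirr _ ?_).resolve_left ?_
      · rintro b hb _ ⟨a, rfl⟩
        refine ⟨⟨b * a.1, (hI _).2 ⟨hmul b hb _ ((hI _).1 a.2).1, fun w hw => ?_⟩⟩, ?_⟩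
        · rw [← Matrix.mulVec_mulVec, ((hI _).1 a.2).2 w hw, Matrix.mulVec_zero]
        · rw [hev, hev, Matrix.mulVec_mulVec]
      · intro hbot
        obtain ⟨a, ha, h2, h3⟩ := ih u hu
        apply h3
        have : ev ⟨a, (hI a).2 ⟨ha, h2⟩⟩ ∈ LinearMap.range ev := ⟨_, rfl⟩
        rw [hbot, Submodule.mem_bot, hev] at this
        exact this
    have hker : LinearMap.ker ev ≤ LinearMap.ker ev' := by
      intro a ha
      rw [LinearMap.mem_ker, hev] at ha
      rw [LinearMap.mem_ker, hev']
      refine hcon a.1 ((hI _).1 a.2).1 ?_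
      intro w hw
      rcases Set.mem_insert_iff.1 hw with rfl | hw
      · exact ha
      · exact ((hI _).1 a.2).2 w hw
    obtain ⟨g, hg⟩ := LinearMap.exists_rightInverse_of_surjective ev hsurj
    have hfac : ∀ a : I, ev' (g (ev a)) = ev' a := by
      intro a
      have : g (ev a) - a ∈ LinearMap.ker ev := by
        rw [LinearMap.mem_ker, map_sub, sub_eq_zero]
        exact LinearMap.congr_fun hg (ev a)
      have := hker this
      rwa [LinearMap.mem_ker, map_sub, sub_eq_zero] at this
    obtain ⟨c, hc⟩ := hcom (ev' ∘ₗ g) (by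
      intro b hb w
      obtain ⟨a, rfl⟩ : w ∈ LinearMap.range ev := by rw [hsurj]; trivial
      have hba : b * a.1 ∈ I := (hI _).2 ⟨hmul b hb _ ((hI _).1 a.2).1, fun w hw => by
        rw [← Matrix.mulVec_mulVec, ((hI _).1 a.2).2 w hw, Matrix.mulVec_zero]⟩
      have h3 : b *ᵥ ev a = ev ⟨_, hba⟩ := by rw [hev, hev, Matrix.mulVec_mulVec]
      rw [h3, LinearMap.comp_apply, LinearMap.comp_apply, hfac, hfac, hev', hev', Matrix.mulVec_mulVec])
    have h5 : v - c • u ∈ Submodule.span F s := by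
      by_contra hn
      obtain ⟨a, ha, h2, h3⟩ := ih _ hn
      apply h3
      have h6 := hc (ev ⟨a, (hI a).2 ⟨ha, h2⟩⟩)
      rw [LinearMap.comp_apply, hfac, hev', hev] at h6
      simp only at h6
      rw [Matrix.mulVec_sub, Matrix.mulVec_smul, h6, sub_self]
    apply hv
    rw [Submodule.mem_span_insert]
    exact ⟨c, _, h5, by abel⟩

theorem burnside {F ι : Type*} [Field F] [Fintype ι] [DecidableEq ι]
    (A : Submodule F (Matrix ι ι F)) (hmul : ∀ a ∈ A, ∀ b ∈ A, a * b ∈ A) (h1 : 1 ∈ A)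
    (hirr : ∀ W : Submodule F (ι → F), (∀ a ∈ A, ∀ w ∈ W, a *ᵥ w ∈ W) → W = ⊥ ∨ W = ⊤)
    (hcom : ∀ x : Module.End F (ι → F), (∀ a ∈ A, ∀ v, x (a *ᵥ v) = a *ᵥ x v) → ∃ c : F, ∀ v, x v = c • v) :
    A = ⊤ := by
  rw [eq_top_iff]
  intro X _
  rw [Matrix.matrix_eq_sum_single X]
  refine A.sum_mem fun i _ => A.sum_mem fun j _ => ?_
  have hni : (Pi.single j 1 : ι → F) ∉ Submodule.span F ((fun l => (Pi.single l 1 : ι → F)) '' {l | l ≠ j}) := by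
    intro h
    have : Submodule.span F ((fun l => (Pi.single l 1 : ι → F)) '' {l | l ≠ j}) ≤ LinearMap.ker (LinearMap.proj j : (ι → F) →ₗ[F] F) := by
      rw [Submodule.span_le]
      rintro _ ⟨l, hl, rfl⟩
      simp [Pi.single_apply, Ne.symm hl]
    have := this h
    simp at this
  obtain ⟨a, ha, h2, h3⟩ := burnside_aux A hmul h1 hirr hcom _ (Set.toFinite _) _ hni
  let W : Submodule F (ι → F) := A.map ((Matrix.mulVecBilin F F).flip (a *ᵥ Pi.single j 1))
  have hW : W = ⊤ := by
    refine (hirr W ?_).resolve_left ?_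
    · rintro b hb _ ⟨c, hc, rfl⟩
      refine ⟨b * c, hmul b hb c hc, ?_⟩
      simp [Matrix.mulVec_mulVec]
    · intro h
      have : a *ᵥ Pi.single j 1 ∈ W := ⟨1, h1, by simp⟩
      rw [h] at this
      exact h3 (by simpa using this)
  have : (Pi.single i (X i j) : ι → F) ∈ W := by rw [hW]; trivial
  obtain ⟨b, hb, hb2⟩ := this
  have hb2' : b *ᵥ (a *ᵥ Pi.single j 1) = Pi.single i (X i j) := hb2
  have : Matrix.single i j (X i j) = b * a := by
    ext p q
    have hcol : ∀ q, (b * a) p q = ((b * a) *ᵥ Pi.single q 1) p := by intro q; rw [Matrix.mulVec_single_one]; rfl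
    rw [hcol]
    by_cases hq : q = j
    · subst hq
      rw [← Matrix.mulVec_mulVec, hb2']
      simp [Matrix.single_apply, Pi.single_apply, eq_comm]
    · rw [← Matrix.mulVec_mulVec, h2 _ ⟨q, hq, rfl⟩]
      simp [Matrix.single_apply, Ne.symm hq]
  rw [this]; exact hmul b hb a ha
end PieceCl1

section PieceCl2
open Matrix

theorem cliff {F Γ : Type*} [Field F] [Group Γ] {n : ℕ} (hn : n.Prime)
    (ρ : Γ →* Matrix (Fin n) (Fin n) F)
    (hirr : ∀ W : Submodule F (Fin n → F), (∀ g, ∀ w ∈ W, ρ g *ᵥ w ∈ W) → W = ⊥ ∨ W = ⊤)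
    (S : Set (Matrix (Fin n) (Fin n) F)) (hS : ∀ g, ∀ x ∈ S, ρ g * x * ρ g⁻¹ ∈ S) :
    (∀ W : Submodule F (Fin n → F), (∀ x ∈ S, ∀ w ∈ W, x *ᵥ w ∈ W) → W = ⊥ ∨ W = ⊤) ∨
    Submodule.span F {v : Fin n → F | ∀ x ∈ S, ∃ c : F, x *ᵥ v = c • v} = ⊤ := by
  classical
  haveI : NeZero n := ⟨hn.ne_zero⟩
  let inv : Submodule F (Fin n → F) → Prop := fun W => ∀ x ∈ S, ∀ w ∈ W, x *ᵥ w ∈ W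
  have hgg : ∀ g, ρ g⁻¹ * ρ g = 1 := fun g => by rw [← map_mul]; simp
  have hgg' : ∀ g, ρ g * ρ g⁻¹ = 1 := fun g => by rw [← map_mul]; simp
  have hinj : ∀ g, Function.Injective (Matrix.toLin' (ρ g)) := by
    intro g v w h
    have h2 := congrArg (fun z => ρ g⁻¹ *ᵥ z) h
    simpa [Matrix.mulVec_mulVec, hgg] using h2
  let tr : Γ → Submodule F (Fin n → F) → Submodule F (Fin n → F) := fun g W => W.map (Matrix.toLin' (ρ g))
  have htr_inv : ∀ g W, inv W → inv (tr g W) := by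
    rintro g W hW x hx _ ⟨w, hw, rfl⟩
    refine ⟨(ρ g⁻¹ * x * ρ g) *ᵥ w, hW _ ?_ w hw, ?_⟩
    · have := hS g⁻¹ x hx
      rwa [inv_inv] at this
    · simp only [Matrix.toLin'_apply, Matrix.mulVec_mulVec, ← mul_assoc, hgg', one_mul]
  have htr_rank : ∀ g W, Module.finrank F (tr g W) = Module.finrank F W := fun g W =>
    ((Submodule.equivMapOfInjective (Matrix.toLin' (ρ g)) (hinj g) W).finrank_eq).symm
  -- minimal dimension invariant subspace
  have hex : ∃ d : ℕ, ∃ W : Submodule F (Fin n → F), inv W ∧ W ≠ ⊥ ∧ Module.finrank F W = d :=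
    ⟨_, ⊤, fun x _ w _ => trivial, top_ne_bot, rfl⟩
  obtain ⟨W, hWinv, hW0, hWd⟩ := Nat.find_spec hex
  have hmin : ∀ U : Submodule F (Fin n → F), inv U → U ≠ ⊥ → Module.finrank F W ≤ Module.finrank F U := by
    intro U hU hU0
    rw [hWd]; exact Nat.find_min' hex ⟨U, hU, hU0, rfl⟩
  set d := Module.finrank F W with hd
  have hsum : (⨆ g, tr g W) = ⊤ := by
    refine (hirr _ ?_).resolve_left ?_
    · intro g w hw
      have : (⨆ g, tr g W) ≤ (⨆ g, tr g W).comap (Matrix.toLin' (ρ g)) := by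
        refine iSup_le fun g' => ?_
        rintro _ ⟨w, hw, rfl⟩
        refine (le_iSup (fun g => tr g W) (g * g')) ⟨w, hw, ?_⟩
        simp [Matrix.mulVec_mulVec]
      exact this hw
    · intro h
      apply hW0
      rw [eq_bot_iff, ← h]
      refine le_trans ?_ (le_iSup _ 1)
      intro w hw
      exact ⟨w, hw, by simp⟩
  -- d divides n
  have hdvd : d ∣ n := by
    have hP : ∃ m : ℕ, ∃ U : Submodule F (Fin n → F), inv U ∧ d ∣ Module.finrank F U ∧ n - Module.finrank F U = m :=
      ⟨_, ⊥, fun x _ w hw => by simp only [Submodule.mem_bot] at hw ⊢; rw [hw]; simp, by simp, rfl⟩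
    obtain ⟨U, hU, hUd, hUm⟩ := Nat.find_spec hP
    by_cases hUt : U = ⊤
    · rw [hUt] at hUd; simpa using hUd
    exfalso
    obtain ⟨g, hg⟩ : ∃ g, ¬ tr g W ≤ U := by
      by_contra hcon
      push Not at hcon
      apply hUt
      rw [eq_top_iff, ← hsum]; exact iSup_le hcon
    have hcastmul : tr g W ⊓ U = ⊥ := by
      by_contra hne
      have h1 : inv (tr g W ⊓ U) := fun x hx w hw => ⟨htr_inv g W hWinv x hx w hw.1, hU x hx w hw.2⟩
      have h2 := hmin _ h1 hne
      rw [hd, ← htr_rank g W] at h2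
      have h3 := Submodule.eq_of_le_of_finrank_le (inf_le_left : tr g W ⊓ U ≤ tr g W) h2
      exact hg (by rw [← h3]; exact inf_le_right)
    have hfr : Module.finrank F ↥(tr g W ⊔ U) = d + Module.finrank F U := by
      have := Submodule.finrank_sup_add_finrank_inf_eq (tr g W) U
      rw [hcastmul, htr_rank] at this
      simpa using this
    have hdpos : 0 < d := by
      rw [hd, Module.finrank_pos_iff]
      exact Submodule.nontrivial_iff_ne_bot.2 hW0
    have h5 : Module.finrank F ↥(tr g W ⊔ U) ≤ n := by
      have := Submodule.finrank_le (tr g W ⊔ U); simpa using this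
    have h4 := Nat.find_min' hP ⟨tr g W ⊔ U, ?_, ?_, rfl⟩
    · omega
    · intro x hx w hw
      obtain ⟨a, ha, c, hc, rfl⟩ := Submodule.mem_sup.1 hw
      rw [Matrix.mulVec_add]
      exact Submodule.add_mem_sup (htr_inv g W hWinv x hx a ha) (hU x hx c hc)
    · rw [hfr]; exact dvd_add dvd_rfl hUd
  rcases (Nat.dvd_prime hn).1 hdvd with h1 | h1
  · right
    rw [eq_top_iff, ← hsum]
    refine iSup_le fun g => ?_
    intro v hv
    apply Submodule.subset_span
    intro x hx
    have hr : Module.finrank F (tr g W) = 1 := by rw [htr_rank]; exact h1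
    by_cases hv0 : v = 0
    · exact ⟨0, by simp [hv0]⟩
    obtain ⟨c, hc⟩ := (finrank_eq_one_iff_of_nonzero' (⟨v, hv⟩ : tr g W) (by simpa using hv0)).1 hr 
      ⟨x *ᵥ v, htr_inv g W hWinv x hx v hv⟩
    exact ⟨c, by simpa using (congrArg Subtype.val hc).symm⟩
  · left
    intro U hU
    by_cases hU0 : U = ⊥
    · left; exact hU0
    · right
      have := hmin U hU hU0
      apply Submodule.eq_top_of_finrank_eq
      have h2 := Submodule.finrank_le U
      simp only [Module.finrank_fin_fun] at h2 ⊢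
      omega

/-- absolute irreducibility -/
theorem absirr {F Γ : Type*} [Field F] [Group Γ] {n : ℕ} (hn : n.Prime)
    (ρ : Γ →* Matrix (Fin n) (Fin n) F)
    (hirr : ∀ W : Submodule F (Fin n → F), (∀ g, ∀ w ∈ W, ρ g *ᵥ w ∈ W) → W = ⊥ ∨ W = ⊤)
    (hcomm : ¬ ∀ g h, ρ g * ρ h = ρ h * ρ g) :
    Submodule.span F (Set.range ρ) = ⊤ := by
  haveI : NeZero n := ⟨hn.ne_zero⟩
  apply burnside
  · intro a ha b hb
    have := Submodule.mul_mem_mul ha hb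
    rw [Submodule.span_mul_span] at this
    refine Submodule.span_mono ?_ this
    rintro _ ⟨_, ⟨g, rfl⟩, _, ⟨h, rfl⟩, rfl⟩
    exact ⟨g * h, by simp⟩
  · exact Submodule.subset_span ⟨1, by simp⟩
  · intro W hW
    exact hirr W fun g w hw => hW _ (Submodule.subset_span ⟨g, rfl⟩) w hw
  · intro x hx
    by_contra hns
    apply hcomm
    have hx' : ∀ g v, x (ρ g *ᵥ v) = ρ g *ᵥ x v := fun g v => hx _ (Submodule.subset_span ⟨g, rfl⟩) v
    have hX : ∀ v, LinearMap.toMatrix' x *ᵥ v = x v := fun v => by rw [← Matrix.toLin'_apply, Matrix.toLin'_toMatrix']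
    have key := cliff hn ρ hirr {LinearMap.toMatrix' x} (by
      rintro g _ rfl
      have h1 : ρ g * LinearMap.toMatrix' x = LinearMap.toMatrix' x * ρ g := by
        apply Matrix.toLin'.injective
        ext1 i
        apply LinearMap.ext_ring
        simp only [LinearMap.comp_apply, Matrix.toLin'_apply, ← Matrix.mulVec_mulVec, hX, hx']
      rw [h1, mul_assoc, ← map_mul]; simp)
    rcases key with key | key
    · -- x irreducible
      obtain ⟨v, hv⟩ := exists_ne (0 : Fin n → F)
      let P := Algebra.adjoin F {x}
      let ev : P →ₗ[F] (Fin n → F) := (LinearMap.applyₗ v).comp P.toSubmodule.subtype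
      have hev : ∀ p : P, ev p = p.1 v := fun p => rfl
      have htop : LinearMap.range ev = ⊤ := by
        refine (key _ ?_).resolve_left ?_
        · rintro _ rfl _ ⟨p, rfl⟩
          rw [hX]
          refine ⟨⟨x * p.1, P.mul_mem (Algebra.subset_adjoin rfl) p.2⟩, ?_⟩
          rw [hev, hev]; rfl
        · intro h
          have : ev 1 ∈ LinearMap.range ev := ⟨_, rfl⟩
          rw [h, Submodule.mem_bot, hev] at this
          exact hv this
      have hc : ∀ p : P, ∀ g w, p.1 (ρ g *ᵥ w) = ρ g *ᵥ p.1 w := by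
        intro p g
        have hle : P ≤ Subalgebra.centralizer F {Matrix.toLin' (ρ g)} := by
          apply Algebra.adjoin_le
          rintro _ rfl
          rw [SetLike.mem_coe, Subalgebra.mem_centralizer_iff]
          rintro _ rfl
          exact LinearMap.ext fun w => by simp [hx']
        have := hle p.2
        rw [Subalgebra.mem_centralizer_iff] at this
        intro w
        have h2 := LinearMap.congr_fun (this _ rfl) w
        simpa using h2.symm
      have hPc : ∀ p q : P, p.1 * q.1 = q.1 * p.1 := by
        intro p q
        exact congrArg Subtype.val (Algebra.adjoinCommRingOfComm F (s := {x}) (by rintro _ rfl _ rfl; rfl) |>.mul_comm p q)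
      intro g h
      apply Matrix.toLin'.injective
      ext1 i
      apply LinearMap.ext_ring
      simp only [LinearMap.comp_apply, Matrix.toLin'_apply, ← Matrix.mulVec_mulVec]
      generalize (LinearMap.single F (fun _ => F) i) 1 = w
      obtain ⟨r, hr⟩ : w ∈ LinearMap.range ev := by rw [htop]; trivial
      obtain ⟨p, hp⟩ : ρ g *ᵥ v ∈ LinearMap.range ev := by rw [htop]; trivial
      obtain ⟨q, hq⟩ : ρ h *ᵥ v ∈ LinearMap.range ev := by rw [htop]; trivial
      rw [hev] at hr hp hq
      rw [← hr, ← hc, ← hc, ← hc, ← hc, ← hq, ← hp, ← hc, ← hc, ← hq, ← hp]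
      have := LinearMap.congr_fun (hPc p q) v
      simp only [Module.End.mul_apply] at this
      rw [this]
    · exfalso
      apply hns
      obtain ⟨v, hvS, hv0⟩ : ∃ v ∈ {v : Fin n → F | ∀ y ∈ ({LinearMap.toMatrix' x} : Set _), ∃ c : F, y *ᵥ v = c • v}, v ≠ 0 := by
        by_contra hcon
        push Not at hcon
        have : Submodule.span F {v : Fin n → F | ∀ y ∈ ({LinearMap.toMatrix' x} : Set _), ∃ c : F, y *ᵥ v = c • v} = ⊥ := by
          rw [Submodule.span_eq_bot]; exact hcon
        rw [this] at key
        exact bot_ne_top key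
      obtain ⟨c, hc⟩ := hvS _ rfl
      rw [hX] at hc
      have := (hirr (Module.End.eigenspace x c) (by
        intro g w hw
        rw [Module.End.mem_eigenspace_iff] at hw ⊢
        rw [hx', hw, Matrix.mulVec_smul])).resolve_left (by
          intro h
          have h2 : v ∈ Module.End.eigenspace x c := by rw [Module.End.mem_eigenspace_iff, hc]
          rw [h] at h2
          exact hv0 (by simpa using h2))
      refine ⟨c, fun w => ?_⟩
      rw [← Module.End.mem_eigenspace_iff, this]; trivial
end PieceCl2

section PieceFm
open Matrix

/-- the representation of `H` over a field `k` -/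
def rk (k : Type*) [Field k] {n : ℕ} (H : Subgroup (SL n ℤ)) : H →* Matrix (Fin n) (Fin n) k where
  toFun h := (h.1.1).map (Int.castRingHom k)
  map_one' := by simp
  map_mul' := by intro a b; exact Matrix.map_mul (f := Int.castRingHom k)

theorem rk_apply (k : Type*) [Field k] {n : ℕ} (H : Subgroup (SL n ℤ)) (h : H) :
    rk k H h = (h.1.1).map (Int.castRingHom k) := rfl

theorem rk_det (k : Type*) [Field k] {n : ℕ} (H : Subgroup (SL n ℤ)) (h : H) :
    (rk k H h).det = 1 := by
  rw [rk_apply]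
  have := (Int.castRingHom k).map_det h.1.1
  rw [RingHom.mapMatrix_apply] at this
  rw [← this, h.1.2]; simp

theorem rk_trace (k : Type*) [Field k] {n : ℕ} (H : Subgroup (SL n ℤ)) (h : H) :
    (rk k H h).trace = ((h.1.1).trace : ℤ) := by
  rw [rk_apply]
  simp [Matrix.trace]

theorem rk_inj (k : Type*) [Field k] [CharZero k] {n : ℕ} (H : Subgroup (SL n ℤ)) : Function.Injective (rk k H) := by
  intro a b h
  apply Subtype.ext
  apply Subtype.ext
  ext i j
  have := congrFun (congrFun h i) j
  simpa [rk_apply] using this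

theorem sbf_of_comm {G : Type*} [Group G] (N : Subgroup G) [N.FiniteIndex]
    (h : ∀ a ∈ N, ∀ b ∈ N, a * b = b * a) : SolvableByFinite G :=
  ⟨N, isSolvable_of_comm (fun a b => Subtype.ext (h a a.2 b b.2)), inferInstance⟩

theorem comm_of_span {k : Type*} [Field k] {n : ℕ} (S : Set (Matrix (Fin n) (Fin n) k))
    (h : Submodule.span k {v : Fin n → k | ∀ x ∈ S, ∃ c : k, x *ᵥ v = c • v} = ⊤) 
    (x y) (hx : x ∈ S) (hy : y ∈ S) : x * y = y * x := by
  have : ∀ v : Fin n → k, (x * y) *ᵥ v = (y * x) *ᵥ v := by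
    intro v
    have hv : v ∈ Submodule.span k {v : Fin n → k | ∀ x ∈ S, ∃ c : k, x *ᵥ v = c • v} := by rw [h]; trivial
    induction hv using Submodule.span_induction with
    | mem v hv =>
      obtain ⟨a, ha⟩ := hv x hx
      obtain ⟨b, hb⟩ := hv y hy
      rw [← Matrix.mulVec_mulVec, ← Matrix.mulVec_mulVec, ha, hb, Matrix.mulVec_smul, Matrix.mulVec_smul, ha, hb, smul_comm]
    | zero => simp
    | add a b _ _ ha hb => rw [Matrix.mulVec_add, Matrix.mulVec_add, ha, hb]
    | smul c a _ ha => rw [Matrix.mulVec_smul, Matrix.mulVec_smul, ha]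
  exact Matrix.mulVec_injective (funext this)

theorem irr_rkQ {n : ℕ} {H : Subgroup (SL n ℤ)} (hirr : IrreducibleQ H) :
    ∀ W : Submodule ℚ (Fin n → ℚ), (∀ g, ∀ w ∈ W, rk ℚ H g *ᵥ w ∈ W) → W = ⊥ ∨ W = ⊤ := by
  intro W hW
  apply hirr W
  rintro g hg _ ⟨w, hw, rfl⟩
  exact hW ⟨g, hg⟩ w hw

/-- a finite index normal subgroup is absolutely irreducible -/
theorem normal_span {n : ℕ} (hn : n.Prime) {H : Subgroup (SL n ℤ)} (hirr : IrreducibleQ H)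
    (hsbf : ¬ SolvableByFinite H) (N : Subgroup H) [N.Normal] [N.FiniteIndex] :
    Submodule.span ℚ (rk ℚ H '' (N : Set H)) = ⊤ := by
  have hnc : ¬ ∀ a ∈ N, ∀ b ∈ N, rk ℚ H a * rk ℚ H b = rk ℚ H b * rk ℚ H a := by
    intro h
    apply hsbf
    refine sbf_of_comm N fun a ha b hb => rk_inj ℚ H ?_
    rw [map_mul, map_mul]; exact h a ha b hb
  have h1 := cliff hn (rk ℚ H) (irr_rkQ hirr) (rk ℚ H '' (N : Set H)) (by
    rintro g _ ⟨x, hx, rfl⟩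
    exact ⟨g * x * g⁻¹, ‹N.Normal›.conj_mem x hx g, by simp⟩)
  rcases h1 with h1 | h1
  · have h2 := absirr hn ((rk ℚ H).comp N.subtype) (by
      intro W hW
      apply h1 W
      rintro _ ⟨x, hx, rfl⟩ w hw
      exact hW ⟨x, hx⟩ w hw) (by
      intro h
      exact hnc fun a ha b hb => h ⟨a, ha⟩ ⟨b, hb⟩)
    rw [eq_top_iff, ← h2]
    apply Submodule.span_mono
    rintro _ ⟨x, rfl⟩
    exact ⟨x.1, x.2, rfl⟩
  · exact absurd (fun a ha b hb => comm_of_span _ h1 _ _ ⟨a, ha, rfl⟩ ⟨b, hb, rfl⟩) hnc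

theorem span_rk {n : ℕ} (hn : n.Prime) {H : Subgroup (SL n ℤ)} (hirr : IrreducibleQ H)
    (hsbf : ¬ SolvableByFinite H) (k : Type*) [Field k] [CharZero k] :
    Submodule.span k (Set.range (rk k H)) = ⊤ := by
  have h1 := normal_span hn hirr hsbf (⊤ : Subgroup H)
  have h2 : ∀ X : Matrix (Fin n) (Fin n) ℚ, X.map (algebraMap ℚ k) ∈ Submodule.span k (Set.range (rk k H)) := by
    intro X
    have hX : X ∈ Submodule.span ℚ (rk ℚ H '' ((⊤ : Subgroup H) : Set H)) := by rw [h1]; trivial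
    induction hX using Submodule.span_induction with
    | mem x hx =>
      obtain ⟨g, _, rfl⟩ := hx
      apply Submodule.subset_span
      refine ⟨g, ?_⟩
      ext i j; simp [rk_apply]
    | zero => rw [Matrix.map_zero _ (map_zero _)]; exact Submodule.zero_mem _
    | add a b _ _ ha hb =>
      rw [Matrix.map_add _ (map_add _)]
      exact Submodule.add_mem _ ha hb
    | smul c a _ ha =>
      have : (c • a).map (algebraMap ℚ k) = (algebraMap ℚ k c) • a.map (algebraMap ℚ k) := by
        ext i j; simp
      rw [this]
      exact Submodule.smul_mem _ _ ha
  rw [eq_top_iff]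
  intro X _
  rw [Matrix.matrix_eq_sum_single X]
  refine Submodule.sum_mem _ fun i _ => Submodule.sum_mem _ fun j _ => ?_
  have h3 := Submodule.smul_mem _ (X i j) (h2 (Matrix.single i j 1))
  convert h3 using 1
  ext p q
  simp [Matrix.single_apply]

theorem irr_rk {n : ℕ} (hn : n.Prime) {H : Subgroup (SL n ℤ)} (hirr : IrreducibleQ H)
    (hsbf : ¬ SolvableByFinite H) (k : Type*) [Field k] [CharZero k] :
    ∀ W : Submodule k (Fin n → k), (∀ g, ∀ w ∈ W, rk k H g *ᵥ w ∈ W) → W = ⊥ ∨ W = ⊤ := by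
  intro W hW
  by_cases h0 : W = ⊥
  · exact Or.inl h0
  right
  obtain ⟨v, hv, hv0⟩ := W.ne_bot_iff.1 h0
  have hall : ∀ X : Matrix (Fin n) (Fin n) k, X *ᵥ v ∈ W := by
    intro X
    have hX : X ∈ Submodule.span k (Set.range (rk k H)) := by rw [span_rk hn hirr hsbf]; trivial
    induction hX using Submodule.span_induction with
    | mem x hx => obtain ⟨g, rfl⟩ := hx; exact hW g v hv
    | zero => simp
    | add a b _ _ ha hb => rw [Matrix.add_mulVec]; exact W.add_mem ha hb
    | smul c a _ ha => rw [Matrix.smul_mulVec]; exact W.smul_mem _ ha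
  obtain ⟨i, hi⟩ := Function.ne_iff.1 hv0
  rw [eq_top_iff]
  intro w _
  have := hall (Matrix.of fun p q => if q = i then w p * (v i)⁻¹ else 0)
  convert this using 1
  ext p
  have hi' : v i ≠ 0 := hi
  simp [Matrix.mulVec, dotProduct, hi']
end PieceFm

section PieceFm2
open Matrix

theorem form_char {n : ℕ} (hn : n.Prime) (hodd : Odd n) {H : Subgroup (SL n ℤ)} (hirr : IrreducibleQ H)
    (hsbf : ¬ SolvableByFinite H) (k : Type*) [Field k] [CharZero k]
    (Φ : Matrix (Fin n) (Fin n) k) (hΦ : Φ.det ≠ 0)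
    (hc : ∀ h : H, ∃ c : k, (rk k H h)ᵀ * Φ * rk k H h = c • Φ) :
    ∀ h : H, (rk k H h)ᵀ * Φ * rk k H h = Φ := by
  classical
  haveI : NeZero n := ⟨hn.ne_zero⟩
  choose c hc using hc
  have hΦ0 : Φ ≠ 0 := by rintro rfl; exact hΦ Matrix.det_zero
  have huniq : ∀ a b : k, a • Φ = b • Φ → a = b := fun a b h => smul_left_injective k hΦ0 h
  have hmul : ∀ a b, c (a * b) = c a * c b := by
    intro a b
    apply huniq
    rw [← hc, map_mul, Matrix.transpose_mul]
    calc (rk k H b)ᵀ * (rk k H a)ᵀ * Φ * (rk k H a * rk k H b) = 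
        (rk k H b)ᵀ * ((rk k H a)ᵀ * Φ * rk k H a) * rk k H b := by noncomm_ring
      _ = (c a * c b) • Φ := by
        rw [hc, Matrix.mul_smul, Matrix.smul_mul, hc, smul_smul]
  have hone : c 1 = 1 := by
    apply huniq; rw [← hc]; simp
  let χ : H →* k := { toFun := c, map_one' := hone, map_mul' := hmul }
  have hpow : ∀ h, c h ^ n = 1 := by
    intro h
    have := congrArg Matrix.det (hc h)
    rw [Matrix.det_mul, Matrix.det_mul, Matrix.det_transpose, rk_det, Matrix.det_smul, one_mul, mul_one, Fintype.card_fin] at this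
    exact (mul_right_cancel₀ hΦ (by rw [one_mul]; exact this)).symm
  have htr : ∀ h : H, ((h.1.1.trace : ℤ) : k) = c h * ((h⁻¹.1.1.trace : ℤ) : k) := by
    intro h
    rw [← rk_trace, ← rk_trace]
    have hu : IsUnit Φ.det := isUnit_iff_ne_zero.2 hΦ
    have h1 : (rk k H h)ᵀ = c h • (Φ * rk k H h⁻¹ * Φ⁻¹) := by
      have h2 : (rk k H h)ᵀ * Φ = c h • (Φ * rk k H h⁻¹) := by
        rw [← Matrix.smul_mul, ← hc h, mul_assoc _ (rk k H h), ← map_mul]; simp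
      rw [← Matrix.smul_mul, ← h2, mul_assoc, Matrix.mul_nonsing_inv _ hu, mul_one]
    rw [← Matrix.trace_transpose, h1, Matrix.trace_smul, Matrix.trace_mul_comm, ← mul_assoc, Matrix.nonsing_inv_mul _ hu, one_mul, smul_eq_mul]
  have hne : ∀ h : H, c h ≠ 1 → h.1.1.trace = 0 := by
    intro h h1
    by_contra h2
    have h3 := htr h
    have h5 : h⁻¹.1.1.trace ≠ 0 := by
      intro h4; rw [h4] at h3; simp at h3; exact h2 h3
    have h6 : c h = (((h.1.1.trace : ℚ) / (h⁻¹.1.1.trace : ℚ) : ℚ) : k) := by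
      push_cast
      rw [eq_div_iff (by exact_mod_cast h5)]
      exact h3.symm
    have h7 := hpow h
    rw [h6] at h7 h1
    have h8 : ((h.1.1.trace : ℚ) / (h⁻¹.1.1.trace : ℚ)) ^ n = 1 := by exact_mod_cast h7
    have h9 : ((h.1.1.trace : ℚ) / (h⁻¹.1.1.trace : ℚ)) = 1 := by
      have : ((h.1.1.trace : ℚ) / (h⁻¹.1.1.trace : ℚ)) ^ n = 1 ^ n := by rw [h8, one_pow]
      exact hodd.strictMono_pow.injective this
    apply h1; rw [h9]; simp
  let χu : H →* kˣ := χ.toHomUnits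
  have hχu : ∀ h, (χu h : k) = c h := fun h => rfl
  haveI : χu.ker.FiniteIndex := by
    have hfin : Finite χu.range := by
      have : (χu.range : Set kˣ) ⊆ (rootsOfUnity n k : Set kˣ) := by
        rintro _ ⟨h, rfl⟩
        rw [SetLike.mem_coe, mem_rootsOfUnity']
        rw [hχu]; exact hpow h
      exact (Set.Finite.subset (@Set.toFinite _ _ (inferInstanceAs (Finite (rootsOfUnity n k)))) this)
    exact Subgroup.finiteIndex_ker χu
  have hspan := normal_span hn hirr hsbf χu.ker
  intro h
  rw [hc]
  suffices c h = 1 by rw [this, one_smul]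
  by_contra hh
  have hz : ∀ X : Matrix (Fin n) (Fin n) ℚ, (rk ℚ H h * X).trace = 0 := by
    intro X
    have hX : X ∈ Submodule.span ℚ (rk ℚ H '' (χu.ker : Set H)) := by rw [hspan]; trivial
    induction hX using Submodule.span_induction with
    | mem x hx =>
      obtain ⟨g, hg, rfl⟩ := hx
      rw [← map_mul, rk_trace, hne, Int.cast_zero]
      rw [hmul]
      have : c g = 1 := by
        rw [← hχu, MonoidHom.mem_ker.1 hg]; rfl
      rw [this, mul_one]; exact hh
    | zero => simp
    | add a b _ _ ha hb => rw [mul_add, Matrix.trace_add, ha, hb, add_zero]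
    | smul c a _ ha => rw [Matrix.mul_smul, Matrix.trace_smul, ha, smul_zero]
  have h1 := hz (rk ℚ H h⁻¹)
  rw [← map_mul] at h1
  simp [hn.ne_zero] at h1

theorem form_descend {n : ℕ} (hn : n.Prime) {H : Subgroup (SL n ℤ)} (hirr : IrreducibleQ H)
    (k : Type*) [Field k] [CharZero k]
    (Φ : Matrix (Fin n) (Fin n) k) (hΦ : Φ ≠ 0)
    (hc : ∀ h : H, (rk k H h)ᵀ * Φ * rk k H h = Φ) : IsometryGroupQ H := by
  classical
  haveI : NeZero n := ⟨hn.ne_zero⟩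
  obtain ⟨i, j, hij⟩ : ∃ i j, Φ i j ≠ 0 := by
    by_contra hcon; push Not at hcon; exact hΦ (by ext i j; exact hcon i j)
  obtain ⟨l, hl⟩ := Module.Projective.exists_dual_ne_zero ℚ hij
  let Ψ : Matrix (Fin n) (Fin n) ℚ := Φ.map l
  have hΨ0 : Ψ ≠ 0 := by
    intro h
    exact hl (by simpa [Ψ] using congrFun (congrFun h i) j)
  have hΨ : ∀ h : H, (rk ℚ H h)ᵀ * Ψ * rk ℚ H h = Ψ := by
    intro h
    ext p q
    have h1 := congrArg l (congrFun (congrFun (hc h) p) q)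
    have hcastmul : ∀ (z : ℤ) (x : k), l (x * (z : k)) = l x * (z : ℚ) := by
      intro z x
      rw [mul_comm, ← zsmul_eq_mul, map_zsmul, zsmul_eq_mul, mul_comm]
    have hcastmul' : ∀ (z : ℤ) (x : k), l ((z : k) * x) = (z : ℚ) * l x := by
      intro z x
      rw [← zsmul_eq_mul, map_zsmul, zsmul_eq_mul]
    simp only [Matrix.mul_apply, Matrix.transpose_apply, rk_apply, Matrix.map_apply, map_sum, Int.coe_castRingHom, hcastmul, hcastmul'] at h1
    simp only [Matrix.mul_apply, Matrix.transpose_apply, rk_apply, Matrix.map_apply, Int.coe_castRingHom, Ψ]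
    exact h1
  have hdet : Ψ.det ≠ 0 := by
    intro h0
    have hker := irr_rkQ hirr (LinearMap.ker (Matrix.toLin' Ψ)) (by
      intro g w hw
      rw [LinearMap.mem_ker, Matrix.toLin'_apply] at hw ⊢
      have h2 := hΨ g
      have hu : IsUnit (rk ℚ H g)ᵀ.det := by rw [Matrix.det_transpose, rk_det]; exact isUnit_one
      have h3 : (rk ℚ H g)ᵀ *ᵥ (Ψ *ᵥ (rk ℚ H g *ᵥ w)) = 0 := by
        rw [Matrix.mulVec_mulVec, Matrix.mulVec_mulVec, h2, hw]
      have h4 := congrArg (fun v => (rk ℚ H g)ᵀ⁻¹ *ᵥ v) h3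
      simpa [Matrix.mulVec_mulVec, ← mul_assoc, Matrix.nonsing_inv_mul _ hu] using h4)
    obtain ⟨v, hv0, hv⟩ := Matrix.exists_mulVec_eq_zero_iff.2 h0
    rcases hker with hk | hk
    · have : v ∈ LinearMap.ker (Matrix.toLin' Ψ) := by simpa using hv
      rw [hk] at this
      exact hv0 (by simpa using this)
    · apply hΨ0
      rw [LinearMap.ker_eq_top] at hk
      simpa using hk
  have hu : IsUnit Ψ.det := isUnit_iff_ne_zero.2 hdet
  refine ⟨Ψ⁻¹, ?_, ?_⟩
  · rw [Matrix.isUnit_iff_isUnit_det, Matrix.det_nonsing_inv]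
    exact isUnit_ringInverse.2 hu
  · intro h hh
    have h1 : matQ h = rk ℚ H ⟨h, hh⟩ := rfl
    have h2 := hΨ ⟨h, hh⟩
    rw [← h1] at h2
    have h3 : (matQ h)ᵀ * (Ψ * matQ h * Ψ⁻¹) = 1 := by
      rw [← mul_assoc, ← mul_assoc, h2, Matrix.mul_nonsing_inv _ hu]
    have h4 : Ψ * matQ h * Ψ⁻¹ * (matQ h)ᵀ = 1 := mul_eq_one_comm.1 h3
    calc matQ h * Ψ⁻¹ * (matQ h)ᵀ = (Ψ⁻¹ * Ψ) * matQ h * Ψ⁻¹ * (matQ h)ᵀ := by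
          rw [Matrix.nonsing_inv_mul _ hu, one_mul]
      _ = Ψ⁻¹ * (Ψ * matQ h * Ψ⁻¹ * (matQ h)ᵀ) := by noncomm_ring
      _ = Ψ⁻¹ := by rw [h4, mul_one]

/-- an invariant form of an irreducible `H`-stable set of matrices forces `H` to be an isometry group -/
theorem form_final {n : ℕ} (hn : n.Prime) (hodd : Odd n) {H : Subgroup (SL n ℤ)} (hirr : IrreducibleQ H)
    (hsbf : ¬ SolvableByFinite H) (k : Type*) [Field k] [CharZero k] [IsAlgClosed k]
    (S : Set (Matrix (Fin n) (Fin n) k))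
    (hS : ∀ g, ∀ x ∈ S, rk k H g * x * rk k H g⁻¹ ∈ S)
    (hSirr : ∀ W : Submodule k (Fin n → k), (∀ x ∈ S, ∀ w ∈ W, x *ᵥ w ∈ W) → W = ⊥ ∨ W = ⊤)
    (Φ : Matrix (Fin n) (Fin n) k) (hΦ : Φ.det ≠ 0) (hinv : ∀ x ∈ S, xᵀ * Φ + Φ * x = 0) : IsometryGroupQ H := by
  haveI : NeZero n := ⟨hn.ne_zero⟩
  have hu : IsUnit Φ.det := isUnit_iff_ne_zero.2 hΦ
  have hΦ0 : Φ ≠ 0 := by rintro rfl; exact hΦ Matrix.det_zero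
  refine form_descend hn hirr k Φ hΦ0 (form_char hn hodd hirr hsbf k Φ hΦ ?_)
  intro h
  set r := rk k H h with hr
  set r' := rk k H h⁻¹ with hr'
  have hrr : r * r' = 1 := by rw [hr, hr', ← map_mul]; simp
  have hrr' : r' * r = 1 := by rw [hr, hr', ← map_mul]; simp
  have hΨ : ∀ x ∈ S, xᵀ * (rᵀ * Φ * r) + (rᵀ * Φ * r) * x = 0 := by
    intro x hx
    have h1 := hinv _ (hS h x hx)
    rw [← hr, ← hr'] at h1
    have h2 : (r * x * r')ᵀ = r'ᵀ * xᵀ * rᵀ := by simp [Matrix.transpose_mul, mul_assoc]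
    rw [h2] at h1
    have h3 : rᵀ * r'ᵀ = 1 := by rw [← Matrix.transpose_mul, hrr', Matrix.transpose_one]
    calc xᵀ * (rᵀ * Φ * r) + (rᵀ * Φ * r) * x = (rᵀ * r'ᵀ) * xᵀ * rᵀ * Φ * r + (rᵀ * Φ * r) * x * (r' * r) := by
          rw [h3, hrr']; noncomm_ring
      _ = rᵀ * (r'ᵀ * xᵀ * rᵀ * Φ + Φ * (r * x * r')) * r := by noncomm_ring
      _ = 0 := by rw [h1]; simp
  set Z := Φ⁻¹ * (rᵀ * Φ * r) with hZ
  have hΦZ : Φ * Z = rᵀ * Φ * r := by rw [hZ, ← mul_assoc, Matrix.mul_nonsing_inv _ hu, one_mul]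
  have hcomm : ∀ x ∈ S, x * Z = Z * x := by
    intro x hx
    have h1 := hΨ x hx
    have h2 := hinv x hx
    rw [← hΦZ] at h1
    have h3 : Φ * (x * Z) = Φ * (Z * x) := by
      have h4 := congrArg (fun M => M * Z) h2
      simp only [add_mul, zero_mul, mul_assoc] at h4
      have h5 := sub_eq_zero.2 (h4.trans h1.symm)
      simp only [mul_assoc] at h5
      rw [← sub_eq_zero, ← h5]; abel
    have h4 := congrArg (fun M => Φ⁻¹ * M) h3
    simpa [← mul_assoc, Matrix.nonsing_inv_mul _ hu] using h4
  obtain ⟨c, hc⟩ := Module.End.exists_eigenvalue (Matrix.toLin' Z)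
  have htop := (hSirr (Module.End.eigenspace (Matrix.toLin' Z) c) (by
    intro x hx w hw
    rw [Module.End.mem_eigenspace_iff, Matrix.toLin'_apply] at hw ⊢
    rw [Matrix.mulVec_mulVec, ← hcomm x hx, ← Matrix.mulVec_mulVec, hw, Matrix.mulVec_smul])).resolve_left hc
  refine ⟨c, ?_⟩
  have hZc : Z = c • 1 := by
    apply Matrix.mulVec_injective
    funext v
    have : v ∈ Module.End.eigenspace (Matrix.toLin' Z) c := by rw [htop]; trivial
    rw [Module.End.mem_eigenspace_iff, Matrix.toLin'_apply] at this
    rw [this, Matrix.smul_mulVec, Matrix.one_mulVec]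
  rw [← hΦZ, hZc]; simp
end PieceFm2

section PieceJo1
open Matrix

section Jo1
open scoped Matrix.Norms.L2Operator

theorem comm_norm {n : ℕ} {A B : Matrix (Fin n) (Fin n) ℂ} :
    ‖A * B - B * A‖ ≤ 2 * ‖A - 1‖ * ‖B - 1‖ := by
  have h : A * B - B * A = (A - 1) * (B - 1) - (B - 1) * (A - 1) := by noncomm_ring
  rw [h]
  calc _ ≤ ‖(A - 1) * (B - 1)‖ + ‖(B - 1) * (A - 1)‖ := norm_sub_le _ _
    _ ≤ ‖A - 1‖ * ‖B - 1‖ + ‖B - 1‖ * ‖A - 1‖ := add_le_add (norm_mul_le _ _) (norm_mul_le _ _)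
    _ = _ := by ring

theorem idem_small {n : ℕ} {E : Matrix (Fin n) (Fin n) ℂ} (hE : E * E = E) (h : ‖E‖ < 1) : E = 0 := by
  have h1 : ‖E‖ ≤ ‖E‖ * ‖E‖ := by
    calc ‖E‖ = ‖E * E‖ := by rw [hE]
      _ ≤ _ := norm_mul_le _ _
  by_contra h0
  have : 0 < ‖E‖ := norm_pos_iff.2 h0
  nlinarith

theorem pow_close {n : ℕ} {C : Matrix (Fin n) (Fin n) ℂ} {m : ℕ} (hm : 0 < m) (hC : C ^ m = 1) {δ : ℝ} (hδ : δ < 1)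
    (h : ∀ j : ℕ, ‖C ^ j - 1‖ ≤ δ) : C = 1 := by
  set E : Matrix (Fin n) (Fin n) ℂ := (m : ℂ)⁻¹ • ∑ j ∈ Finset.range m, C ^ j with hE
  have hm0 : (m : ℂ) ≠ 0 := by exact_mod_cast hm.ne'
  have hCE : C * E = E := by
    rw [hE, Matrix.mul_smul, Finset.mul_sum]
    congr 1
    have h1 := Finset.sum_range_succ (fun j => C ^ j) m
    have h2 := Finset.sum_range_succ' (fun j => C ^ j) m
    rw [h1] at h2
    simp only [hC, pow_zero] at h2
    have h3 := add_right_cancel h2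
    rw [h3]
    exact Finset.sum_congr rfl fun j _ => (pow_succ' C j).symm
  have hCjE : ∀ j : ℕ, C ^ j * E = E := by
    intro j
    induction j with
    | zero => simp
    | succ j ih => rw [pow_succ, mul_assoc, hCE, ih]
  have hEE : E * E = E := by
    conv_lhs => rw [hE]
    rw [Matrix.smul_mul, Finset.sum_mul]
    simp only [← hE, hCjE, Finset.sum_const, Finset.card_range]
    rw [← Nat.cast_smul_eq_nsmul ℂ, smul_smul, inv_mul_cancel₀ hm0, one_smul]
  have hF : (1 - E) * (1 - E) = 1 - E := by
    have : (1 - E) * (1 - E) = 1 - E - E + E * E := by noncomm_ring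
    rw [this, hEE]; abel
  have hn : ‖1 - E‖ ≤ δ := by
    have h1 : 1 - E = (m : ℂ)⁻¹ • ∑ j ∈ Finset.range m, (1 - C ^ j) := by
      rw [Finset.sum_sub_distrib, smul_sub, ← hE]
      simp only [Finset.sum_const, Finset.card_range]
      rw [← Nat.cast_smul_eq_nsmul ℂ, smul_smul, inv_mul_cancel₀ hm0, one_smul]
    rw [h1, norm_smul, norm_inv, Complex.norm_natCast]
    have h2 : ‖∑ j ∈ Finset.range m, (1 - C ^ j)‖ ≤ m * δ := by
      refine (norm_sum_le _ _).trans ?_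
      calc _ ≤ ∑ j ∈ Finset.range m, δ := Finset.sum_le_sum fun j _ => by rw [norm_sub_rev]; exact h j
        _ = m * δ := by simp
    have hm' : (0:ℝ) < m := by exact_mod_cast hm
    rw [inv_mul_le_iff₀ hm']
    exact h2
  have := idem_small hF (lt_of_le_of_lt hn hδ)
  have hE1 : E = 1 := (sub_eq_zero.1 this).symm
  rw [hE1, mul_one] at hCE
  exact hCE

theorem norm_unit_le {n : ℕ} {U : Matrix (Fin n) (Fin n) ℂ} (h : U ∈ Matrix.unitaryGroup (Fin n) ℂ) : ‖U‖ ≤ 1 := by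
  have h1 : ‖star U * U‖ = ‖U‖ * ‖U‖ := CStarRing.norm_star_mul_self
  rw [(Unitary.mem_iff.1 h).1] at h1
  have h2 : ‖(1 : Matrix (Fin n) (Fin n) ℂ)‖ ≤ 1 := by
    have h3 : ‖star (1 : Matrix (Fin n) (Fin n) ℂ) * 1‖ = ‖(1 : Matrix (Fin n) (Fin n) ℂ)‖ * ‖(1 : Matrix (Fin n) (Fin n) ℂ)‖ := CStarRing.norm_star_mul_self
    rw [star_one, mul_one] at h3
    by_contra hc
    push Not at hc
    nlinarith
  by_contra hc
  push Not at hc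
  nlinarith

theorem unit_conj_norm {n : ℕ} {U V X : Matrix (Fin n) (Fin n) ℂ} (h : U ∈ Matrix.unitaryGroup (Fin n) ℂ)
    (h' : V ∈ Matrix.unitaryGroup (Fin n) ℂ) : ‖U * X * V‖ ≤ ‖X‖ := by
  calc ‖U * X * V‖ ≤ ‖U‖ * ‖X‖ * ‖V‖ := (norm_mul_le _ _).trans (mul_le_mul_of_nonneg_right (norm_mul_le _ _) (norm_nonneg _))
    _ ≤ 1 * ‖X‖ * 1 := by
      gcongr
      · exact norm_unit_le h
      · exact norm_unit_le h'
    _ = ‖X‖ := by ring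

theorem close_comm {n : ℕ} {G : Type*} [Group G] [Finite G] (f : G →* Matrix (Fin n) (Fin n) ℂ)
    (hf : Function.Injective f) (hu : ∀ g, f g ∈ Matrix.unitaryGroup (Fin n) ℂ) (a b : G)
    (ha : ‖f a - 1‖ ≤ 1/5) (hb : ‖f b - 1‖ ≤ 1/5) : a * b = b * a := by
  by_contra hab
  let T : Set G := {x | ‖f x - 1‖ ≤ 1/5 ∧ a * x ≠ x * a}
  obtain ⟨b, ⟨hb, hab⟩, hmin⟩ := Set.exists_min_image T (fun x => ‖f x - 1‖) (Set.toFinite _) ⟨b, hb, hab⟩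
  set c := a * b * a⁻¹ * b⁻¹ with hc
  have hc1 : c ≠ 1 := by
    intro h
    apply hab
    have : a * b = c * (b * a) := by rw [hc]; group
    rw [this, h, one_mul]
  have hb1 : b ≠ 1 := by rintro rfl; exact hab (by simp)
  have hbpos : 0 < ‖f b - 1‖ := by
    rw [norm_pos_iff, sub_ne_zero]
    intro h; exact hb1 (hf (by rw [h, map_one]))
  have hcn : ‖f c - 1‖ ≤ 2 * ‖f a - 1‖ * ‖f b - 1‖ := by
    have h1 : f c - 1 = 1 * (f a * f b - f b * f a) * f (b * a)⁻¹ := by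
      rw [one_mul, sub_mul, ← map_mul, ← map_mul, ← map_mul, ← map_mul, hc]
      have : b * a * (b * a)⁻¹ = 1 := by group
      rw [this, map_one]
      congr 2; group
    rw [h1]
    exact (unit_conj_norm (one_mem _) (hu _)).trans comm_norm
  have hclt : ‖f c - 1‖ < ‖f b - 1‖ := by nlinarith
  have hac : a * c = c * a := by
    by_contra h
    exact absurd (hmin c ⟨by linarith, h⟩) (not_le.2 hclt)
  have hpow : ∀ j : ℕ, c ^ j = a ^ j * b * (a ^ j)⁻¹ * b⁻¹ := by
    intro j
    have hacj : ∀ j : ℕ, a * c ^ j = c ^ j * a := fun j => (Commute.pow_right hac j)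
    induction j with
    | zero => simp
    | succ j ih =>
      have h2 : a ^ j * b * (a ^ j)⁻¹ = c ^ j * b := by rw [ih]; group
      calc c ^ (j+1) = c ^ j * c := pow_succ _ _
        _ = c ^ j * a * b * a⁻¹ * b⁻¹ := by rw [hc]; group
        _ = a * (c ^ j * b) * a⁻¹ * b⁻¹ := by rw [← hacj j]; group
        _ = a * (a ^ j * b * (a ^ j)⁻¹) * a⁻¹ * b⁻¹ := by rw [h2]
        _ = a ^ (j+1) * b * (a ^ (j+1))⁻¹ * b⁻¹ := by rw [pow_succ' a j]; group
  apply hc1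
  apply hf
  rw [map_one]
  refine pow_close (m := Nat.card G) Nat.card_pos (by rw [← map_pow, pow_card_eq_one', map_one]) (δ := 2/5) (by norm_num) ?_
  intro j
  have h1 : f c ^ j - 1 = 1 * (f (a ^ j) * (f b - 1) * f (a^j)⁻¹ - (f b - 1)) * f b⁻¹ := by
    rw [← map_pow, hpow j]
    simp only [mul_sub, sub_mul, mul_one, one_mul, ← map_mul]
    simp
  rw [h1]
  refine (unit_conj_norm (one_mem _) (hu _)).trans ?_
  refine (norm_sub_le _ _).trans ?_
  have := unit_conj_norm (X := f b - 1) (hu (a^j)) (hu (a^j)⁻¹)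
  linarith

theorem jordan_unitary (n : ℕ) : ∃ m : ℕ, ∀ (G : Type) [Group G] [Finite G] (f : G →* Matrix (Fin n) (Fin n) ℂ),
    Function.Injective f → (∀ g, f g ∈ Matrix.unitaryGroup (Fin n) ℂ) →
    ∃ A : Subgroup G, (∀ a ∈ A, ∀ b ∈ A, a * b = b * a) ∧ ∀ g : Fin (m+1) → G, ∃ i j, i ≠ j ∧ (g i)⁻¹ * g j ∈ A := by
  classical
  haveI : ProperSpace (Matrix (Fin n) (Fin n) ℂ) := FiniteDimensional.proper ℂ _
  have htb := (isCompact_closedBall (0 : Matrix (Fin n) (Fin n) ℂ) 1).totallyBounded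
  obtain ⟨t, htf, ht⟩ := Metric.totallyBounded_iff.1 htb (1/10) (by norm_num)
  refine ⟨htf.toFinset.card, ?_⟩
  intro G _ _ f hf hu
  refine ⟨Subgroup.closure {x | ‖f x - 1‖ ≤ 1/5}, ?_, ?_⟩
  · have := Subgroup.isMulCommutative_closure (k := {x : G | ‖f x - 1‖ ≤ 1/5}) (fun a ha b hb => close_comm f hf hu a b ha hb)
    intro a ha b hb
    exact congrArg Subtype.val (this.is_comm.comm ⟨a, ha⟩ ⟨b, hb⟩)
  · intro g
    have hmem : ∀ i, ∃ y ∈ t, dist (f (g i)) y < 1/10 := by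
      intro i
      have h1 : f (g i) ∈ Metric.closedBall (0 : Matrix (Fin n) (Fin n) ℂ) 1 := by
        rw [mem_closedBall_zero_iff]; exact norm_unit_le (hu _)
      have := ht h1
      simpa using this
    choose y hy hyd using hmem
    obtain ⟨i, -, j, -, hij, heq⟩ := Finset.exists_ne_map_eq_of_card_lt_of_maps_to (s := (Finset.univ : Finset (Fin (htf.toFinset.card + 1)))) (t := htf.toFinset) (by simp) (f := y) (fun i _ => by simpa using hy i)
    refine ⟨i, j, hij, Subgroup.subset_closure ?_⟩
    have h1 : f ((g i)⁻¹ * g j) - 1 = f (g i)⁻¹ * (f (g j) - f (g i)) * 1 := by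
      rw [mul_one, mul_sub, ← map_mul, ← map_mul]; simp
    change ‖_‖ ≤ _
    rw [h1]
    refine (unit_conj_norm (hu _) (one_mem _)).trans ?_
    rw [← dist_eq_norm]
    have h2 := dist_triangle_right (f (g j)) (f (g i)) (y i)
    have h3 := hyd i
    have h4 := hyd j
    rw [← heq] at h4
    linarith
end Jo1
end PieceJo1

section PieceJo2
open Matrix

section Jo2
open scoped ComplexOrder MatrixOrder Matrix.Norms.L2Operator in
theorem posdef_sqrt (n:ℕ) (P : Matrix (Fin n) (Fin n) ℂ) (hpd : P.PosDef) : ∃ Q : Matrix (Fin n) (Fin n) ℂ, IsUnit Q ∧ P = Qᴴ * Q := by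
  obtain ⟨Q, hQ⟩ := CStarAlgebra.nonneg_iff_eq_star_mul_self.1 (Matrix.nonneg_iff_posSemidef.2 hpd.posSemidef)
  refine ⟨Q, ?_, hQ⟩
  have := hpd.isUnit
  rw [Matrix.isUnit_iff_isUnit_det] at this ⊢
  rw [hQ, Matrix.det_mul] at this
  exact isUnit_of_mul_isUnit_right this

theorem closure_equiv (p : ℕ) [Fact p.Prime] : Nonempty (AlgebraicClosure ℚ_[p] ≃+* ℂ) := by
  have h1 : Cardinal.mk ℚ_[p] = Cardinal.continuum := by
    apply le_antisymm
    · calc Cardinal.mk ℚ_[p] ≤ Cardinal.mk (CauSeq ℚ (padicNorm p)) := Cardinal.mk_quotient_le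
        _ ≤ Cardinal.mk (ℕ → ℚ) := Cardinal.mk_subtype_le _
        _ = _ := by simp
    · exact continuum_le_cardinal_of_nontriviallyNormedField ℚ_[p]
  have h2 : Cardinal.mk (AlgebraicClosure ℚ_[p]) = Cardinal.continuum := by
    apply le_antisymm
    · refine (Algebra.IsAlgebraic.cardinalMk_le_max ℚ_[p] _).trans ?_
      rw [h1]; simp [Cardinal.aleph0_le_continuum]
    · rw [← h1]
      exact Cardinal.mk_le_of_injective (algebraMap ℚ_[p] (AlgebraicClosure ℚ_[p])).injective
  refine IsAlgClosed.ringEquiv_of_equiv_of_charZero ?_ ?_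
  · rw [h2]; exact Cardinal.aleph0_lt_continuum
  · apply Cardinal.eq.1
    rw [h2, Cardinal.mk_complex]

open scoped ComplexOrder in
theorem jordan (n : ℕ) : ∃ m : ℕ, ∀ (G : Type) [Group G] [Finite G] (f : G →* Matrix (Fin n) (Fin n) ℂ),
    Function.Injective f →
    ∃ A : Subgroup G, (∀ a ∈ A, ∀ b ∈ A, a * b = b * a) ∧ ∀ g : Fin (m+1) → G, ∃ i j, i ≠ j ∧ (g i)⁻¹ * g j ∈ A := by
  classical
  obtain ⟨m, hm⟩ := jordan_unitary n
  refine ⟨m, ?_⟩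
  intro G _ _ f hf
  haveI := Fintype.ofFinite G
  set P : Matrix (Fin n) (Fin n) ℂ := ∑ g, (f g)ᴴ * f g with hP
  have hinv : ∀ g, (f g)ᴴ * P * f g = P := by
    intro g
    rw [hP, Finset.mul_sum, Finset.sum_mul]
    refine Fintype.sum_equiv (Equiv.mulRight g) _ _ (fun x => ?_)
    simp [Matrix.conjTranspose_mul, Matrix.mul_assoc]
  have hpd : P.PosDef := by
    rw [hP, ← Finset.add_sum_erase _ _ (Finset.mem_univ (1:G))]
    refine Matrix.PosDef.add_posSemidef ?_ ?_
    · simp; exact Matrix.PosDef.one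
    · exact Matrix.posSemidef_sum _ (fun i _ => Matrix.posSemidef_conjTranspose_mul_self _)
  obtain ⟨Q, hQu, hQ⟩ : ∃ Q : Matrix (Fin n) (Fin n) ℂ, IsUnit Q ∧ P = Qᴴ * Q := posdef_sqrt n P hpd
  obtain ⟨u, rfl⟩ := hQu
  let f' : G →* Matrix (Fin n) (Fin n) ℂ :=
    { toFun := fun g => u.1 * f g * u⁻¹.1
      map_one' := by simp
      map_mul' := by
        intro a b
        rw [map_mul]
        simp only [mul_assoc]
        rw [Units.inv_mul_cancel_left] }
  refine hm G f' ?_ ?_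
  · intro a b h
    have : u.1 * f a * u⁻¹.1 = u.1 * f b * u⁻¹.1 := h
    apply hf
    exact (Units.mul_right_inj u).1 ((Units.mul_left_inj u⁻¹).1 this)
  · intro g
    rw [Matrix.mem_unitaryGroup_iff', Matrix.star_eq_conjTranspose]
    change (u.1 * f g * u⁻¹.1)ᴴ * (u.1 * f g * u⁻¹.1) = 1
    have h1 := hinv g
    rw [hQ] at h1
    have h2 : (u⁻¹.1)ᴴ * ((u.1)ᴴ) = 1 := by
      rw [← Matrix.conjTranspose_mul]; simp
    calc _ = (u⁻¹.1)ᴴ * ((f g)ᴴ * ((u.1)ᴴ * u.1) * f g) * u⁻¹.1 := by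
          simp only [Matrix.conjTranspose_mul, Matrix.mul_assoc]
      _ = ((u⁻¹.1)ᴴ * (u.1)ᴴ) * (u.1 * u⁻¹.1) := by rw [h1]; simp only [Matrix.mul_assoc]
      _ = 1 := by rw [h2]; simp

theorem avg_hom {R A G : Type*} [CommRing R] [Ring A] [Algebra R A] [Group G] [Fintype G] (c q : R)
    (hc : c * (Fintype.card G : R) = 1) (f v : G → A) (E : G → G → A) (hv : ∀ g, f g * v g = 1) (hv' : ∀ g, v g * f g = 1)
    (hf : ∀ a b, f a * f b = f (a * b) + q • E a b) :
    ∃ (f' : G → A) (D : G → A) (E' : G → G → A), (∀ g, f' g = f g + q • D g) ∧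
      ∀ a b, f' a * f' b = f' (a * b) + (q * q) • E' a b := by
  have hx : ∀ g h, f (g * h) * v h = f g + q • (- (E g h * v h)) := by
    intro g h
    have := hf g h
    have h2 : f (g * h) = f g * f h - q • E g h := by rw [this]; abel
    rw [h2, sub_mul, mul_assoc, hv, mul_one, smul_mul_assoc, smul_neg, sub_eq_add_neg]
  have hcs : ∀ x : A, c • ∑ h : G, x = x := by
    intro x
    rw [Finset.sum_const, Finset.card_univ, ← Nat.cast_smul_eq_nsmul R, smul_smul, hc, one_smul]
  set X : G → G → A := fun g h => - (E g h * v h) with hX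
  have key : ∀ g, c • ∑ h, f (g * h) * v h = f g + q • (c • ∑ h, X g h) := by
    intro g
    simp only [hx, Finset.sum_add_distrib, smul_add, hcs]
    rw [← Finset.smul_sum, smul_comm]
  refine ⟨fun g => c • ∑ h, f (g * h) * v h, fun g => c • ∑ h, X g h,
    fun a b => (c • ∑ h, X a (b * h)) * (c • ∑ h, X b h) - c • ∑ h, X a (b * h) * X b h, key, ?_⟩
  intro a b
  have h1 : c • ∑ h, f (a * h) * v h = f a + q • (c • ∑ h, X a (b * h)) := by
    rw [key a]
    congr 3
    exact (Fintype.sum_equiv (Equiv.mulLeft b) _ _ (fun _ => rfl)).symm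
  have h2 : c • ∑ h, f (a * b * h) * v h = f a * f b + q • (f a * (c • ∑ h, X b h)) + q • ((c • ∑ h, X a (b * h)) * f b)
      + (q * q) • (c • ∑ h, X a (b * h) * X b h) := by
    have h3 : ∀ h, f (a * b * h) * v h = f a * f b + q • (f a * X b h) + q • (X a (b * h) * f b) + (q*q) • (X a (b * h) * X b h) := by
      intro h
      have e1 := hx a (b * h)
      have e2 := hx b h
      have : f (a * b * h) * v h = (f (a * (b * h)) * v (b * h)) * (f (b * h) * v h) := by
        rw [mul_assoc (f (a * (b * h))), ← mul_assoc (v (b * h)), hv', one_mul, mul_assoc a b h]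
      rw [this, e1, e2]
      simp only [mul_add, add_mul, smul_mul_assoc, mul_smul_comm, smul_add, smul_smul, hX]
      abel
    simp only [h3, Finset.sum_add_distrib, smul_add, hcs]
    simp only [← Finset.smul_sum, ← Finset.mul_sum, ← Finset.sum_mul, mul_smul_comm, smul_mul_assoc]
    rw [smul_comm c q, smul_comm c q, smul_comm c (q * q)]
  beta_reduce
  rw [h2, h1, key b]
  simp only [mul_add, add_mul, smul_mul_assoc, mul_smul_comm, smul_sub, smul_add, smul_smul]
  module

theorem lift_hom (p : ℕ) [Fact p.Prime] {n : ℕ} (G : Type) [Group G] [Fintype G] (hp : ¬ p ∣ Fintype.card G)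
    (ι : G →* Matrix (Fin n) (Fin n) (ZMod p)) (hdet : ∀ g, (ι g).det = 1) :
    ∃ f : G →* Matrix (Fin n) (Fin n) ℤ_[p], ∀ g, (f g).map (PadicInt.toZMod (p := p)) = ι g := by
  classical
  have hsurj : Function.Surjective (PadicInt.toZMod (p := p)) := by
    intro x
    exact ⟨(x.val : ℤ_[p]), by simp⟩
  have hker : ∀ x : ℤ_[p], PadicInt.toZMod x = 0 ↔ ‖x‖ ≤ (p:ℝ) ^ (-((1:ℕ):ℤ)) := by
    intro x
    rw [PadicInt.norm_le_pow_iff_mem_span_pow, ← RingHom.mem_ker, PadicInt.ker_toZMod, PadicInt.maximalIdeal_eq_span_p, pow_one]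
  choose s hs using hsurj
  let f0 : G → Matrix (Fin n) (Fin n) ℤ_[p] := fun g => (ι g).map s
  let F : ℕ → Set (G → Matrix (Fin n) (Fin n) ℤ_[p]) := fun k =>
    {f | (∀ g i j, ‖f g i j - f0 g i j‖ ≤ (p:ℝ) ^ (-((1:ℕ):ℤ))) ∧ ∀ a b i j, ‖(f a * f b) i j - f (a * b) i j‖ ≤ (p:ℝ) ^ (-((k+1:ℕ):ℤ))}
  have hred : ∀ f : G → Matrix (Fin n) (Fin n) ℤ_[p], (∀ g i j, ‖f g i j - f0 g i j‖ ≤ (p:ℝ) ^ (-((1:ℕ):ℤ))) ↔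
      ∀ g, (f g).map (PadicInt.toZMod (p := p)) = ι g := by
    intro f
    constructor
    · intro h g
      ext i j
      have := (hker _).2 (h g i j)
      rw [map_sub, sub_eq_zero] at this
      simp only [Matrix.map_apply, this, f0, hs]
    · intro h g i j
      rw [← hker, map_sub, sub_eq_zero]
      have := congrFun (congrFun (h g) i) j
      simp only [Matrix.map_apply] at this
      rw [this]; simp only [Matrix.map_apply, f0, hs]
  have hdiv : ∀ (k : ℕ) (M : Matrix (Fin n) (Fin n) ℤ_[p]), (∀ i j, ‖M i j‖ ≤ (p:ℝ) ^ (-((k:ℕ):ℤ))) ↔ ∃ E, M = ((p:ℤ_[p])^k) • E := by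
    intro k M
    constructor
    · intro h
      have : ∀ i j, ∃ e, M i j = (p:ℤ_[p])^k * e := by
        intro i j
        have := h i j
        rw [PadicInt.norm_le_pow_iff_mem_span_pow, Ideal.mem_span_singleton] at this
        exact this
      choose e he using this
      exact ⟨Matrix.of e, by ext i j : 1; simp [he]⟩
    · rintro ⟨E, rfl⟩ i j
      rw [PadicInt.norm_le_pow_iff_mem_span_pow, Ideal.mem_span_singleton]
      exact ⟨E i j, rfl⟩
  have hpp : (1:ℝ) ≤ p := by exact_mod_cast (Fact.out : p.Prime).one_le
  have hunit : ∀ f : G → Matrix (Fin n) (Fin n) ℤ_[p], (∀ g, (f g).map (PadicInt.toZMod (p := p)) = ι g) → ∀ g, IsUnit (f g).det := by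
    intro f hm g
    have : PadicInt.toZMod (f g).det = 1 := by
      rw [RingHom.map_det, RingHom.mapMatrix_apply, hm, hdet]
    by_contra hcon
    have h2 : (f g).det ∈ RingHom.ker (PadicInt.toZMod (p := p)) := by
      rw [PadicInt.ker_toZMod]; exact (IsLocalRing.mem_maximalIdeal _).2 hcon
    rw [RingHom.mem_ker, this] at h2
    exact one_ne_zero h2
  haveI : CompactSpace (Matrix (Fin n) (Fin n) ℤ_[p]) := inferInstanceAs (CompactSpace (Fin n → Fin n → ℤ_[p]))
  have hcl : ∀ k, IsClosed (F k) := by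
    intro k
    have hev : ∀ g i j, Continuous (fun f : G → Matrix (Fin n) (Fin n) ℤ_[p] => f g i j) := fun g i j => by fun_prop
    have hFk : F k = {f : G → Matrix (Fin n) (Fin n) ℤ_[p] | ∀ g i j, ‖f g i j - f0 g i j‖ ≤ (p:ℝ) ^ (-((1:ℕ):ℤ))} ∩
      {f | ∀ a b i j, ‖(f a * f b) i j - f (a * b) i j‖ ≤ (p:ℝ) ^ (-((k+1:ℕ):ℤ))} := rfl
    rw [hFk]
    refine IsClosed.inter ?_ ?_
    · simp only [Set.setOf_forall]
      refine isClosed_iInter fun g => isClosed_iInter fun i => isClosed_iInter fun j => ?_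
      exact isClosed_le (((hev g i j).sub continuous_const).norm) continuous_const
    · simp only [Set.setOf_forall]
      refine isClosed_iInter fun a => isClosed_iInter fun b => isClosed_iInter fun i => isClosed_iInter fun j => ?_
      refine isClosed_le (Continuous.norm (Continuous.sub ?_ (hev _ i j))) continuous_const
      simp only [Matrix.mul_apply]
      exact continuous_finset_sum _ (fun l _ => (hev a i l).mul (hev b l j))
  have hne : (⋂ k, F k).Nonempty := by
    apply IsCompact.nonempty_iInter_of_sequence_nonempty_isCompact_isClosed
    · rintro k f ⟨h1, h2⟩
      refine ⟨h1, fun a b i j => (h2 a b i j).trans ?_⟩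
      exact zpow_le_zpow_right₀ hpp (by push_cast; linarith)
    · intro k
      induction k with
      | zero =>
        refine ⟨f0, ?_, ?_⟩
        · intro g i j; simp only [sub_self, norm_zero]; positivity
        · have h0 : ∀ g, (f0 g).map (PadicInt.toZMod (p := p)) = ι g := (hred f0).1 (by intro g i j; simp only [sub_self, norm_zero]; positivity)
          intro a b i j
          rw [zero_add, ← hker, map_sub, sub_eq_zero]
          have : (f0 a * f0 b).map (PadicInt.toZMod (p := p)) = (f0 (a * b)).map (PadicInt.toZMod (p := p)) := by
            rw [Matrix.map_mul, h0, h0, h0, map_mul]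
          exact congrFun (congrFun this i) j
      | succ k ih =>
        obtain ⟨f, hf1, hf2⟩ := ih
        have hm := (hred f).1 hf1
        have hu := hunit f hm
        have hE : ∀ a b, ∃ E, f a * f b - f (a * b) = ((p:ℤ_[p])^(k+1)) • E := fun a b => (hdiv (k+1) _).1 (fun i j => hf2 a b i j)
        choose E hE using hE
        have hcu : IsUnit ((Fintype.card G : ℕ) : ℤ_[p]) := by
          rw [PadicInt.isUnit_iff]
          by_contra hcon
          have : ‖((Fintype.card G : ℤ) : ℤ_[p])‖ < 1 := lt_of_le_of_ne (PadicInt.norm_le_one _) (by simpa using hcon)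
          rw [PadicInt.norm_int_lt_one_iff_dvd] at this
          exact hp (by exact_mod_cast this)
        obtain ⟨c, hc⟩ := hcu.exists_left_inv
        obtain ⟨f', D, E', h1, h2⟩ := avg_hom c ((p:ℤ_[p])^(k+1)) hc f (fun g => (f g)⁻¹) E (fun g => Matrix.mul_nonsing_inv _ (hu g)) (fun g => Matrix.nonsing_inv_mul _ (hu g)) (fun a b => by rw [← hE]; abel)
        refine ⟨f', ?_, ?_⟩
        · rw [hred]
          intro g
          rw [h1, ← hm g]
          ext i j
          simp [pow_succ]
        · intro a b
          have := (hdiv (k+1+1) (f' a * f' b - f' (a * b))).2 ⟨(p:ℤ_[p])^k • E' a b, by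
            rw [h2, smul_smul]; ring_nf; rw [add_sub_cancel_left]⟩
          exact this
    · exact (hcl 0).isCompact
    · exact hcl
  obtain ⟨f, hf⟩ := hne
  rw [Set.mem_iInter] at hf
  have hm := (hred f).1 (hf 0).1
  have hmul : ∀ a b, f (a * b) = f a * f b := by
    intro a b
    ext i j : 2
    by_contra hcon
    have h0 : 0 < ‖(f a * f b) i j - f (a * b) i j‖ := by
      rw [norm_pos_iff, sub_ne_zero]; exact fun h => hcon h.symm
    obtain ⟨k, hk⟩ := PadicInt.exists_pow_neg_lt p h0
    have h1 := (hf k).2 a b i j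
    have h2 : (p:ℝ) ^ (-((k+1:ℕ):ℤ)) ≤ (p:ℝ) ^ (-((k:ℕ):ℤ)) := zpow_le_zpow_right₀ hpp (by push_cast; linarith)
    linarith
  have hone : f 1 = 1 := by
    have hu : IsUnit (f 1) := (Matrix.isUnit_iff_isUnit_det _).2 (hunit f hm 1)
    have := hmul 1 1
    rw [mul_one] at this
    exact (hu.mul_right_inj.1 (this.symm.trans (mul_one _).symm))
  exact ⟨{ toFun := f, map_one' := hone, map_mul' := hmul }, hm⟩

theorem jordan_modp (n : ℕ) : ∃ m : ℕ, ∀ (p : ℕ) [Fact p.Prime] (G : Subgroup (SpecialLinearGroup (Fin n) (ZMod p))),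
    ¬ p ∣ Nat.card G →
    ∃ A : Subgroup G, (∀ a ∈ A, ∀ b ∈ A, a * b = b * a) ∧ ∀ g : Fin (m+1) → G, ∃ i j, i ≠ j ∧ (g i)⁻¹ * g j ∈ A := by
  classical
  obtain ⟨m, hm⟩ := jordan n
  refine ⟨m, ?_⟩
  intro p _ G hp
  haveI : Finite (SpecialLinearGroup (Fin n) (ZMod p)) := inferInstance
  haveI := Fintype.ofFinite G
  rw [Nat.card_eq_fintype_card] at hp
  obtain ⟨f, hf⟩ := lift_hom p G hp 
    ({ toFun := fun g => g.1.1, map_one' := rfl, map_mul' := fun _ _ => rfl } : G →* Matrix (Fin n) (Fin n) (ZMod p)) (fun g => g.1.2)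
  obtain ⟨e⟩ := closure_equiv p
  let φ : ℤ_[p] →+* ℂ := e.toRingHom.comp ((algebraMap ℚ_[p] (AlgebraicClosure ℚ_[p])).comp PadicInt.Coe.ringHom)
  have hφ : Function.Injective φ := by
    refine e.injective.comp ((algebraMap ℚ_[p] (AlgebraicClosure ℚ_[p])).injective.comp ?_)
    exact Subtype.val_injective
  refine hm G ((φ.mapMatrix : Matrix (Fin n) (Fin n) ℤ_[p] →+* _).toMonoidHom.comp f) ?_
  intro a b h
  have h1 : (f a).map φ = (f b).map φ := h
  have h2 : f a = f b := Matrix.map_injective hφ h1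
  have h3 := hf a
  rw [h2, hf b] at h3
  exact Subtype.ext (Subtype.ext h3.symm)
end Jo2
end PieceJo2

section PieceJo3
open Matrix

section Jo3
theorem exists_uf (S : Set ℕ) (hS : S.Infinite) : ∃ U : Ultrafilter ℕ, S ∈ U ∧ (U : Filter ℕ) ≤ Filter.cofinite := by
  haveI : (Filter.cofinite ⊓ Filter.principal S).NeBot := by
    rw [Filter.inf_principal_neBot_iff]
    intro T hT
    by_contra h
    rw [Set.not_nonempty_iff_eq_empty] at h
    rw [Filter.mem_cofinite] at hT
    exact hS (hT.subset (fun x hx hxT => by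
      have : x ∈ T ∩ S := ⟨hxT, hx⟩
      rw [h] at this; exact this))
  refine ⟨Ultrafilter.of (Filter.cofinite ⊓ Filter.principal S), ?_, ?_⟩
  · exact (Ultrafilter.of_le _).trans inf_le_right (Filter.mem_principal_self S)
  · exact (Ultrafilter.of_le _).trans inf_le_left

theorem int_zero_of_ev (U : Ultrafilter ℕ) (hU : (U : Filter ℕ) ≤ Filter.cofinite) (x : ℤ)
    (h : ∀ᶠ p in (U : Filter ℕ), (x : ZMod p) = 0) : x = 0 := by
  by_contra hx
  have hfin : {p : ℕ | (x : ZMod p) = 0}.Finite := by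
    refine (Set.finite_le_nat x.natAbs).subset ?_
    intro p hp
    have : (p : ℤ) ∣ x := (ZMod.intCast_zmod_eq_zero_iff_dvd x p).1 hp
    exact Nat.le_of_dvd (Int.natAbs_pos.2 hx) (Int.natCast_dvd.1 this)
  have h2 : ∀ᶠ p in (U : Filter ℕ), ¬ ((x : ZMod p) = 0) := hU (by
    rw [Filter.mem_cofinite]
    exact hfin.subset (fun p hp => not_not.1 hp))
  obtain ⟨p, h3, h4⟩ := (h.and h2).exists
  exact h4 h3

theorem finite_not_dvd {n : ℕ} (H : Subgroup (SL n ℤ)) (hsbf : ¬ SolvableByFinite H) :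
    {p : ℕ | p.Prime ∧ ¬ p ∣ Nat.card (H.map (redMod n p))}.Finite := by
  classical
  by_contra hinf
  apply hsbf
  obtain ⟨m, hm⟩ := jordan_modp n
  obtain ⟨U, hUS, hU⟩ := exists_uf _ hinf
  have hB : ∀ p : ℕ, ∃ B : Subgroup (SL n (ZMod p)), p ∈ {p : ℕ | p.Prime ∧ ¬ p ∣ Nat.card (H.map (redMod n p))} →
      (∀ a ∈ B, ∀ b ∈ B, a * b = b * a) ∧ ∀ g : Fin (m+1) → H, ∃ i j, i ≠ j ∧ redMod n p ((g i)⁻¹ * g j : H).1 ∈ B := by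
    intro p
    by_cases hp : p ∈ {p : ℕ | p.Prime ∧ ¬ p ∣ Nat.card (H.map (redMod n p))}
    · haveI : Fact p.Prime := ⟨hp.1⟩
      obtain ⟨A, hA1, hA2⟩ := hm p (H.map (redMod n p)) hp.2
      refine ⟨A.map (Subgroup.subtype _), fun _ => ⟨?_, ?_⟩⟩
      · rintro _ ⟨a, ha, rfl⟩ _ ⟨b, hb, rfl⟩
        rw [← map_mul, hA1 a ha b hb, map_mul]
      · intro g
        obtain ⟨i, j, hij, h⟩ := hA2 (fun i => ⟨redMod n p (g i).1, Subgroup.mem_map_of_mem _ (g i).2⟩)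
        refine ⟨i, j, hij, _, h, ?_⟩
        simp
    · exact ⟨⊥, fun h => absurd h hp⟩
  choose B hB using hB
  have hBe : ∀ᶠ p in (U : Filter ℕ), (∀ a ∈ B p, ∀ b ∈ B p, a * b = b * a) ∧ ∀ g : Fin (m+1) → H, ∃ i j, i ≠ j ∧ redMod n p ((g i)⁻¹ * g j : H).1 ∈ B p :=
    Filter.mem_of_superset hUS (fun p hp => hB p hp)
  let K : Subgroup H :=
    { carrier := {h | ∀ᶠ p in (U : Filter ℕ), redMod n p h.1 ∈ B p}
      one_mem' := by simp [one_mem]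
      mul_mem' := by
        intro a b ha hb
        filter_upwards [ha, hb] with p h1 h2
        simpa using mul_mem h1 h2
      inv_mem' := by
        intro a ha
        filter_upwards [ha] with p h1
        simpa using h1 }
  have hKfi : K.FiniteIndex := by
    rw [Subgroup.finiteIndex_iff_finite_quotient]
    by_contra hni
    rw [not_finite_iff_infinite] at hni
    obtain ⟨e⟩ : Nonempty (Fin (m+1) ↪ H ⧸ K) := ⟨(Fin.valEmbedding).trans (Infinite.natEmbedding _)⟩
    have hg : ∀ i, ∃ g : H, (g : H ⧸ K) = e i := fun i => QuotientGroup.mk_surjective _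
    choose g hg using hg
    have h1 : ∀ᶠ p in (U : Filter ℕ), ∃ ij : Fin (m+1) × Fin (m+1), ij.1 ≠ ij.2 ∧ redMod n p ((g ij.1)⁻¹ * g ij.2 : H).1 ∈ B p := by
      filter_upwards [hBe] with p hp
      obtain ⟨i, j, h⟩ := hp.2 g
      exact ⟨(i, j), h⟩
    rw [Ultrafilter.eventually_exists_iff] at h1
    obtain ⟨⟨i, j⟩, h⟩ := h1
    obtain ⟨p0, hij, -⟩ := h.exists
    have : (g i)⁻¹ * g j ∈ K := h.mono (fun p hp => hp.2)
    rw [← QuotientGroup.eq, hg, hg] at this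
    exact hij (e.injective this)
  refine sbf_of_comm K ?_
  intro a ha b hb
  have hev : ∀ᶠ p in (U : Filter ℕ), redMod n p (a.1 * b.1) = redMod n p (b.1 * a.1) := by
    filter_upwards [hBe, ha, hb] with p h1 h2 h3
    rw [map_mul, map_mul, h1.1 _ h2 _ h3]
  refine Subtype.ext (Subtype.ext ?_)
  ext i j
  rw [← sub_eq_zero]
  refine int_zero_of_ev U hU _ ?_
  filter_upwards [hev] with p hp
  have := congrFun (congrFun (congrArg Subtype.val hp) i) j
  push_cast
  rw [sub_eq_zero]
  exact this
end Jo3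
end PieceJo3

section PieceLp1
open Matrix

section Lp1
open Polynomial

noncomputable def bcp (p i : ℕ) [Fact p.Prime] : (ZMod p)[X] := C (((i.factorial : ℕ) : ZMod p)⁻¹) * descPochhammer (ZMod p) i

theorem bcp_eval (p i : ℕ) [Fact p.Prime] (hi : i < p) (m : ℕ) : (bcp p i).eval (m : ZMod p) = (m.choose i : ZMod p) := by
  have h0 : ((i.factorial : ℕ) : ZMod p) ≠ 0 := by
    rw [Ne, ZMod.natCast_eq_zero_iff]
    intro h
    exact absurd (((Fact.out : p.Prime).dvd_factorial).1 h) (by omega)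
  rw [bcp, eval_mul, eval_C, descPochhammer_eval_eq_descFactorial, Nat.descFactorial_eq_factorial_mul_choose]
  push_cast
  rw [inv_mul_cancel_left₀ h0]

theorem bcp_natDegree (p i : ℕ) [Fact p.Prime] : (bcp p i).natDegree ≤ i := by
  refine (natDegree_C_mul_le _ _).trans ?_
  rw [descPochhammer_natDegree]

theorem bcp_zero (p : ℕ) [Fact p.Prime] : bcp p 0 = 1 := by simp [bcp]
theorem bcp_one (p : ℕ) [Fact p.Prime] : bcp p 1 = X := by simp [bcp]
theorem bcp_coeff_zero (p i : ℕ) [Fact p.Prime] (hi : i ≠ 0) : (bcp p i).coeff 0 = 0 := by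
  rw [coeff_zero_eq_eval_zero, bcp, eval_mul, descPochhammer_ne_zero_eval_zero _ hi, mul_zero]

theorem uni_pow {p n : ℕ} [Fact p.Prime] (hnp : n ≤ p) {A : Type*} [Ring A] [Algebra (ZMod p) A] (u : A)
    (hu : (u - 1)^n = 0) (m : ℕ) : u ^ m = ∑ i ∈ Finset.range n, (bcp p i).eval (m : ZMod p) • (u - 1)^i := by
  have h1 : u ^ m = ∑ i ∈ Finset.range (m + 1), (m.choose i : ZMod p) • (u - 1)^i := by
    conv_lhs => rw [← sub_add_cancel u 1]
    rw [(Commute.one_right (u - 1)).add_pow]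
    refine Finset.sum_congr rfl (fun i _ => ?_)
    rw [one_pow, mul_one, Nat.cast_smul_eq_nsmul, nsmul_eq_mul, (Nat.cast_commute _ _).eq]
  have h2 : ∀ i, i < n → (bcp p i).eval (m : ZMod p) = (m.choose i : ZMod p) := fun i hi => bcp_eval p i (by omega) m
  rw [h1]
  have e1 : ∑ i ∈ Finset.range (m + 1), (m.choose i : ZMod p) • (u - 1)^i = ∑ i ∈ Finset.range (m + 1 + n), (m.choose i : ZMod p) • (u - 1)^i := by
    refine Finset.sum_subset (Finset.range_mono (by omega)) ?_
    intro i _ hi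
    rw [Finset.mem_range] at hi
    rw [Nat.choose_eq_zero_of_lt (by omega)]; simp
  have e2 : ∑ i ∈ Finset.range n, (m.choose i : ZMod p) • (u - 1)^i = ∑ i ∈ Finset.range (m + 1 + n), (m.choose i : ZMod p) • (u - 1)^i := by
    refine Finset.sum_subset (Finset.range_mono (by omega)) ?_
    intro i _ hi
    rw [Finset.mem_range] at hi
    rw [pow_eq_zero_of_le (by omega) hu, smul_zero]
  rw [e1, ← e2]
  exact Finset.sum_congr rfl (fun i hi => by rw [h2 i (Finset.mem_range.1 hi)])

theorem poly_coeff_mem {p : ℕ} [Fact p.Prime] {V κ : Type*} [AddCommGroup V] [Module (ZMod p) V] (W : Submodule (ZMod p) V)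
    (s : Finset κ) (v : κ → V) (q : κ → (ZMod p)[X]) (hq : ∀ k ∈ s, (q k).natDegree < p)
    (h : ∀ t : ZMod p, ∑ k ∈ s, (q k).eval t • v k ∈ W) (m : ℕ) : ∑ k ∈ s, (q k).coeff m • v k ∈ W := by
  by_contra hcon
  obtain ⟨f, hf, hW⟩ := Submodule.exists_le_ker_of_notMem hcon
  let P : (ZMod p)[X] := ∑ k ∈ s, C (f (v k)) * q k
  have hP : P = 0 := by
    refine Polynomial.eq_zero_of_natDegree_lt_card_of_eval_eq_zero P (f := fun t : ZMod p => t) Function.injective_id ?_ ?_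
    · intro t
      have := hW (h t)
      rw [LinearMap.mem_ker, map_sum] at this
      simp only [P, eval_finset_sum, eval_mul, eval_C]
      rw [← this]
      exact Finset.sum_congr rfl (fun k _ => by rw [map_smul, smul_eq_mul, mul_comm])
    · rw [ZMod.card]
      refine lt_of_le_of_lt (Polynomial.natDegree_sum_le_of_forall_le (n := p - 1) s _ ?_) (by have := (Fact.out : p.Prime).pos; omega)
      intro k hk
      exact (natDegree_C_mul_le _ _).trans (by have := hq k hk; omega)
  apply hf
  rw [map_sum]
  have := congrArg (fun P => Polynomial.coeff P m) hP
  simp only [P, finset_sum_coeff, coeff_C_mul, coeff_zero] at this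
  rw [← this]
  exact Finset.sum_congr rfl (fun k _ => by rw [map_smul, smul_eq_mul, mul_comm])

noncomputable def lg (p n : ℕ) [Fact p.Prime] {A : Type*} [Ring A] [Algebra (ZMod p) A] (u : A) : A :=
  ∑ i ∈ Finset.range n, (bcp p i).coeff 1 • (u - 1)^i

theorem lg_eq (p n : ℕ) [Fact p.Prime] {A : Type*} [Ring A] [Algebra (ZMod p) A] (hn : 2 ≤ n) (u : A) :
    ∃ b, Commute (u - 1) b ∧ lg p n u = (u - 1) * (1 + (u - 1) * b) := by
  obtain ⟨m, rfl⟩ : ∃ m, n = m + 2 := ⟨n - 2, by omega⟩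
  refine ⟨∑ i ∈ Finset.range m, (bcp p (i + 2)).coeff 1 • (u - 1)^i, ?_, ?_⟩
  · exact Commute.sum_right (Finset.range m) (fun i => (bcp p (i + 2)).coeff 1 • (u - 1)^i) (u-1) (fun i _ => (((Commute.refl (u-1)).pow_right i).smul_right ((bcp p (i + 2)).coeff 1)))
  · rw [lg, Finset.sum_range_succ', Finset.sum_range_succ', bcp_zero, zero_add, bcp_one, Polynomial.coeff_one]
    simp only [coeff_X_one, one_smul, pow_one, mul_add, mul_one, Finset.mul_sum, mul_smul_comm]
    rw [add_comm]
    simp only [one_ne_zero, if_false, zero_smul, zero_add]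
    rw [add_comm]
    congr 1
    refine Finset.sum_congr rfl (fun i _ => ?_)
    rw [pow_succ', pow_succ']

theorem lg_nilp (p n : ℕ) [Fact p.Prime] {A : Type*} [Ring A] [Algebra (ZMod p) A] (hn : 2 ≤ n) (u : A) (hu : (u-1)^n = 0) :
    (lg p n u)^n = 0 := by
  obtain ⟨b, hb, h⟩ := lg_eq p n hn u
  rw [h, ((Commute.one_right _).add_right ((Commute.refl _).mul_right hb)).mul_pow, hu, zero_mul]

theorem lg_ne (p n : ℕ) [Fact p.Prime] {A : Type*} [Ring A] [Algebra (ZMod p) A] (hn : 2 ≤ n) (u : A) (hu : (u-1)^n = 0) 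
    (h : lg p n u = 0) : u = 1 := by
  obtain ⟨b, hb, h1⟩ := lg_eq p n hn u
  rw [h1] at h
  have hnil : IsNilpotent ((u - 1) * b) := ⟨n, by rw [hb.mul_pow, hu, zero_mul]⟩
  have h2 := hnil.isUnit_one_add.mul_left_eq_zero.1 h
  exact sub_eq_zero.1 h2

theorem lg_conj (p n : ℕ) [Fact p.Prime] {A : Type*} [Ring A] [Algebra (ZMod p) A] (g : Aˣ) (u : A) :
    lg p n (g * u * g⁻¹.1) = g * lg p n u * g⁻¹.1 := by
  have : g * u * g⁻¹.1 - 1 = g * (u - 1) * g⁻¹.1 := by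
    rw [mul_sub, sub_mul, mul_one, Units.mul_inv]
  rw [lg, this, lg, Finset.mul_sum, Finset.sum_mul]
  refine Finset.sum_congr rfl (fun i _ => ?_)
  rw [Units.conj_pow, mul_smul_comm, smul_mul_assoc]

/-- polynomial conjugation argument: if `u^t y u^{-t} ∈ W` for all `t` then `[lg u, y] ∈ W`. -/
theorem lg_bracket {p n : ℕ} [Fact p.Prime] (hn : 2 ≤ n) (hnp : 2 * n ≤ p) {A : Type*} [Ring A] [Algebra (ZMod p) A] (u : A)
    (hu : (u-1)^n = 0) (W : Submodule (ZMod p) A) (y : A) (h : ∀ m m' : ℕ, u ^ m * u ^ m' = 1 → u^m * y * u^m' ∈ W) :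
    lg p n u * y - y * lg p n u ∈ W := by
  have hone : ∑ i ∈ Finset.range n, (bcp p i).coeff 0 • (u - 1)^i = 1 := by
    rw [Finset.sum_eq_single 0]
    · rw [bcp_zero]; simp
    · intro i _ hi
      rw [bcp_coeff_zero p i hi, zero_smul]
    · intro h; exact absurd (Finset.mem_range.2 (by omega)) h
  have hup : u ^ p = 1 := by
    refine (uni_pow (p := p) (n := n) (by omega) u hu p).trans (Eq.trans ?_ hone)
    refine Finset.sum_congr rfl (fun i _ => ?_)
    rw [coeff_zero_eq_eval_zero]; simp
  have key := poly_coeff_mem W (Finset.range n ×ˢ Finset.range n) (fun ij => (u-1)^ij.1 * y * (u-1)^ij.2)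
    (fun ij => bcp p ij.1 * (bcp p ij.2).comp (-X)) ?_ ?_ 1
  · convert key using 1
    have hc : ∀ ij : ℕ × ℕ, (bcp p ij.1 * (bcp p ij.2).comp (-X)).coeff 1 = (bcp p ij.1).coeff 1 * (bcp p ij.2).coeff 0 - (bcp p ij.1).coeff 0 * (bcp p ij.2).coeff 1 := by
      intro ij
      rw [Polynomial.mul_coeff_one, show (-X : (ZMod p)[X]) = C (-1) * X by simp, Polynomial.comp_C_mul_X_coeff, Polynomial.comp_C_mul_X_coeff]
      ring
    simp only [hc]
    rw [Finset.sum_product]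
    have h1 : lg p n u * y = lg p n u * y * ∑ i ∈ Finset.range n, (bcp p i).coeff 0 • (u - 1)^i := by rw [hone, mul_one]
    have h2 : y * lg p n u = (∑ i ∈ Finset.range n, (bcp p i).coeff 0 • (u - 1)^i) * y * lg p n u := by rw [hone, one_mul]
    rw [h1, h2, lg, Finset.sum_mul, Finset.sum_mul_sum, Finset.sum_mul, Finset.sum_mul_sum, ← Finset.sum_sub_distrib]
    refine Finset.sum_congr rfl (fun i _ => ?_)
    rw [← Finset.sum_sub_distrib]
    refine Finset.sum_congr rfl (fun j _ => ?_)
    simp only [smul_mul_assoc, mul_smul_comm, smul_smul, sub_smul, mul_comm]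
  · rintro ⟨i, j⟩ hij
    rw [Finset.mem_product, Finset.mem_range, Finset.mem_range] at hij
    have h1 := bcp_natDegree p i
    have h2 := bcp_natDegree p j
    have h3 : ((bcp p j).comp (-X)).natDegree ≤ j := by
      refine natDegree_comp_le.trans ?_
      rw [natDegree_neg, natDegree_X, mul_one]; exact h2
    have := natDegree_mul_le (p := bcp p i) (q := (bcp p j).comp (-X))
    dsimp only at *
    omega
  · intro t
    have e1 : (t.val : ZMod p) = t := ZMod.natCast_zmod_val t
    have e2 : ((t.val * (p - 1) : ℕ) : ZMod p) = -t := by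
      rw [Nat.cast_mul, Nat.cast_sub (Fact.out : p.Prime).one_le]; simp
    have := h t.val (t.val * (p-1)) (by
      rw [← pow_add, show t.val + t.val * (p-1) = t.val * (1 + (p - 1)) by ring, Nat.add_sub_cancel' (Fact.out : p.Prime).one_le, mul_comm, pow_mul, hup, one_pow])
    rw [uni_pow (p := p) (n := n) (by omega) u hu t.val, uni_pow (p := p) (n := n) (by omega) u hu (t.val * (p-1)), e1, e2, Finset.sum_mul, Finset.sum_mul_sum] at this
    rw [Finset.sum_product]
    convert this using 1
    refine Finset.sum_congr rfl (fun i _ => Finset.sum_congr rfl (fun j _ => ?_))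
    simp [smul_mul_assoc, mul_smul_comm, smul_smul, mul_comm]

/-- the span of logarithms of unipotents of `G` -/
noncomputable def Lsp {p n : ℕ} [Fact p.Prime] (G : Subgroup (SpecialLinearGroup (Fin n) (ZMod p))) :
    Submodule (ZMod p) (Matrix (Fin n) (Fin n) (ZMod p)) :=
  Submodule.span (ZMod p) {x | ∃ u ∈ G, (u.1 - 1)^n = 0 ∧ x = lg p n u.1}

theorem Lsp_conj {p n : ℕ} [Fact p.Prime] (G : Subgroup (SpecialLinearGroup (Fin n) (ZMod p))) (g) (hg : g ∈ G) (x) (hx : x ∈ Lsp G) :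
    g.1 * x * (g⁻¹).1 ∈ Lsp G := by
  induction hx using Submodule.span_induction with
  | mem x hx =>
    obtain ⟨u, hu, hun, rfl⟩ := hx
    let w : (Matrix (Fin n) (Fin n) (ZMod p))ˣ := ⟨g.1, (g⁻¹).1, congrArg Subtype.val (mul_inv_cancel g), congrArg Subtype.val (inv_mul_cancel g)⟩
    refine Submodule.subset_span ⟨g * u * g⁻¹, mul_mem (mul_mem hg hu) (inv_mem hg), ?_, ?_⟩
    · have e : (g * u * g⁻¹).1 - 1 = w * (u.1 - 1) * w⁻¹.1 := by
        rw [mul_sub, sub_mul, mul_one, Units.mul_inv]; rfl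
      rw [e, Units.conj_pow, hun]; simp
    · exact (lg_conj p n w u.1).symm
  | zero => simp
  | add x y _ _ h1 h2 => rw [mul_add, add_mul]; exact add_mem h1 h2
  | smul c x _ h => rw [mul_smul_comm, smul_mul_assoc]; exact Submodule.smul_mem _ _ h

theorem Lsp_lie {p n : ℕ} [Fact p.Prime] (hn : 2 ≤ n) (hnp : 2 * n ≤ p) (G : Subgroup (SpecialLinearGroup (Fin n) (ZMod p)))
    (x y) (hx : x ∈ Lsp G) (hy : y ∈ Lsp G) : x * y - y * x ∈ Lsp G := by
  induction hx using Submodule.span_induction with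
  | mem x hx =>
    obtain ⟨u, hu, hun, rfl⟩ := hx
    refine lg_bracket hn hnp u.1 hun _ y ?_
    intro m m' hmm
    have h1 : u ^ m * u ^ m' = 1 := Subtype.ext (by simpa using hmm)
    have h2 := Lsp_conj G (u ^ m) (pow_mem hu m) y hy
    rw [← eq_inv_of_mul_eq_one_right h1] at h2
    simpa using h2
  | zero => simp
  | add a b _ _ h1 h2 =>
    have : (a + b) * y - y * (a + b) = (a * y - y * a) + (b * y - y * b) := by noncomm_ring
    rw [this]; exact add_mem h1 h2
  | smul c x _ h => rw [smul_mul_assoc, mul_smul_comm, ← smul_sub]; exact Submodule.smul_mem _ _ h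

theorem Lsp_trace {p n : ℕ} [Fact p.Prime] (hn : 2 ≤ n) (G : Subgroup (SpecialLinearGroup (Fin n) (ZMod p)))
    (x) (hx : x ∈ Lsp G) : x.trace = 0 := by
  induction hx using Submodule.span_induction with
  | mem x hx =>
    obtain ⟨u, hu, hun, rfl⟩ := hx
    exact (Matrix.isNilpotent_trace_of_isNilpotent ⟨n, lg_nilp p n hn u.1 hun⟩).eq_zero
  | zero => simp
  | add a b _ _ h1 h2 => rw [Matrix.trace_add, h1, h2, add_zero]
  | smul c x _ h => rw [Matrix.trace_smul, h, smul_zero]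

theorem unip_of_pow {p n : ℕ} [Fact p.Prime] (u : SpecialLinearGroup (Fin n) (ZMod p)) (hu : u ^ p = 1) : (u.1 - 1)^n = 0 := by
  have h1 : (u.1 - 1)^p = 0 := by
    rcases Nat.eq_zero_or_pos n with rfl | hn
    · exact Subsingleton.elim _ _
    haveI : Nonempty (Fin n) := ⟨⟨0, hn⟩⟩
    haveI : CharP (Matrix (Fin n) (Fin n) (ZMod p)) p := inferInstance
    rw [sub_pow_char_of_commute _ (Commute.one_right u.1)]
    have h0 : (u ^ p).1 = u.1 ^ p := Matrix.SpecialLinearGroup.coe_pow u p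
    rw [← h0, hu]; simp
  have h2 := Matrix.isNilpotent_charpoly_sub_pow_of_isNilpotent (M := u.1 - 1) ⟨p, h1⟩
  have h3 := sub_eq_zero.1 h2.eq_zero
  have h4 := Matrix.aeval_self_charpoly (u.1 - 1)
  rw [h3] at h4
  simpa using h4

theorem Lsp_exists {p n : ℕ} [Fact p.Prime] (hn : 2 ≤ n) (G : Subgroup (SpecialLinearGroup (Fin n) (ZMod p)))
    (hp : p ∣ Nat.card G) : ∃ x ∈ Lsp G, x ≠ 0 ∧ x^n = 0 := by
  obtain ⟨u, hu⟩ := exists_prime_orderOf_dvd_card' p hp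
  have h1 : u.1 ^ p = 1 := by
    have h0 : u ^ p = 1 := orderOf_dvd_iff_pow_eq_one.1 (dvd_of_eq hu)
    exact congrArg Subtype.val h0
  have h2 := unip_of_pow u.1 h1
  refine ⟨lg p n u.1.1, Submodule.subset_span ⟨u.1, u.2, h2, rfl⟩, ?_, lg_nilp p n hn _ h2⟩
  intro h
  have h3 := lg_ne p n hn _ h2 h
  have : u = 1 := Subtype.ext (Subtype.ext h3)
  rw [this, orderOf_one] at hu
  exact (Fact.out : p.Prime).one_lt.ne hu
end Lp1
end PieceLp1

section PieceUp
open Matrix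

section Up
theorem exists_psi (U : Ultrafilter Nat.Primes) (hU : (U : Filter Nat.Primes) ≤ Filter.cofinite) :
    ∃ (k : Type) (_ : Field k) (_ : CharZero k) (_ : IsAlgClosed k) (ψ : (∀ p : Nat.Primes, ZMod p) →+* k),
      ∀ x, ψ x = 0 ↔ ∀ᶠ p : Nat.Primes in (U : Filter Nat.Primes), x p = 0 := by
  classical
  let I : Ideal (∀ p : Nat.Primes, ZMod p) :=
    { carrier := {x | ∀ᶠ p : Nat.Primes in (U : Filter Nat.Primes), x p = 0}
      zero_mem' := by simp
      add_mem' := by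
        intro a b ha hb
        filter_upwards [ha, hb] with p h1 h2
        simp [h1, h2]
      smul_mem' := by
        intro c a ha
        filter_upwards [ha] with p h1
        simp [h1] }
  have hmemI : ∀ x, x ∈ I ↔ ∀ᶠ p : Nat.Primes in (U : Filter Nat.Primes), x p = 0 := fun x => Iff.rfl
  have hI : I.IsMaximal := by
    rw [Ideal.isMaximal_iff]
    constructor
    · rw [hmemI]
      intro h
      obtain ⟨p, hp⟩ := h.exists
      haveI : Fact (p : ℕ).Prime := ⟨p.2⟩
      exact one_ne_zero (α := ZMod p) hp
    · intro J x hIJ hx hxJ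
      rw [hmemI, ← Ultrafilter.eventually_not] at hx
      let y : ∀ p : Nat.Primes, ZMod p := fun p => (x p)⁻¹
      have : 1 - y * x ∈ I := by
        rw [hmemI]
        filter_upwards [hx] with p hp
        haveI : Fact (p : ℕ).Prime := ⟨p.2⟩
        simp [y, inv_mul_cancel₀ hp]
      have h2 := J.add_mem (hIJ this) (J.mul_mem_left y hxJ)
      simpa using h2
  letI : Field ((∀ p : Nat.Primes, ZMod p) ⧸ I) := Ideal.Quotient.field I
  have hcz : CharZero ((∀ p : Nat.Primes, ZMod p) ⧸ I) := by
    refine charZero_of_inj_zero ?_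
    intro m hm
    by_contra hm0
    have h1 : ((m : ∀ p : Nat.Primes, ZMod p)) ∈ I := by
      rw [← Ideal.Quotient.eq_zero_iff_mem]; simpa using hm
    rw [hmemI] at h1
    have hfin : {p : Nat.Primes | (m : ZMod p) = 0}.Finite := by
      refine Set.Finite.preimage (f := fun p : Nat.Primes => (p : ℕ)) (Subtype.val_injective.injOn) (Set.finite_le_nat m) |>.subset ?_
      intro p hp
      exact Nat.le_of_dvd (Nat.pos_of_ne_zero hm0) ((ZMod.natCast_eq_zero_iff _ _).1 hp)
    have h2 : ∀ᶠ p : Nat.Primes in (U : Filter Nat.Primes), ¬ ((m : ZMod p) = 0) := hU (by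
      rw [Filter.mem_cofinite]
      exact hfin.subset (fun p hp => not_not.1 hp))
    obtain ⟨p, h3, h4⟩ := (h1.and h2).exists
    exact h4 (by simpa using h3)
  refine ⟨AlgebraicClosure ((∀ p : Nat.Primes, ZMod p) ⧸ I), inferInstance, ?_, inferInstance,
    (algebraMap _ (AlgebraicClosure ((∀ p : Nat.Primes, ZMod p) ⧸ I))).comp (Ideal.Quotient.mk I), ?_⟩
  · exact charZero_of_injective_algebraMap (algebraMap ((∀ p : Nat.Primes, ZMod p) ⧸ I) _).injective
  · intro x
    rw [RingHom.comp_apply, map_eq_zero, Ideal.Quotient.eq_zero_iff_mem, hmemI]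

instance (p : Nat.Primes) : Fact (p : ℕ).Prime := ⟨p.2⟩

theorem full_lie {n : ℕ} (hn : n.Prime) (hodd : Odd n) (H : Subgroup (SL n ℤ)) (hirr : IrreducibleQ H)
    (hsbf : ¬ SolvableByFinite H) (hiso : ¬ IsometryGroupQ H)
    (U : Ultrafilter Nat.Primes) (hU : (U : Filter Nat.Primes) ≤ Filter.cofinite) :
    ∀ᶠ p : Nat.Primes in (U : Filter Nat.Primes), ∀ X : Matrix (Fin n) (Fin n) (ZMod p), X.trace = 0 → X ∈ Lsp (H.map (redMod n p)) := by
  classical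
  obtain ⟨k, _, _, _, ψ, hψ⟩ := exists_psi U hU
  have hn2 : 2 ≤ n := hn.two_le
  let ev : ∀ (p : Nat.Primes), (∀ p : Nat.Primes, ZMod p) →+* ZMod p := fun p => Pi.evalRingHom _ p
  let T : Set (Matrix (Fin n) (Fin n) (∀ p : Nat.Primes, ZMod p)) := {x | ∀ᶠ p : Nat.Primes in (U : Filter Nat.Primes), x.map (ev p) ∈ Lsp (H.map (redMod n p))}
  let S0 : Set (Matrix (Fin n) (Fin n) k) := (fun x => x.map ψ) '' T
  have hlarge : ∀ᶠ p : Nat.Primes in (U : Filter Nat.Primes), 2 * n ≤ (p : ℕ) := by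
    refine hU ?_
    rw [Filter.mem_cofinite]
    refine (Set.Finite.preimage (f := fun p : Nat.Primes => (p : ℕ)) (Subtype.val_injective.injOn) (Set.finite_le_nat (2*n))).subset ?_
    intro p hp
    have hp' : ¬ (2 * n ≤ (p:ℕ)) := hp
    change (p:ℕ) ≤ 2 * n
    omega
  have hmap0 : ∀ x : Matrix (Fin n) (Fin n) (∀ p : Nat.Primes, ZMod p), x.map ψ = 0 → ∀ᶠ p : Nat.Primes in (U : Filter Nat.Primes), x.map (ev p) = 0 := by
    intro x hx
    have : ∀ i j, ∀ᶠ p : Nat.Primes in (U : Filter Nat.Primes), x i j p = 0 := fun i j => (hψ _).1 (congrFun (congrFun hx i) j)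
    simp only [← Filter.eventually_all] at this
    filter_upwards [this] with p hp
    ext i j
    exact hp i j
  -- stability
  have hstab : ∀ g : H, ∀ x ∈ S0, rk k H g * x * rk k H g⁻¹ ∈ S0 := by
    rintro g _ ⟨x, hx, rfl⟩
    let c : ∀ (g : H), Matrix (Fin n) (Fin n) (∀ p : Nat.Primes, ZMod p) := fun g => g.1.1.map (Int.castRingHom _)
    have hc : ∀ g, (c g).map ψ = rk k H g := by
      intro g
      rw [rk_apply]
      ext i j
      simp [c]
    refine ⟨c g * x * c g⁻¹, ?_, ?_⟩
    · filter_upwards [hx] with p hp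
      rw [Matrix.map_mul, Matrix.map_mul]
      have he : ∀ g : H, (c g).map (ev p) = (redMod n p g.1).1 := by
        intro g
        ext i j
        simp [c, redMod]
      rw [he, he]
      have := Lsp_conj (H.map (redMod n p)) (redMod n p g.1) (Subgroup.mem_map_of_mem _ g.2) _ hp
      rw [← map_inv] at this
      exact this
    · change (c g * x * c g⁻¹).map ψ = _
      rw [Matrix.map_mul, Matrix.map_mul, hc, hc]
  have hnil : ∃ x ∈ S0, x ≠ 0 ∧ x ^ n = 0 := by
    have hdvd : ∀ᶠ p : Nat.Primes in (U : Filter Nat.Primes), (p : ℕ) ∣ Nat.card (H.map (redMod n p)) := by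
      refine hU ?_
      rw [Filter.mem_cofinite]
      refine (Set.Finite.preimage (f := fun p : Nat.Primes => (p : ℕ)) (Subtype.val_injective.injOn) (finite_not_dvd H hsbf)).subset ?_
      intro p hp
      exact ⟨p.2, hp⟩
    have : ∀ p : Nat.Primes, ∃ x : Matrix (Fin n) (Fin n) (ZMod p), (p : ℕ) ∣ Nat.card (H.map (redMod n p)) → x ∈ Lsp (H.map (redMod n p)) ∧ x ≠ 0 ∧ x ^ n = 0 := by
      intro p
      by_cases hp : (p : ℕ) ∣ Nat.card (H.map (redMod n p))
      · obtain ⟨x, hx⟩ := Lsp_exists hn2 _ hp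
        exact ⟨x, fun _ => hx⟩
      · exact ⟨0, fun h => absurd h hp⟩
    choose x hx using this
    let y : Matrix (Fin n) (Fin n) (∀ p : Nat.Primes, ZMod p) := Matrix.of fun i j p => x p i j
    have hy : ∀ p, y.map (ev p) = x p := fun p => rfl
    refine ⟨y.map ψ, ⟨y, ?_, rfl⟩, ?_, ?_⟩
    · filter_upwards [hdvd] with p hp
      exact (hx p hp).1
    · intro h
      obtain ⟨p, h1, h2⟩ := ((hmap0 y h).and hdvd).exists
      exact (hx p h2).2.1 h1
    · have h1 : (y ^ n).map ψ = (y.map ψ)^n := Matrix.map_pow y ψ n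
      rw [← h1]
      ext i j
      simp only [Matrix.map_apply, Matrix.zero_apply]
      rw [hψ]
      filter_upwards [hdvd] with p hp
      have h2 : (y ^ n).map (ev p) = x p ^ n := by
        rw [← hy p]; exact Matrix.map_pow y (ev p) n
      have h3 := (hx p hp).2.2
      rw [h3] at h2
      exact congrFun (congrFun h2 i) j
  have hSirr : ∀ W : Submodule k (Fin n → k), (∀ x ∈ S0, ∀ w ∈ W, x *ᵥ w ∈ W) → W = ⊥ ∨ W = ⊤ := by
    rcases cliff hn (rk k H) (irr_rk hn hirr hsbf k) S0 hstab with h | h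
    · exact h
    · exfalso
      obtain ⟨x, hxS, hx0, hxn⟩ := hnil
      apply hx0
      have hker : ∀ v : Fin n → k, x *ᵥ v = 0 := by
        intro v
        have hv : v ∈ Submodule.span k {v : Fin n → k | ∀ x ∈ S0, ∃ c : k, x *ᵥ v = c • v} := by rw [h]; trivial
        induction hv using Submodule.span_induction with
        | mem v hv =>
          obtain ⟨c, hc⟩ := hv x hxS
          have hp : ∀ m : ℕ, (x ^ m) *ᵥ v = c ^ m • v := by
            intro m
            induction m with
            | zero => simp
            | succ m ih => rw [pow_succ, ← Matrix.mulVec_mulVec, hc, Matrix.mulVec_smul, ih, smul_smul, pow_succ']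
          have := hp n
          rw [hxn, Matrix.zero_mulVec] at this
          rcases smul_eq_zero.1 this.symm with h1 | h1
          · rw [hc, pow_eq_zero_iff (by omega) |>.1 h1, zero_smul]
          · rw [h1, Matrix.mulVec_zero]
        | zero => simp
        | add a b _ _ h1 h2 => rw [Matrix.mulVec_add, h1, h2, add_zero]
        | smul c a _ h1 => rw [Matrix.mulVec_smul, h1, smul_zero]
      ext i j
      have := congrFun (hker (Pi.single j 1)) i
      simpa using this
  have hTlie : ∀ x ∈ S0, ∀ y ∈ S0, x * y - y * x ∈ S0 := by
    rintro _ ⟨x, hx, rfl⟩ _ ⟨y, hy, rfl⟩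
    refine ⟨x * y - y * x, ?_, ?_⟩
    · filter_upwards [hx, hy, hlarge] with p h1 h2 h3
      have := Lsp_lie hn2 h3 _ _ _ h1 h2
      rw [← Matrix.map_mul, ← Matrix.map_mul, ← Matrix.map_sub _ (fun a b => map_sub _ a b)] at this
      exact this
    · change (x * y - y * x).map ψ = _
      rw [Matrix.map_sub _ (fun a b => map_sub _ a b), Matrix.map_mul, Matrix.map_mul]
  have hTtr : ∀ x ∈ S0, x.trace = 0 := by
    rintro _ ⟨x, hx, rfl⟩
    have : (x.map ψ).trace = ψ x.trace := by simp [Matrix.trace]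
    change (x.map ψ).trace = 0
    rw [this, hψ]
    filter_upwards [hx] with p hp
    have h1 := Lsp_trace hn2 _ _ hp
    have h2 : (x.map (ev p)).trace = ev p x.trace := by simp [Matrix.trace]
    rw [h2] at h1
    exact h1
  have hl : ∀ x ∈ Submodule.span k S0, ∀ y ∈ Submodule.span k S0, x * y - y * x ∈ Submodule.span k S0 := by
    intro x hx y hy
    induction hx using Submodule.span_induction with
    | mem x hx =>
      induction hy using Submodule.span_induction with
      | mem y hy => exact Submodule.subset_span (hTlie x hx y hy)
      | zero => simp
      | add a b _ _ h1 h2 =>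
        have : x * (a + b) - (a + b) * x = (x * a - a * x) + (x * b - b * x) := by noncomm_ring
        rw [this]; exact add_mem h1 h2
      | smul c a _ h => rw [mul_smul_comm, smul_mul_assoc, ← smul_sub]; exact Submodule.smul_mem _ _ h
    | zero => simp
    | add a b _ _ h1 h2 =>
      have : (a + b) * y - y * (a + b) = (a * y - y * a) + (b * y - y * b) := by noncomm_ring
      rw [this]; exact add_mem h1 h2
    | smul c x _ h => rw [smul_mul_assoc, mul_smul_comm, ← smul_sub]; exact Submodule.smul_mem _ _ h
  have ht : ∀ x ∈ Submodule.span k S0, x.trace = 0 := by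
    intro x hx
    induction hx using Submodule.span_induction with
    | mem x hx => exact hTtr x hx
    | zero => simp
    | add a b _ _ h1 h2 => rw [Matrix.trace_add, h1, h2, add_zero]
    | smul c x _ h => rw [Matrix.trace_smul, h, smul_zero]
  have hi : ∀ W : Submodule k (Fin n → k), (∀ x ∈ Submodule.span k S0, ∀ w ∈ W, x *ᵥ w ∈ W) → W = ⊥ ∨ W = ⊤ := by
    intro W hW
    exact hSirr W (fun x hx => hW x (Submodule.subset_span hx))
  rcases gabber hn hodd (Submodule.span k S0) hl ht hi with hfull | ⟨Φ, hΦ, hinv⟩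
  · let z : Fin n := ⟨0, by omega⟩
    have hB : ∀ i j : Fin n, ∀ᶠ p : Nat.Primes in (U : Filter Nat.Primes),
        (Matrix.single i j 1 - if i = j then Matrix.single z z 1 else 0 : Matrix (Fin n) (Fin n) (ZMod p)) ∈ Lsp (H.map (redMod n p)) := by
      intro i j
      by_contra hcon
      rw [← Ultrafilter.eventually_not] at hcon
      have : ∀ p : Nat.Primes, ∃ a : Matrix (Fin n) (Fin n) (ZMod p),
          ¬ ((Matrix.single i j 1 - if i = j then Matrix.single z z 1 else 0 : Matrix (Fin n) (Fin n) (ZMod p)) ∈ Lsp (H.map (redMod n p))) →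
          (∀ x ∈ Lsp (H.map (redMod n p)), ∑ r, ∑ s, a r s * x r s = 0) ∧ a i j - (if i = j then a z z else 0) = 1 := by
        intro p
        by_cases hp : (Matrix.single i j 1 - if i = j then Matrix.single z z 1 else 0 : Matrix (Fin n) (Fin n) (ZMod p)) ∈ Lsp (H.map (redMod n p))
        · exact ⟨0, fun h => absurd hp h⟩
        · obtain ⟨f, hf, hL⟩ := Submodule.exists_le_ker_of_notMem hp
          have hfx : ∀ x : Matrix (Fin n) (Fin n) (ZMod p), f x = ∑ r, ∑ s, f (Matrix.single r s 1) * x r s := by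
            intro x
            conv_lhs => rw [Matrix.matrix_eq_sum_single x]
            rw [map_sum]
            refine Finset.sum_congr rfl (fun r _ => ?_)
            rw [map_sum]
            refine Finset.sum_congr rfl (fun s _ => ?_)
            rw [mul_comm, ← smul_eq_mul, ← map_smul, Matrix.smul_single, smul_eq_mul, mul_one]
          set c := f (Matrix.single i j 1 - if i = j then Matrix.single z z 1 else 0 : Matrix (Fin n) (Fin n) (ZMod p)) with hc
          refine ⟨fun r s => c⁻¹ * f (Matrix.single r s 1), fun _ => ⟨?_, ?_⟩⟩
          · intro x hx
            have h1 : f x = 0 := hL hx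
            simp only [mul_assoc, ← Finset.mul_sum]
            rw [← hfx, h1, mul_zero]
          · have h2 : c = f (Matrix.single i j 1) - if i = j then f (Matrix.single z z 1) else 0 := by
              rw [hc, map_sub]; split_ifs <;> simp
            have h3 : c⁻¹ * (f (Matrix.single i j 1) - if i = j then f (Matrix.single z z 1) else 0) = 1 := by
              rw [← h2]; exact inv_mul_cancel₀ hf
            rw [mul_sub, mul_ite, mul_zero] at h3
            exact h3
      choose a ha using this
      let b : Matrix (Fin n) (Fin n) (∀ p : Nat.Primes, ZMod p) := Matrix.of fun i j p => a p i j
      have hvan : ∀ x ∈ Submodule.span k S0, ∑ r, ∑ s, ψ (b r s) * x r s = 0 := by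
        intro x hx
        induction hx using Submodule.span_induction with
        | mem x hx =>
          obtain ⟨x, hx, rfl⟩ := hx
          have h1 : ∑ r, ∑ s, ψ (b r s) * (x.map ψ) r s = ψ (∑ r, ∑ s, b r s * x r s) := by
            simp [map_sum]
          change ∑ r, ∑ s, ψ (b r s) * (x.map ψ) r s = 0
          rw [h1, hψ]
          filter_upwards [hx, hcon] with p h2 h3
          have h4 := (ha p h3).1 _ h2
          simpa [b, Finset.sum_apply, ev] using h4
        | zero => simp
        | add u v _ _ h1 h2 => simp only [Matrix.add_apply, mul_add, Finset.sum_add_distrib, h1, h2, add_zero]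
        | smul c u _ h1 => simp only [Matrix.smul_apply, smul_eq_mul, mul_left_comm _ c, ← Finset.mul_sum, h1, mul_zero]
      have hmem := hfull (Matrix.single i j 1 - if i = j then Matrix.single z z 1 else 0) (by
        rw [Matrix.trace_sub]
        by_cases hij : i = j
        · subst hij; simp [Matrix.trace_single_eq_same]
        · simp [hij, Matrix.trace_single_eq_of_ne])
      have h1 := hvan _ hmem
      have h2 : ψ (b i j - (if i = j then b z z else 0) - 1) = 0 := by
        rw [hψ]
        filter_upwards [hcon] with p h3
        have h4 := (ha p h3).2
        by_cases hij : i = j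
        · subst hij
          simp only [if_true] at h4 ⊢
          simp [b, h4]
        · simp only [hij, if_false] at h4 ⊢
          simp only [sub_zero] at h4
          simp [b, h4]
      have h3 : ∑ r, ∑ s, ψ (b r s) * (Matrix.single i j 1 - if i = j then Matrix.single z z 1 else 0 : Matrix (Fin n) (Fin n) k) r s
          = ψ (b i j - (if i = j then b z z else 0)) := by
        have hs : ∀ i j : Fin n, ∑ r, ∑ s, ψ (b r s) * (Matrix.single i j 1 : Matrix (Fin n) (Fin n) k) r s = ψ (b i j) := by
          intro i j
          rw [Finset.sum_eq_single i, Finset.sum_eq_single j]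
          · simp
          · intro s _ hs; simp [Matrix.single_apply, hs.symm]
          · simp
          · intro r _ hr; exact Finset.sum_eq_zero (fun s _ => by simp [Matrix.single_apply, hr.symm])
          · simp
        simp only [Matrix.sub_apply, mul_sub, Finset.sum_sub_distrib, hs]
        by_cases hij : i = j
        · simp only [hij, if_true, hs, map_sub]
        · simp [hij]
      rw [map_sub, ← h3, h1] at h2
      simp at h2
    have hall : ∀ᶠ p : Nat.Primes in (U : Filter Nat.Primes), ∀ i j : Fin n,
        (Matrix.single i j 1 - if i = j then Matrix.single z z 1 else 0 : Matrix (Fin n) (Fin n) (ZMod p)) ∈ Lsp (H.map (redMod n p)) := by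
      simp only [Filter.eventually_all]
      exact hB
    filter_upwards [hall] with p hp X hX
    have hXe : X = ∑ i, ∑ j, X i j • (Matrix.single i j 1 - if i = j then Matrix.single z z 1 else 0 : Matrix (Fin n) (Fin n) (ZMod p)) := by
      simp only [smul_sub, Finset.sum_sub_distrib]
      have h1 : ∑ i, ∑ j, X i j • (if i = j then Matrix.single z z 1 else 0 : Matrix (Fin n) (Fin n) (ZMod p)) = 0 := by
        have : ∀ i, ∑ j, X i j • (if i = j then Matrix.single z z 1 else 0 : Matrix (Fin n) (Fin n) (ZMod p)) = X i i • Matrix.single z z 1 := by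
          intro i; simp
        simp only [this]
        rw [← Finset.sum_smul]
        have : ∑ i, X i i = 0 := hX
        rw [this, zero_smul]
      rw [h1, sub_zero]
      conv_lhs => rw [Matrix.matrix_eq_sum_single X]
      refine Finset.sum_congr rfl (fun i _ => Finset.sum_congr rfl (fun j _ => ?_))
      rw [Matrix.smul_single, smul_eq_mul, mul_one]
    rw [hXe]
    exact Submodule.sum_mem _ (fun i _ => Submodule.sum_mem _ (fun j _ => Submodule.smul_mem _ _ (hp i j)))
  · exact absurd (form_final hn hodd hirr hsbf k S0 hstab hSirr Φ hΦ (fun x hx => hinv x (Submodule.subset_span hx))) hiso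
end Up
end PieceUp

section PieceCt1
open Matrix

section Ct1

theorem diag2n_eq {F ι : Type*} [Field F] [Fintype ι] [DecidableEq ι] {i j : ι} (hij : i ≠ j) (c : F) (hc : c ≠ 0) :
    Matrix.SpecialLinearGroup.diag2n hij c hc * (Matrix.SpecialLinearGroup.transvection hij 1 * Matrix.SpecialLinearGroup.transvection hij.symm (-1) * Matrix.SpecialLinearGroup.transvection hij 1)
    = Matrix.SpecialLinearGroup.transvection hij c * Matrix.SpecialLinearGroup.transvection hij.symm (-c⁻¹) * Matrix.SpecialLinearGroup.transvection hij c := by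
  apply Subtype.ext
  have hd : (Matrix.SpecialLinearGroup.diag2n hij c hc).1 = 1 + Matrix.single i i (c - 1) + Matrix.single j j (c⁻¹ - 1) := by
    rw [Matrix.SpecialLinearGroup.diag2n_coe]
    ext a b
    simp only [Matrix.diagonal_apply, Matrix.add_apply, Matrix.one_apply, Matrix.single_apply]
    split_ifs <;> grind
  simp only [Matrix.SpecialLinearGroup.coe_mul, Matrix.SpecialLinearGroup.transvection_coe, hd]
  simp only [mul_add, add_mul, mul_one, one_mul, Matrix.single_mul_single_same, Matrix.single_mul_single_of_ne _ _ _ _ hij, Matrix.single_mul_single_of_ne _ _ _ _ hij.symm, add_zero, zero_add, zero_mul, mul_zero]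
  ext a b
  simp only [Matrix.add_apply, Matrix.one_apply, Matrix.single_apply]
  split_ifs <;> grind

theorem eq_top_of_index {n p : ℕ} [Fact p.Prime] (hn : 2 ≤ n) (G : Subgroup (SpecialLinearGroup (Fin n) (ZMod p))) (h : G.index < p) : G = ⊤ := by
  have h0 : G.index ≠ 0 := Subgroup.FiniteIndex.index_ne_zero
  have hmem : ∀ u : SpecialLinearGroup (Fin n) (ZMod p), u ^ p = 1 → u ∈ G := by
    intro u hu
    obtain ⟨m, hm0, hmi, hm⟩ := Subgroup.exists_pow_mem_of_index_ne_zero h0 u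
    have hcop : Nat.Coprime m p := by
      refine Nat.Coprime.symm ((Nat.Prime.coprime_iff_not_dvd Fact.out).2 (fun hd => ?_))
      exact absurd (Nat.le_of_dvd hm0 hd) (by omega)
    have h1 : u ^ (1 : ℤ) ∈ G := by
      have hb : (1 : ℤ) = (m : ℤ) * m.gcdA p + (p : ℤ) * m.gcdB p := by
        rw [← Nat.gcd_eq_gcd_ab, hcop]; rfl
      rw [hb, _root_.zpow_add, _root_.zpow_mul, _root_.zpow_mul, _root_.zpow_natCast, _root_.zpow_natCast, hu, _root_.one_zpow, mul_one]
      exact G.zpow_mem hm _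
    simpa using h1
  have htr : ∀ (i j : Fin n) (hij : i ≠ j) (a : ZMod p), Matrix.SpecialLinearGroup.transvection hij a ∈ G := by
    intro i j hij a
    apply hmem
    have : ∀ m : ℕ, (Matrix.SpecialLinearGroup.transvection hij a) ^ m = Matrix.SpecialLinearGroup.transvection hij ((m : ZMod p) * a) := by
      intro m
      induction m with
      | zero => simp
      | succ m ih =>
        rw [pow_succ, ih]
        apply Subtype.ext
        rw [Matrix.SpecialLinearGroup.coe_mul]
        have := Matrix.transvection_mul_transvection_same (i := i) (j := j) hij ((m : ZMod p) * a) a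
        refine this.trans ?_
        change _ = Matrix.transvection i j _
        congr 1
        push_cast; ring
    rw [this]; simp
  haveI : Nontrivial (Fin n) := Fin.nontrivial_iff_two_le.2 hn
  rw [eq_top_iff]
  intro M _
  refine Matrix.SpecialLinearGroup.diagonal_transvection_induction' (fun M => M ∈ G) M ?_ htr (fun A B hA hB => G.mul_mem hA hB)
  intro i j hij c hc
  have h1 := diag2n_eq hij c hc
  have h2 : (Matrix.SpecialLinearGroup.transvection hij 1 * Matrix.SpecialLinearGroup.transvection hij.symm (-1) * Matrix.SpecialLinearGroup.transvection hij 1) ∈ G :=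
    G.mul_mem (G.mul_mem (htr _ _ _ _) (htr _ _ _ _)) (htr _ _ _ _)
  refine (Subgroup.mul_mem_cancel_right G h2).1 ?_
  rw [h1]
  exact G.mul_mem (G.mul_mem (htr _ _ _ _) (htr _ _ _ _)) (htr _ _ _ _)

theorem card_SL_le {n p : ℕ} [Fact p.Prime] (hn : 2 ≤ n) :
    Nat.card (SpecialLinearGroup (Fin n) (ZMod p)) * (p - 1) ≤ p ^ (n * n) := by
  classical
  let z : Fin n := ⟨0, by omega⟩
  have h1 : Nat.card (Matrix (Fin n) (Fin n) (ZMod p)) = p ^ (n * n) := by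
    simp [Nat.card_eq_fintype_card, Matrix, ZMod.card, ← pow_mul]
  have h2 : Nat.card (ZMod p)ˣ = p - 1 := by
    rw [Nat.card_eq_fintype_card, ZMod.card_units]
  rw [← h1, ← h2, ← Nat.card_prod]
  let D : (ZMod p)ˣ → Matrix (Fin n) (Fin n) (ZMod p) := fun c => Matrix.diagonal (fun i => if i = z then (c : ZMod p) else 1)
  have hD : ∀ c, (D c).det = c := by
    intro c
    simp [D, Matrix.det_diagonal]
  refine Nat.card_le_card_of_injective (fun x : SpecialLinearGroup (Fin n) (ZMod p) × (ZMod p)ˣ => D x.2 * x.1.1) ?_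
  rintro ⟨g, c⟩ ⟨g', c'⟩ h
  simp only at h
  have hdet := congrArg Matrix.det h
  rw [Matrix.det_mul, Matrix.det_mul, hD, hD, g.2, g'.2, mul_one, mul_one] at hdet
  have hc : c = c' := Units.ext hdet
  subst hc
  have hu : IsUnit (D c) := by rw [Matrix.isUnit_iff_isUnit_det, hD]; exact c.isUnit
  have := hu.mul_left_cancel h
  exact Prod.ext (Subtype.ext this) rfl

end Ct1
end PieceCt1

section PieceCt2
open Matrix

section Ct2
open MvPolynomial

/-- near-identity substitutions are injective -/
theorem subst_inj {ι F : Type*} [Field F] (f : ι → MvPolynomial ι F)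
    (hf : ∀ i, f i - X i ∈ idealOfVars ι F ^ 2) (P : MvPolynomial ι F) (hP : aeval f P = 0) : P = 0 := by
  set I := idealOfVars ι F with hI
  set φ : MvPolynomial ι F →ₐ[F] MvPolynomial ι F := aeval f with hφ
  have hX : ∀ i, X i ∈ I := fun i => Ideal.subset_span ⟨i, rfl⟩
  have hfI : ∀ i, f i ∈ I := by
    intro i
    have h1 : f i - X i ∈ I := Ideal.pow_le_self (by norm_num) (hf i)
    have := I.add_mem h1 (hX i)
    simpa using this
  have h0 : ∀ Q, φ Q - Q ∈ I := by
    intro Q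
    induction Q using MvPolynomial.induction_on with
    | C a => simp [hφ]
    | add a b ha hb => 
      have : φ (a + b) - (a + b) = (φ a - a) + (φ b - b) := by rw [map_add]; ring
      rw [this]; exact I.add_mem ha hb
    | mul_X a i ha =>
      have : φ (a * X i) - a * X i = φ a * f i - a * X i := by rw [map_mul, hφ, aeval_X]
      rw [this]; exact I.sub_mem (I.mul_mem_left _ (hfI i)) (I.mul_mem_left _ (hX i))
  have h1 : ∀ Q ∈ I, φ Q ∈ I ∧ φ Q - Q ∈ I ^ 2 := by
    intro Q hQ
    refine ⟨?_, ?_⟩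
    · have := I.add_mem (h0 Q) hQ
      simpa using this
    · rw [hI, idealOfVars] at hQ
      induction hQ using Submodule.span_induction with
      | mem x hx =>
        obtain ⟨i, rfl⟩ := hx
        rw [hφ, aeval_X]; exact hf i
      | zero => simp
      | add a b _ _ ha hb =>
        have : φ (a + b) - (a + b) = (φ a - a) + (φ b - b) := by rw [map_add]; ring
        rw [this]; exact Ideal.add_mem _ ha hb
      | smul c a ha h =>
        have : φ (c • a) - c • a = φ c * (φ a - a) + (φ c - c) * a := by rw [smul_eq_mul, map_mul]; ring
        rw [this]
        refine Ideal.add_mem _ (Ideal.mul_mem_left _ _ h) ?_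
        rw [pow_two]; exact Ideal.mul_mem_mul (h0 c) ha
  have h2 : ∀ m : ℕ, ∀ Q ∈ I ^ m, φ Q - Q ∈ I ^ (m + 1) := by
    intro m
    induction m with
    | zero => intro Q _; simpa using h0 Q
    | succ m ih =>
      intro Q hQ
      rw [pow_succ'] at hQ
      induction hQ using Submodule.mul_induction_on' with
      | mem_mul_mem a ha b hb =>
        have : φ (a * b) - a * b = φ a * (φ b - b) + (φ a - a) * b := by rw [map_mul]; ring
        rw [this]
        refine Ideal.add_mem _ ?_ ?_
        · rw [pow_succ']; exact Ideal.mul_mem_mul (h1 a ha).1 (ih b hb)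
        · have : I ^ (m + 1 + 1) = I ^ 2 * I ^ m := by rw [← pow_add]; congr 1; omega
          rw [this]; exact Ideal.mul_mem_mul (h1 a ha).2 hb
      | add a _ b _ ha hb =>
        have : φ (a + b) - (a + b) = (φ a - a) + (φ b - b) := by rw [map_add]; ring
        rw [this]; exact Ideal.add_mem _ ha hb
  have h3 : ∀ m : ℕ, P ∈ I ^ m := by
    intro m
    induction m with
    | zero => simp
    | succ m ih =>
      have := h2 m P ih
      rw [hP, zero_sub] at this
      exact (Ideal.neg_mem_iff _).1 this
  ext x
  rw [coeff_zero]
  exact (mem_pow_idealOfVars_iff' (x.degree + 1) P).1 (h3 _) x (Nat.lt_succ_self _)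

theorem eval_nilp {F R : Type*} [CommRing F] [CommRing R] [Algebra F R] (q : Polynomial F) (e : R) (he : e * e = 0) :
    Polynomial.aeval e q = algebraMap F R (q.coeff 0) + q.coeff 1 • e := by
  have h1 : q = Polynomial.X * (Polynomial.X * q.divX.divX + Polynomial.C (q.coeff 1)) + Polynomial.C (q.coeff 0) := by
    have a1 := Polynomial.X_mul_divX_add q
    have a2 := Polynomial.X_mul_divX_add q.divX
    rw [Polynomial.coeff_divX] at a2
    rw [a2, a1]
  conv_lhs => rw [h1]
  simp only [map_add, map_mul, Polynomial.aeval_X, Polynomial.aeval_C]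
  rw [mul_add, ← mul_assoc, he, Algebra.smul_def]; ring

end Ct2
end PieceCt2

section PieceCt3
open Matrix

section Ct3
open MvPolynomial

theorem totalDegree_aeval_X {ι F : Type*} [Field F] (i : ι) (q : Polynomial F) :
    (Polynomial.aeval (X i : MvPolynomial ι F) q).totalDegree ≤ q.natDegree := by
  rw [Polynomial.aeval_eq_sum_range]
  refine totalDegree_finsetSum_le (fun k hk => ?_)
  refine (totalDegree_smul_le _ _).trans ((totalDegree_pow _ _).trans ?_)
  rw [totalDegree_X, mul_one]
  exact Nat.lt_succ_iff.1 (Finset.mem_range.1 hk)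

theorem exists_M {n p : ℕ} [Fact p.Prime] (hn : 2 ≤ n) (hnp : n ≤ p) {ι : Type*}
    (G : Subgroup (SpecialLinearGroup (Fin n) (ZMod p))) (u : ι → SpecialLinearGroup (Fin n) (ZMod p))
    (hu : ∀ i, u i ∈ G) (hun : ∀ i, ((u i).1 - 1)^n = 0)
    {R : Type*} [CommRing R] [Algebra (ZMod p) R] (π : MvPolynomial ι (ZMod p) →ₐ[ZMod p] R)
    (hπ : ∀ i j, π (X i) * π (X j) = 0) (s : Finset ι) :
    ∃ M : Matrix (Fin n) (Fin n) (MvPolynomial ι (ZMod p)),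
      (∀ t : ι → ZMod p, ∃ g ∈ G, M.map (eval t) = g.1) ∧ (∀ a b, (M a b).totalDegree ≤ n * s.card) ∧
      M.map π = 1 + ∑ i ∈ s, π (X i) • (lg p n (u i).1).map (algebraMap (ZMod p) R) := by
  classical
  induction s using Finset.induction with
  | empty =>
    refine ⟨1, fun t => ⟨1, G.one_mem, ?_⟩, ?_, ?_⟩
    · rw [Matrix.map_one _ (map_zero _) (map_one _)]; rfl
    · intro a b
      rw [Matrix.one_apply]; split_ifs <;> simp
    · rw [Matrix.map_one _ (map_zero _) (map_one _)]; simp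
  | insert i s his ih =>
    obtain ⟨M, h1, h2, h3⟩ := ih
    let A : Matrix (Fin n) (Fin n) (MvPolynomial ι (ZMod p)) := fun a b =>
      ∑ j ∈ Finset.range n, Polynomial.aeval (X i : MvPolynomial ι (ZMod p)) (bcp p j) * C ((((u i).1 - 1)^j) a b)
    have hA1 : ∀ t : ι → ZMod p, A.map (eval t) = ((u i) ^ (t i).val).1 := by
      intro t
      rw [Matrix.SpecialLinearGroup.coe_pow, uni_pow hnp _ (hun i)]
      ext a b
      rw [Matrix.sum_apply, Matrix.map_apply]
      simp only [A, map_sum, map_mul, eval_C, Matrix.smul_apply, smul_eq_mul]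
      refine Finset.sum_congr rfl (fun j _ => ?_)
      congr 1
      rw [ZMod.natCast_zmod_val]
      have : eval t (Polynomial.aeval (X i : MvPolynomial ι (ZMod p)) (bcp p j)) = (bcp p j).eval (t i) := by
        rw [← Polynomial.coe_aeval_eq_eval (t i)]
        have := Polynomial.aeval_algHom_apply (aeval t : MvPolynomial ι (ZMod p) →ₐ[ZMod p] ZMod p) (X i) (bcp p j)
        rw [aeval_X] at this
        rw [this]; rfl
      exact this
    have hA2 : ∀ a b, (A a b).totalDegree ≤ n := by
      intro a b
      refine totalDegree_finsetSum_le (fun j hj => ?_)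
      refine (totalDegree_mul _ _).trans ?_
      rw [totalDegree_C, add_zero]
      exact (totalDegree_aeval_X i _).trans ((bcp_natDegree p j).trans (Finset.mem_range.1 hj).le)
    have hone : ∑ j ∈ Finset.range n, (bcp p j).coeff 0 • ((u i).1 - 1)^j = 1 := by
      rw [Finset.sum_eq_single 0]
      · simp [bcp_zero]
      · intro b _ hb; rw [bcp_coeff_zero p b hb, zero_smul]
      · intro h; exact absurd (Finset.mem_range.2 (by omega)) h
    have hA3 : A.map π = 1 + π (X i) • (lg p n (u i).1).map (algebraMap (ZMod p) R) := by
      ext a b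
      have hq : ∀ j, π (Polynomial.aeval (X i : MvPolynomial ι (ZMod p)) (bcp p j)) = algebraMap _ R ((bcp p j).coeff 0) + (bcp p j).coeff 1 • π (X i) := by
        intro j
        rw [← Polynomial.aeval_algHom_apply, eval_nilp _ _ (hπ i i)]
      have hC : ∀ c, π (C c) = algebraMap (ZMod p) R c := fun c => π.commutes c
      have hlhs : (A.map π) a b = π (∑ j ∈ Finset.range n, Polynomial.aeval (X i : MvPolynomial ι (ZMod p)) (bcp p j) * C ((((u i).1 - 1)^j) a b)) := rfl
      rw [hlhs]
      simp only [Matrix.map_apply, map_sum, map_mul, hq, hC, Matrix.add_apply, Matrix.smul_apply, smul_eq_mul, add_mul, Finset.sum_add_distrib]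
      congr 1
      · have := congrArg (fun m : Matrix (Fin n) (Fin n) (ZMod p) => algebraMap (ZMod p) R (m a b)) hone
        simp only [Matrix.sum_apply, Matrix.smul_apply, smul_eq_mul, map_sum, map_mul] at this
        rw [this, Matrix.one_apply, Matrix.one_apply]; split_ifs <;> simp
      · rw [lg, Matrix.sum_apply, map_sum, Finset.mul_sum]
        refine Finset.sum_congr rfl (fun j _ => ?_)
        rw [Matrix.smul_apply, smul_eq_mul, map_mul, Algebra.smul_def]; ring
    refine ⟨A * M, ?_, ?_, ?_⟩
    · intro t
      obtain ⟨g, hg, hM⟩ := h1 t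
      refine ⟨(u i)^(t i).val * g, G.mul_mem (G.pow_mem (hu i) _) hg, ?_⟩
      rw [Matrix.map_mul, hA1, hM]; rfl
    · intro a b
      rw [Matrix.mul_apply]
      refine totalDegree_finsetSum_le (fun j _ => ?_)
      refine (totalDegree_mul _ _).trans ?_
      rw [Finset.card_insert_of_notMem his]
      have := hA2 a j; have := h2 j b
      nlinarith
    · have : (A * M).map π = A.map π * M.map π := Matrix.map_mul
      rw [this, hA3, h3, Finset.sum_insert his, add_mul, one_mul, mul_add, mul_one]
      have hz : (π (X i) • (lg p n (u i).1).map (algebraMap (ZMod p) R)) * ∑ j ∈ s, π (X j) • (lg p n (u j).1).map (algebraMap (ZMod p) R) = 0 := by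
        rw [Finset.mul_sum]
        refine Finset.sum_eq_zero (fun j _ => ?_)
        rw [smul_mul_smul_comm, hπ, zero_smul]
      rw [hz]; abel

end Ct3
end PieceCt3

section PieceCt4
open Matrix

section Ct4
open MvPolynomial

theorem card_lower {n p : ℕ} [Fact p.Prime] (hn : 2 ≤ n) (hnp : n ≤ p) {ι : Type} [Fintype ι]
    (G : Subgroup (SpecialLinearGroup (Fin n) (ZMod p))) (u : ι → SpecialLinearGroup (Fin n) (ZMod p))
    (hu : ∀ i, u i ∈ G) (hun : ∀ i, ((u i).1 - 1)^n = 0)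
    (hli : LinearIndependent (ZMod p) (fun i => lg p n (u i).1)) (D : ℕ)
    (hD : Fintype.card ι * (D * (n * Fintype.card ι)) ≤ p - 1) :
    (D + 1) ^ Fintype.card ι ≤ Nat.card G := by
  classical
  obtain ⟨L, hL⟩ := LinearMap.exists_leftInverse_of_injective (Finsupp.linearCombination (ZMod p) (fun i => lg p n (u i).1))
    (LinearMap.ker_eq_bot.2 hli)
  have hLi : ∀ i, L (lg p n (u i).1) = Finsupp.single i 1 := by
    intro i
    have := LinearMap.congr_fun hL (Finsupp.single i 1)
    simpa using this
  have hLx : ∀ (j : ι) (x : Matrix (Fin n) (Fin n) (ZMod p)), L x j = ∑ a, ∑ b, L (Matrix.single a b 1) j * x a b := by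
    intro j x
    conv_lhs => rw [Matrix.matrix_eq_sum_single x]
    rw [map_sum, Finsupp.finsetSum_apply]
    refine Finset.sum_congr rfl (fun r _ => ?_)
    rw [map_sum, Finsupp.finsetSum_apply]
    refine Finset.sum_congr rfl (fun s _ => ?_)
    rw [mul_comm, ← smul_eq_mul, ← Finsupp.smul_apply, ← map_smul, Matrix.smul_single, smul_eq_mul, mul_one]
  let I := idealOfVars ι (ZMod p)
  let π := Ideal.Quotient.mkₐ (ZMod p) (I ^ 2)
  have hπ : ∀ i j, π (X i) * π (X j) = 0 := by
    intro i j
    rw [← map_mul]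
    refine Ideal.Quotient.eq_zero_iff_mem.2 ?_
    rw [pow_two]
    exact Ideal.mul_mem_mul (Ideal.subset_span ⟨i, rfl⟩) (Ideal.subset_span ⟨j, rfl⟩)
  obtain ⟨M, hM1, hM2, hM3⟩ := exists_M hn hnp G u hu hun π hπ Finset.univ
  let f : ι → MvPolynomial ι (ZMod p) := fun j => ∑ a, ∑ b, C (L (Matrix.single a b 1) j) * M a b - C (L 1 j)
  have hC : ∀ c, π (C c) = algebraMap (ZMod p) _ c := fun c => π.commutes c
  have hf1 : ∀ j, f j - X j ∈ I ^ 2 := by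
    intro j
    refine Ideal.Quotient.eq_zero_iff_mem.1 ?_
    change π (f j - X j) = 0
    have hMab : ∀ a b, π (M a b) = algebraMap (ZMod p) _ ((1 : Matrix (Fin n) (Fin n) (ZMod p)) a b) + ∑ i, π (X i) * algebraMap (ZMod p) _ (lg p n (u i).1 a b) := by
      intro a b
      have := congrFun (congrFun hM3 a) b
      rw [Matrix.map_apply] at this
      rw [this, Matrix.add_apply, Matrix.sum_apply]
      congr 1
      rw [Matrix.one_apply, Matrix.one_apply]; split_ifs <;> simp
    have h1 : algebraMap (ZMod p) (MvPolynomial ι (ZMod p) ⧸ I ^ 2) (L 1 j) = ∑ a, ∑ b, algebraMap (ZMod p) _ (L (Matrix.single a b 1) j) * algebraMap (ZMod p) _ ((1 : Matrix (Fin n) (Fin n) (ZMod p)) a b) := by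
      rw [hLx j 1]; simp only [map_sum, map_mul]
    have h2 : ∀ i, ∑ a, ∑ b, algebraMap (ZMod p) (MvPolynomial ι (ZMod p) ⧸ I ^ 2) (L (Matrix.single a b 1) j) * algebraMap (ZMod p) _ (lg p n (u i).1 a b) = if i = j then 1 else 0 := by
      intro i
      have := hLx j (lg p n (u i).1)
      rw [hLi] at this
      have h3 := congrArg (algebraMap (ZMod p) (MvPolynomial ι (ZMod p) ⧸ I ^ 2)) this
      simp only [map_sum, map_mul] at h3
      rw [← h3, Finsupp.single_apply]; split_ifs <;> simp
    have h3 : π (f j) = ∑ a, ∑ b, algebraMap (ZMod p) _ (L (Matrix.single a b 1) j) * π (M a b) - algebraMap (ZMod p) _ (L 1 j) := by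
      simp only [f, map_sub, map_sum, map_mul, hC]
    have h4 : ∑ a, ∑ b, algebraMap (ZMod p) (MvPolynomial ι (ZMod p) ⧸ I ^ 2) (L (Matrix.single a b 1) j) * ∑ i, π (X i) * algebraMap (ZMod p) _ (lg p n (u i).1 a b) = π (X j) := by
      have : ∀ a b, algebraMap (ZMod p) (MvPolynomial ι (ZMod p) ⧸ I ^ 2) (L (Matrix.single a b 1) j) * ∑ i, π (X i) * algebraMap (ZMod p) _ (lg p n (u i).1 a b)
          = ∑ i, π (X i) * (algebraMap (ZMod p) (MvPolynomial ι (ZMod p) ⧸ I ^ 2) (L (Matrix.single a b 1) j) * algebraMap (ZMod p) _ (lg p n (u i).1 a b)) := by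
        intro a b
        rw [Finset.mul_sum]
        exact Finset.sum_congr rfl (fun i _ => by ring)
      simp only [this]
      have h5 : ∀ a, ∑ b, ∑ i, π (X i) * (algebraMap (ZMod p) (MvPolynomial ι (ZMod p) ⧸ I ^ 2) (L (Matrix.single a b 1) j) * algebraMap (ZMod p) _ (lg p n (u i).1 a b))
         = ∑ i, ∑ b, π (X i) * (algebraMap (ZMod p) (MvPolynomial ι (ZMod p) ⧸ I ^ 2) (L (Matrix.single a b 1) j) * algebraMap (ZMod p) _ (lg p n (u i).1 a b)) := fun a => Finset.sum_comm
      simp only [h5]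
      rw [Finset.sum_comm]
      simp only [← Finset.mul_sum, h2]
      simp
    rw [map_sub, h3, h1]
    simp only [hMab, mul_add, Finset.sum_add_distrib]
    rw [h4]; ring
  have hf2 : ∀ (t : ι → ZMod p), ∃ g : G, ∀ j, eval t (f j) = L g.1.1 j - L 1 j := by
    intro t
    obtain ⟨g, hg, hgM⟩ := hM1 t
    refine ⟨⟨g, hg⟩, fun j => ?_⟩
    rw [hLx j g.1, ← hgM]
    simp only [f, map_sub, map_sum, map_mul, eval_C, Matrix.map_apply]
  have hf3 : ∀ j, (f j).totalDegree ≤ n * Fintype.card ι := by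
    intro j
    refine (totalDegree_sub _ _).trans (max_le ?_ (by rw [totalDegree_C]; exact Nat.zero_le _))
    refine totalDegree_finsetSum_le (fun a _ => totalDegree_finsetSum_le (fun b _ => ?_))
    refine (totalDegree_mul _ _).trans ?_
    rw [totalDegree_C, zero_add]
    exact hM2 a b
  let T : ((ι → Fin (D + 1)) → ZMod p) →ₗ[ZMod p] (G → ZMod p) :=
    { toFun := fun c g => ∑ a, c a * ∏ j, (L g.1.1 j - L 1 j) ^ (a j : ℕ)
      map_add' := fun c c' => by
        funext g
        simp only [Pi.add_apply, add_mul, Finset.sum_add_distrib]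
      map_smul' := fun r c => by
        funext g
        simp only [Pi.smul_apply, smul_eq_mul, mul_assoc, RingHom.id_apply, Finset.mul_sum] }
  have hT : Function.Injective T := by
    rw [← LinearMap.ker_eq_bot, LinearMap.ker_eq_bot']
    intro c hc
    let e : (ι → Fin (D + 1)) → (ι →₀ ℕ) := fun a => Finsupp.equivFunOnFinite.symm (fun j => (a j : ℕ))
    have he : Function.Injective e := by
      intro a b hab
      funext j
      have := DFunLike.congr_fun hab j
      exact Fin.ext this
    let P : MvPolynomial ι (ZMod p) := ∑ a, monomial (e a) (c a)
    have hPf : aeval f P = ∑ a, C (c a) * ∏ j, f j ^ (a j : ℕ) := by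
      simp only [P, map_sum]
      refine Finset.sum_congr rfl (fun a _ => ?_)
      rw [aeval_monomial, Finsupp.prod_fintype _ _ (fun i => pow_zero _)]
      rfl
    have hP0 : aeval f P = 0 := by
      refine MvPolynomial.eq_zero_of_eval_eq_zero (σ := ι) (K := ZMod p) (aeval f P) ?_ ?_
      · intro t
        obtain ⟨g, hg⟩ := hf2 t
        have := congrFun hc g
        rw [hPf]
        simp only [map_sum, map_mul, eval_C, map_prod, map_pow, hg]
        exact this
      · rw [ZMod.card, mem_restrictDegree]
        intro s hs i
        have h1 : s i ≤ (aeval f P).totalDegree := by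
          refine le_trans ?_ (le_totalDegree hs)
          rw [Finsupp.sum_fintype _ _ (fun _ => rfl)]
          exact Finset.single_le_sum (f := fun i => s i) (fun _ _ => Nat.zero_le _) (Finset.mem_univ i)
        refine h1.trans (le_trans ?_ hD)
        rw [hPf]
        refine totalDegree_finsetSum_le (fun a _ => ?_)
        refine (totalDegree_mul _ _).trans ?_
        rw [totalDegree_C, zero_add]
        refine (totalDegree_finset_prod _ _).trans ?_
        rw [← Finset.card_univ, ← smul_eq_mul]
        refine Finset.sum_le_card_nsmul _ _ _ (fun j _ => ?_)
        refine (totalDegree_pow _ _).trans ?_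
        exact Nat.mul_le_mul (Nat.lt_succ_iff.1 (a j).2) (hf3 j)
    have hPz : P = 0 := subst_inj f hf1 P hP0
    funext a
    have := congrArg (coeff (e a)) hPz
    rw [coeff_zero] at this
    simp only [P, coeff_sum, coeff_monomial, he.eq_iff] at this
    simpa using this
  have := LinearMap.finrank_le_finrank_of_injective hT
  rw [Module.finrank_fintype_fun_eq_card, Module.finrank_fintype_fun_eq_card] at this
  rw [Nat.card_eq_fintype_card]
  simpa using this

end Ct4
end PieceCt4

section PieceFin0
open Matrix

section FinPart

theorem top_of_full {n p : ℕ} [Fact p.Prime] (hn : 2 ≤ n) (G : Subgroup (SpecialLinearGroup (Fin n) (ZMod p)))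
    (hG : ∀ X : Matrix (Fin n) (Fin n) (ZMod p), X.trace = 0 → X ∈ Lsp G)
    (hp : 2 * (n * n * n * (n * n)) ^ (n * n - 1) < p) : G = ⊤ := by
  classical
  have hp2 : 2 ≤ p := (Fact.out : p.Prime).two_le
  have hn4 : 4 ≤ n * n := by nlinarith
  set d := n * n - 1 with hd
  set B := n * n * n * (n * n) with hB
  have hB1 : 1 ≤ B := by
    have : 0 < n * n * n * (n * n) := by positivity
    exact this
  have hBd : B ≤ B ^ d := by
    calc B = B ^ 1 := (pow_one B).symm
      _ ≤ B ^ d := Nat.pow_le_pow_right hB1 (by omega)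
  have hBp : B < p := by omega
  have hnp : n ≤ p := by
    have : n ≤ B := by rw [hB]; nlinarith [Nat.zero_le (n*n*n)]
    omega
  let S : Set (Matrix (Fin n) (Fin n) (ZMod p)) := {x | ∃ u ∈ G, (u.1 - 1)^n = 0 ∧ x = lg p n u.1}
  obtain ⟨b, hbS, hspan, hli⟩ := exists_linearIndependent (ZMod p) S
  haveI : Fintype b := Fintype.ofFinite b
  have hcard : Fintype.card b = d := by
    have h1 : Module.finrank (ZMod p) (Submodule.span (ZMod p) b) = Fintype.card b := by
      have := finrank_span_eq_card hli
      rwa [Subtype.range_coe] at this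
    have h2 : Submodule.span (ZMod p) b = LinearMap.ker (Matrix.traceLinearMap (Fin n) (ZMod p) (ZMod p)) := by
      rw [hspan]
      ext X
      rw [LinearMap.mem_ker, Matrix.traceLinearMap_apply]
      exact ⟨fun h => Lsp_trace hn G X h, fun h => hG X h⟩
    have h3 := LinearMap.finrank_range_add_finrank_ker (Matrix.traceLinearMap (Fin n) (ZMod p) (ZMod p))
    have h4 : LinearMap.range (Matrix.traceLinearMap (Fin n) (ZMod p) (ZMod p)) = ⊤ := by
      rw [LinearMap.range_eq_top]
      intro c
      exact ⟨Matrix.single ⟨0, by omega⟩ ⟨0, by omega⟩ c, by simp [Matrix.trace_single_eq_same]⟩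
    rw [h4, finrank_top, Module.finrank_self, ← h2, h1, Module.finrank_matrix] at h3
    simp only [Fintype.card_fin, Module.finrank_self, mul_one] at h3
    omega
  have hch : ∀ i : b, ∃ u ∈ G, (u.1 - 1)^n = 0 ∧ i.1 = lg p n u.1 := fun i => hbS i.2
  choose u hu hun hlg using hch
  have hli' : LinearIndependent (ZMod p) (fun i => lg p n (u i).1) := by
    have : (fun i => lg p n (u i).1) = (fun i : b => i.1) := funext (fun i => (hlg i).symm)
    rw [this]; exact hli
  set D := (p - 1) / B with hDdef
  have hDB : D * B ≤ p - 1 := Nat.div_mul_le_self _ _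
  have hDB2 : p ≤ (D + 1) * B := by
    have := Nat.lt_div_mul_add (a := p - 1) (b := B) hB1
    rw [← hDdef] at this
    rw [add_mul, one_mul]
    omega
  have hlow := card_lower hn hnp G u hu hun hli' D (by
    rw [hcard]
    refine le_trans ?_ hDB
    have hdn : d ≤ n * n := by omega
    calc d * (D * (n * d)) = D * (d * n * d) := by ring
      _ ≤ D * ((n * n) * n * (n * n)) := Nat.mul_le_mul_left _ (Nat.mul_le_mul (Nat.mul_le_mul_right _ hdn) hdn)
      _ = D * B := by rw [hB])
  rw [hcard] at hlow
  have h5 : p ^ d ≤ Nat.card G * B ^ d := by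
    calc p ^ d ≤ ((D + 1) * B) ^ d := Nat.pow_le_pow_left hDB2 d
      _ = (D + 1) ^ d * B ^ d := mul_pow _ _ _
      _ ≤ _ := Nat.mul_le_mul_right _ hlow
  have h6 := card_SL_le (n := n) (p := p) hn
  have h7 : Nat.card (SpecialLinearGroup (Fin n) (ZMod p)) ≤ 2 * p ^ d := by
    have h8 : p ^ (n * n) = p ^ d * p := by rw [← pow_succ]; congr 1; omega
    rw [h8] at h6
    have h9 : p ≤ 2 * (p - 1) := by omega
    have : Nat.card (SpecialLinearGroup (Fin n) (ZMod p)) * (p - 1) ≤ (2 * p ^ d) * (p - 1) := by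
      refine h6.trans ?_
      calc p ^ d * p ≤ p ^ d * (2 * (p - 1)) := Nat.mul_le_mul_left _ h9
        _ = _ := by ring
    exact Nat.le_of_mul_le_mul_right this (by omega)
  have h10 := G.card_mul_index
  have hG0 : 0 < Nat.card G := Nat.card_pos
  apply eq_top_of_index hn
  have h11 : Nat.card G * G.index ≤ Nat.card G * (2 * B ^ d) := by
    rw [h10]
    refine h7.trans ?_
    calc 2 * p ^ d ≤ 2 * (Nat.card G * B ^ d) := Nat.mul_le_mul_left _ h5
      _ = _ := by ring
  exact lt_of_le_of_lt (Nat.le_of_mul_le_mul_left h11 hG0) hp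

theorem main_thm (n : ℕ) (hn : n.Prime) (hodd : Odd n)
    (H : Subgroup (SL n ℤ)) (hirr : IrreducibleQ H)
    (hsbf : ¬ SolvableByFinite H) (hiso : ¬ IsometryGroupQ H) :
    {p : ℕ | p.Prime ∧ H.map (redMod n p) ≠ ⊤}.Finite := by
  by_contra hinf
  let T : Set Nat.Primes := {p | H.map (redMod n p) ≠ ⊤}
  have hT : T.Infinite := by
    intro hfin
    apply hinf
    refine (hfin.image (fun p : Nat.Primes => (p : ℕ))).subset ?_
    rintro p ⟨hp, hne⟩
    exact ⟨⟨p, hp⟩, hne, rfl⟩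
  haveI : Filter.NeBot (Filter.cofinite ⊓ Filter.principal T) := Set.Infinite.cofinite_inf_principal_neBot hT
  let U : Ultrafilter Nat.Primes := Ultrafilter.of (Filter.cofinite ⊓ Filter.principal T)
  have hUle : (U : Filter Nat.Primes) ≤ Filter.cofinite ⊓ Filter.principal T := Ultrafilter.of_le _
  have hU : (U : Filter Nat.Primes) ≤ Filter.cofinite := hUle.trans inf_le_left
  have hUT : ∀ᶠ p : Nat.Primes in (U : Filter Nat.Primes), p ∈ T := (hUle.trans inf_le_right) (Filter.mem_principal_self T)
  have hlarge : ∀ᶠ p : Nat.Primes in (U : Filter Nat.Primes), 2 * (n * n * n * (n * n)) ^ (n * n - 1) < (p : ℕ) := by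
    refine hU ?_
    rw [Filter.mem_cofinite]
    refine (Set.Finite.preimage (f := fun p : Nat.Primes => (p : ℕ)) (Subtype.val_injective.injOn) (Set.finite_le_nat (2 * (n * n * n * (n * n)) ^ (n * n - 1)))).subset ?_
    intro p hp
    have hp' : ¬ (2 * (n * n * n * (n * n)) ^ (n * n - 1) < (p : ℕ)) := hp
    exact not_lt.1 hp'
  obtain ⟨p, h1, h2, h3⟩ := ((full_lie hn hodd H hirr hsbf hiso U hU).and (hlarge.and hUT)).exists
  exact h3 (top_of_full hn.two_le _ h1 h2)

end FinPart
end PieceFin0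

/-- For odd prime `n`, if `H ≤ SL(n,ℤ)` is finitely generated, irreducible,
not solvable-by-finite, and not an isometry group, then `Π(H)` is finite. -/
theorem exceptional_primes_finite_of_irreducible (n : ℕ) (hn : n.Prime) (hodd : Odd n)
    (H : Subgroup (SL n ℤ)) (hFG : H.FG) (hirr : IrreducibleQ H)
    (hsbf : ¬ SolvableByFinite H) (hiso : ¬ IsometryGroupQ H) :
    {p : ℕ | p.Prime ∧ H.map (redMod n p) ≠ ⊤}.Finite := by
  exact main_thm n hn hodd H hirr hsbf hiso
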